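/- Let n ≥ 3 and let F = (α+β)²/α be a square metric on a connected open set U ⊆ ℝⁿ (with 0 < b² < 1 on U). If F is of scalar flag curvature on U, then there exist smooth functions τ(x) and λ(x) on U such that: (E1) b_{i|j} = τ{(1+2b²)a_{ij} − 3b_ib_j}; (E2) R̄ⁱ_k = λ(α²δⁱ_k − yⁱȳ_k) + 2η(β²δⁱ_k + α²bⁱb_k − β bⁱȳ_k − β b_kyⁱ); and (E3) ∂τ/∂xⁱ = u·b_i, where η := λ + 4(2+b²)τ² and u := −(7+4b²)τ² − λ. -/

import Mathlib

open scoped BigOperators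

noncomputable section

abbrev Vec (n : ℕ) := Fin n → ℝ

/-- Partial derivative of a function on `ℝⁿ` in the `k`-th coordinate direction. -/
def pd {n : ℕ} (f : Vec n → ℝ) (k : Fin n) (x : Vec n) : ℝ :=
  fderiv ℝ f x (Pi.single k 1)

/-- Partial derivative in the base (`x`) variable of a function of `(x, y)`. -/
def pdx {n : ℕ} (f : Vec n → Vec n → ℝ) (k : Fin n) (x y : Vec n) : ℝ :=
  fderiv ℝ (fun x' => f x' y) x (Pi.single k 1)

/-- Partial derivative in the fiber (`y`) variable of a function of `(x, y)`. -/
def pdy {n : ℕ} (f : Vec n → Vec n → ℝ) (k : Fin n) (x y : Vec n) : ℝ :=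
  fderiv ℝ (fun y' => f x y') y (Pi.single k 1)

/-- The fundamental tensor `g_{ij} = ½ ∂²(F²)/∂yⁱ∂yʲ` of a Finsler metric `F`. -/
def fundTensor {n : ℕ} (F : Vec n → Vec n → ℝ) (x y : Vec n) : Matrix (Fin n) (Fin n) ℝ :=
  Matrix.of fun i j => (1/2) * pdy (fun x y => pdy (fun x y => (F x y)^2) j x y) i x y

/-- The geodesic coefficients `Gⁱ = ¼ g^{il}(yᵏ ∂²(F²)/∂xᵏ∂yˡ − ∂(F²)/∂xˡ)`. -/
def geoCoeff {n : ℕ} (F : Vec n → Vec n → ℝ) (i : Fin n) (x y : Vec n) : ℝ :=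
  (1/4) * ∑ l, (fundTensor F x y)⁻¹ i l *
    ((∑ k, y k * pdx (fun x y => pdy (fun x y => (F x y)^2) l x y) k x y)
      - pdx (fun x y => (F x y)^2) l x y)

/-- Riemann curvature `Rⁱ_k` associated to a spray `G`. -/
def curvOfSpray {n : ℕ} (G : Fin n → Vec n → Vec n → ℝ) (i k : Fin n) (x y : Vec n) : ℝ :=
  2 * pdx (G i) k x y
  - ∑ j, y j * pdx (fun x y => pdy (G i) k x y) j x y
  + 2 * ∑ j, G j x y * pdy (fun x y => pdy (G i) k x y) j x y
  - ∑ j, pdy (G i) j x y * pdy (G j) k x y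

/-- Christoffel symbols `Γᵏ_{ij}` of a Riemannian metric field. -/
def christoffel {n : ℕ} (g : Vec n → Matrix (Fin n) (Fin n) ℝ) (k i j : Fin n) (x : Vec n) : ℝ :=
  (1/2) * ∑ l, (g x)⁻¹ k l *
    (pd (fun x => g x l i) j x + pd (fun x => g x l j) i x - pd (fun x => g x i j) l x)

/-- The geodesic spray `Gⁱ_α = ½ Γⁱ_{jk} yʲ yᵏ` of a Riemannian metric. -/
def sprayOf {n : ℕ} (g : Vec n → Matrix (Fin n) (Fin n) ℝ) (i : Fin n) (x y : Vec n) : ℝ :=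
  (1/2) * ∑ j, ∑ k, christoffel g i j k x * y j * y k

/-- Covariant derivative `b_{i|j}` of a 1-form w.r.t. a Riemannian metric. -/
def covDeriv {n : ℕ} (g : Vec n → Matrix (Fin n) (Fin n) ℝ) (b : Vec n → Vec n)
    (i j : Fin n) (x : Vec n) : ℝ :=
  pd (fun x => b x i) j x - ∑ k, b x k * christoffel g k i j x

/-- `b² = a^{ij} b_i b_j`. -/
def bsq {n : ℕ} (a : Vec n → Matrix (Fin n) (Fin n) ℝ) (b : Vec n → Vec n) (x : Vec n) : ℝ :=
  ∑ i, ∑ j, (a x)⁻¹ i j * b x i * b x j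

/-- `α(x,y) = √(a_{ij}(x) yⁱ yʲ)`. -/
def alphaOf {n : ℕ} (a : Vec n → Matrix (Fin n) (Fin n) ℝ) (x y : Vec n) : ℝ :=
  Real.sqrt (∑ i, ∑ j, a x i j * y i * y j)

/-- `β(x,y) = b_i(x) yⁱ`. -/
def betaOf {n : ℕ} (b : Vec n → Vec n) (x y : Vec n) : ℝ := ∑ i, b x i * y i

/-- The square metric `F = (α+β)²/α`. -/
def sqMetric {n : ℕ} (a : Vec n → Matrix (Fin n) (Fin n) ℝ) (b : Vec n → Vec n)
    (x y : Vec n) : ℝ :=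
  (alphaOf a x y + betaOf b x y)^2 / alphaOf a x y

/-- `F` is of scalar flag curvature on `U`. -/
def IsScalarFlag {n : ℕ} (U : Set (Vec n)) (F : Vec n → Vec n → ℝ) : Prop :=
  ∃ K : Vec n → Vec n → ℝ, ∀ x ∈ U, ∀ y : Vec n, y ≠ 0 → ∀ i k : Fin n,
    curvOfSpray (geoCoeff F) i k x y =
      K x y * ((F x y)^2 * (if i = k then (1:ℝ) else 0)
        - y i * ∑ j, fundTensor F x y k j * y j)

/-- Conditions (E1)–(E3). -/
def E123 {n : ℕ} (U : Set (Vec n)) (a : Vec n → Matrix (Fin n) (Fin n) ℝ)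
    (b : Vec n → Vec n) (τ lam : Vec n → ℝ) : Prop :=
  (∀ x ∈ U, ∀ i j : Fin n, covDeriv a b i j x =
      τ x * ((1 + 2 * bsq a b x) * a x i j - 3 * b x i * b x j)) ∧
  (∀ x ∈ U, ∀ y : Vec n, ∀ i k : Fin n,
      curvOfSpray (sprayOf a) i k x y =
        lam x * ((alphaOf a x y)^2 * (if i = k then (1:ℝ) else 0)
            - y i * (∑ j, a x k j * y j))
        + 2 * (lam x + 4 * (2 + bsq a b x) * (τ x)^2) *
          ((betaOf b x y)^2 * (if i = k then (1:ℝ) else 0)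
            + (alphaOf a x y)^2 * (∑ j, (a x)⁻¹ i j * b x j) * b x k
            - betaOf b x y * (∑ j, (a x)⁻¹ i j * b x j) * (∑ j, a x k j * y j)
            - betaOf b x y * b x k * y i)) ∧
  (∀ x ∈ U, ∀ i : Fin n, pd τ i x =
      (-(7 + 4 * bsq a b x) * (τ x)^2 - lam x) * b x i)

section

lemma Derivation.sum_apply' {ι A : Type*} [CommRing A] [Algebra ℝ A] (s : Finset ι)
    (D : ι → Derivation ℝ A A) (f : A) : (∑ i ∈ s, D i) f = ∑ i ∈ s, D i f := by
  rw [← Derivation.coeFnAddMonoidHom_apply, map_sum, Finset.sum_apply]; rfl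

/-- Commuting base derivations `X` and fibre derivations `Y` with fibre coordinates `y`. -/
structure FibreCalculus (n : ℕ) (A : Type*) [CommRing A] [Algebra ℝ A] where
  X : Fin n → Derivation ℝ A A
  Y : Fin n → Derivation ℝ A A
  y : Fin n → A
  X_X : ∀ i j f, X i (X j f) = X j (X i f)
  Y_X : ∀ i j f, Y i (X j f) = X j (Y i f)
  Y_Y : ∀ i j f, Y i (Y j f) = Y j (Y i f)
  X_y : ∀ i j, X i (y j) = 0
  Y_y : ∀ i j, Y i (y j) = if i = j then 1 else 0

namespace FibreCalculus

variable {n : ℕ} {A : Type*} [CommRing A] [Algebra ℝ A] (c : FibreCalculus n A)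

/-- The derivative along the fibre vector field with components `v`. -/
def along (v : Fin n → A) : Derivation ℝ A A := ∑ j, v j • c.Y j

/-- The spray vector field with geodesic coefficients `G`. -/
def spray (G : Fin n → A) : Derivation ℝ A A :=
  ∑ j, c.y j • c.X j - (2 : A) • c.along G

/-- The horizontal derivative in direction `k` of the spray `G`. -/
def hor (G : Fin n → A) (k : Fin n) : Derivation ℝ A A :=
  c.X k - c.along fun j => c.Y k (G j)

/-- The Riemann curvature of the spray `G`. -/
def curv (G : Fin n → A) (i k : Fin n) : A :=
  2 * c.X k (G i) - ∑ j, c.y j * c.X j (c.Y k (G i))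
    + 2 * ∑ j, G j * c.Y j (c.Y k (G i)) - ∑ j, c.Y j (G i) * c.Y k (G j)

lemma along_apply (v : Fin n → A) (f : A) : c.along v f = ∑ j, v j * c.Y j f := by
  simp only [along, Derivation.sum_apply', Derivation.smul_apply, smul_eq_mul]

lemma spray_apply (G : Fin n → A) (f : A) :
    c.spray G f = ∑ j, c.y j * c.X j f - 2 * c.along G f := by
  simp only [spray, Derivation.sub_apply, Derivation.sum_apply',
    Derivation.smul_apply, smul_eq_mul]

lemma hor_apply (G : Fin n → A) (k : Fin n) (f : A) :
    c.hor G k f = c.X k f - c.along (fun j => c.Y k (G j)) f := rfl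

lemma along_y (v : Fin n → A) (i : Fin n) : c.along v (c.y i) = v i := by
  simp [along_apply, c.Y_y]

lemma along_add (v w : Fin n → A) (f : A) :
    c.along (fun j => v j + w j) f = c.along v f + c.along w f := by
  simp [along_apply, add_mul, Finset.sum_add_distrib]

lemma along_mul (g : A) (v : Fin n → A) (f : A) :
    c.along (fun j => g * v j) f = g * c.along v f := by
  simp [along_apply, mul_assoc, Finset.mul_sum]

lemma Y_along (k : Fin n) (v : Fin n → A) (f : A) :
    c.Y k (c.along v f) = c.along v (c.Y k f) + c.along (fun j => c.Y k (v j)) f := by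
  simp only [along_apply, map_sum, Derivation.leibniz, smul_eq_mul, ← Finset.sum_add_distrib]
  refine Finset.sum_congr rfl fun j _ => ?_
  rw [c.Y_Y k j]; ring

lemma X_along (k : Fin n) (v : Fin n → A) (f : A) :
    c.X k (c.along v f) = c.along v (c.X k f) + c.along (fun j => c.X k (v j)) f := by
  simp only [along_apply, map_sum, Derivation.leibniz, smul_eq_mul, ← Finset.sum_add_distrib]
  refine Finset.sum_congr rfl fun j _ => ?_
  rw [c.Y_X j k]; ring

lemma Y_euler (k : Fin n) (f : A) :
    c.Y k (c.along c.y f) = c.along c.y (c.Y k f) + c.Y k f := by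
  rw [Y_along]; congr 1
  simp [along_apply, c.Y_y]

lemma spray_Y (G : Fin n → A) (k : Fin n) (f : A) :
    c.spray G (c.Y k f) =
      c.Y k (c.spray G f) - c.X k f + 2 * c.along (fun j => c.Y k (G j)) f := by
  have h : c.Y k (∑ j, c.y j * c.X j f) = ∑ j, c.y j * c.X j (c.Y k f) + c.X k f := by
    simp [Derivation.leibniz, c.Y_y, Finset.sum_add_distrib, c.Y_X]
  have h2 : c.Y k (2 * c.along G f) = 2 * c.Y k (c.along G f) := by
    rw [two_mul, map_add, two_mul]
  rw [spray_apply, spray_apply, map_sub, h, h2, Y_along]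
  ring

lemma spray_X (G : Fin n → A) (k : Fin n) (f : A) :
    c.spray G (c.X k f) =
      c.X k (c.spray G f) + 2 * c.along (fun j => c.X k (G j)) f := by
  have h : c.X k (∑ j, c.y j * c.X j f) = ∑ j, c.y j * c.X j (c.X k f) := by
    simp [Derivation.leibniz, c.X_y, c.X_X k]
  have h2 : c.X k (2 * c.along G f) = 2 * c.X k (c.along G f) := by
    rw [two_mul, map_add, two_mul]
  rw [spray_apply, spray_apply, map_sub, h, h2, X_along]
  ring

lemma curv_eq (G : Fin n → A) (i k : Fin n) :
    c.curv G i k = 2 * c.X k (G i) - c.spray G (c.Y k (G i))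
      - c.along (fun j => c.Y k (G j)) (G i) := by
  simp only [curv, spray_apply, along_apply]
  simp only [mul_comm (c.Y k (G _))]
  ring

/-- The curvature is the vertical part of the commutator of the spray with the
horizontal fields. -/
lemma sum_curv_mul (G : Fin n → A) (k : Fin n) (f : A) :
    ∑ l, c.curv G l k * c.Y l f =
      c.spray G (c.hor G k f) - c.hor G k (c.spray G f)
        - ∑ l, c.Y k (G l) * c.hor G l f := by
  have e1 : c.spray G (c.along (fun j => c.Y k (G j)) f)
      = ∑ l, (c.spray G (c.Y k (G l)) * c.Y l f + c.Y k (G l) * c.spray G (c.Y l f)) := by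
    rw [along_apply, map_sum]
    refine Finset.sum_congr rfl fun l _ => ?_
    rw [Derivation.leibniz]; simp only [smul_eq_mul]; ring
  have e2 : ∑ l, c.along (fun j => c.Y k (G j)) (G l) * c.Y l f
      = ∑ l, c.Y k (G l) * c.along (fun j => c.Y l (G j)) f := by
    simp only [along_apply, Finset.sum_mul, Finset.mul_sum]
    rw [Finset.sum_comm]
    refine Finset.sum_congr rfl fun l _ => Finset.sum_congr rfl fun j _ => by ring
  have e3 : ∑ l, c.curv G l k * c.Y l f
      = ∑ l, (2 * c.X k (G l) * c.Y l f - c.spray G (c.Y k (G l)) * c.Y l f)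
        - ∑ l, c.along (fun j => c.Y k (G j)) (G l) * c.Y l f := by
    rw [← Finset.sum_sub_distrib]
    refine Finset.sum_congr rfl fun l _ => by rw [curv_eq]; ring
  rw [hor_apply, hor_apply, map_sub, spray_X, e1, e3, e2]
  simp only [hor_apply, along_apply c (fun j => c.X k (G j)),
    along_apply c (fun j => c.Y k (G j)), spray_Y, Finset.mul_sum]
  rw [← sub_eq_zero]
  simp only [mul_sub, mul_add, add_mul, sub_mul, Finset.sum_add_distrib, Finset.sum_sub_distrib,
    mul_assoc,
    mul_left_comm _ (2 : A), ← Finset.mul_sum]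
  ring

/-- Curvature under a projective change of the spray. -/
lemma curv_projective (G : Fin n → A) (P : A) (hG : ∀ i, c.along c.y (G i) = 2 * G i)
    (hP : c.along c.y P = P) :
    ∃ (a : A) (b : Fin n → A), ∀ i k, c.curv (fun i => G i + P * c.y i) i k =
      c.curv G i k + a * (if i = k then 1 else 0) + b k * c.y i := by
  have hS : ∀ f, c.spray (fun i => G i + P * c.y i) f
      = c.spray G f - 2 * P * c.along c.y f := by
    intro f; rw [spray_apply, spray_apply, along_add, along_mul]; ring
  have hYY : ∀ i k, c.along c.y (c.Y k (G i)) = c.Y k (G i) := by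
    intro i k
    have := c.Y_euler k (G i)
    rw [hG, two_mul, map_add] at this
    linear_combination -this
  have hYP : ∀ k, c.along c.y (c.Y k P) = 0 := by
    intro k
    have := c.Y_euler k P
    rw [hP] at this
    linear_combination -this
  have hY : ∀ i k, c.Y k (G i + P * c.y i)
      = c.Y k (G i) + c.Y k P * c.y i + P * (if k = i then 1 else 0) := by
    intro i k; rw [map_add, Derivation.leibniz, c.Y_y]; simp only [smul_eq_mul]; ring
  have hD : ∀ (D : Derivation ℝ A A) (i k : Fin n), D (if k = i then 1 else 0) = 0 := by
    intro D i k; split_ifs <;> simp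
  have hSy : ∀ i, c.spray G (c.y i) = - 2 * G i := by
    intro i; rw [spray_apply, along_y]; simp [c.X_y]
  refine ⟨-(c.spray G P) + P ^ 2,
    fun k => 2 * c.X k P - c.spray G (c.Y k P) - c.along (fun j => c.Y k (G j)) P - c.Y k P * P,
    fun i k => ?_⟩
  rw [curv_eq, curv_eq, hS]
  have h1 : c.along (fun j => c.Y k (G j + P * c.y j)) (G i + P * c.y i)
      = c.along (fun j => c.Y k (G j)) (G i + P * c.y i)
        + c.Y k P * c.along c.y (G i + P * c.y i) + P * c.Y k (G i + P * c.y i) := by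
    have h2 : c.along (fun j => P * (if k = j then 1 else 0)) (G i + P * c.y i)
        = P * c.Y k (G i + P * c.y i) := by simp [along_apply]
    simp only [hY i k] at h2
    simp only [hY]
    rw [along_add, along_add, along_mul, h2]
  have hy : ∀ i, c.along c.y (c.y i) = c.y i := fun i => c.along_y c.y i
  rw [h1, hY]
  simp only [map_add, Derivation.leibniz, smul_eq_mul, hD, hYY, hYP, hG, hP, hSy, hy, c.X_y,
    along_y]
  simp only [eq_comm (a := k) (b := i)]
  ring

end FibreCalculus

end

section

namespace FibreCalculus

variable {n : ℕ} {A : Type*} [CommRing A] [Algebra ℝ A] (c : FibreCalculus n A)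

/-- A subalgebra containing the fibre coordinates and stable under all derivations. -/
structure IsStable (R : Subalgebra ℝ A) : Prop where
  X_mem : ∀ k, ∀ f ∈ R, c.X k f ∈ R
  Y_mem : ∀ k, ∀ f ∈ R, c.Y k f ∈ R
  y_mem : ∀ k, c.y k ∈ R

variable {c} {R : Subalgebra ℝ A}

lemma two_mem_subalgebra (R : Subalgebra ℝ A) : (2 : A) ∈ R := by
  have := R.algebraMap_mem 2
  rwa [map_ofNat] at this

lemma IsStable.along_mem (hR : c.IsStable R) {v : Fin n → A} (hv : ∀ i, v i ∈ R) {f : A}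
    (hf : f ∈ R) : c.along v f ∈ R := by
  rw [along_apply]
  exact R.sum_mem fun j _ => R.mul_mem (hv j) (hR.Y_mem j f hf)

lemma IsStable.spray_mem (hR : c.IsStable R) {v : Fin n → A} (hv : ∀ i, v i ∈ R) {f : A}
    (hf : f ∈ R) : c.spray v f ∈ R := by
  rw [spray_apply]
  exact R.sub_mem (R.sum_mem fun j _ => R.mul_mem (hR.y_mem j) (hR.X_mem j f hf))
    (R.mul_mem (two_mem_subalgebra R) (hR.along_mem hv hf))

lemma derivation_inv (δ : Derivation ℝ A A) {D D' : A} (h : D * D' = 1) :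
    δ D' = - δ D * D' ^ 2 := by
  have h1 : δ (D * D') = 0 := by rw [h]; simp
  rw [Derivation.leibniz] at h1
  simp only [smul_eq_mul] at h1
  linear_combination D' * h1 - δ D' * h

variable (c)

/-- Expansion of the curvature of the spray `P + B / D` in powers of `1 / D`. -/
lemma curv_expansion (P B : Fin n → A) {D D' : A} (h : D * D' = 1) (i k : Fin n) :
    c.curv (fun i => P i + B i * D') i k =
      c.curv P i k
      + (2 * c.X k (B i) - c.spray P (c.Y k (B i)) + 2 * c.along B (c.Y k (P i))
        - c.along (fun j => c.Y k (P j)) (B i) - c.along (fun j => c.Y k (B j)) (P i)) * D'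
      + (- 2 * B i * c.X k D + 2 * c.along B (c.Y k (B i)) + c.Y k (B i) * c.spray P D
        + c.spray P (B i * c.Y k D) + B i * c.along (fun j => c.Y k (P j)) D
        - c.along (fun j => c.Y k (B j)) (B i) + c.Y k D * c.along B (P i)) * D' ^ 2
      + (- 2 * c.along B D * c.Y k (B i) - 2 * c.along B (B i * c.Y k D)
        - 2 * B i * c.Y k D * c.spray P D + B i * c.along (fun j => c.Y k (B j)) D
        + c.Y k D * c.along B (B i)) * D' ^ 3
      + 3 * c.along B D * c.Y k D * B i * D' ^ 4 := by
  have hS : ∀ f, c.spray (fun i => P i + B i * D') f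
      = c.spray P f - 2 * D' * c.along B f := by
    intro f
    have : (fun i => P i + B i * D') = fun i => P i + D' * B i := by
      ext i; rw [mul_comm D']
    rw [this, spray_apply, spray_apply, along_add, along_mul]; ring
  have hY : ∀ i k, c.Y k (P i + B i * D')
      = c.Y k (P i) + D' * c.Y k (B i) + (- c.Y k D * D' ^ 2) * B i := by
    intro i k
    rw [map_add, Derivation.leibniz, derivation_inv _ h]; simp only [smul_eq_mul]; ring
  rw [curv_eq, curv_eq, hS]
  simp only [hY]
  rw [along_add, along_add, along_mul, along_mul]
  simp only [map_add, map_neg, Derivation.leibniz, Derivation.leibniz_pow, smul_eq_mul,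
    nsmul_eq_mul, derivation_inv _ h]
  ring

variable {c}

lemma curv_mem (hR : c.IsStable R) {P : Fin n → A} (hP : ∀ i, P i ∈ R) (i k : Fin n) :
    c.curv P i k ∈ R := by
  rw [curv_eq]
  repeat' first
    | assumption
    | exact hP _
    | exact two_mem_subalgebra R
    | intro _
    | apply hR.X_mem
    | apply hR.Y_mem
    | apply hR.along_mem
    | apply hR.spray_mem
    | apply R.add_mem
    | apply R.sub_mem
    | apply R.mul_mem

lemma curv_pole_four (hR : c.IsStable R) {P B : Fin n → A} (hP : ∀ i, P i ∈ R)
    (hB : ∀ i, B i ∈ R) {D D' : A} (hD : D ∈ R) (h : D * D' = 1) (i k : Fin n) :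
    ∃ g ∈ R, D ^ 4 * c.curv (fun i => P i + B i * D') i k
      = 3 * c.along B D * c.Y k D * B i + D * g := by
  have hc := curv_mem hR hP i k
  have h1 : (2 * c.X k (B i) - c.spray P (c.Y k (B i)) + 2 * c.along B (c.Y k (P i))
        - c.along (fun j => c.Y k (P j)) (B i) - c.along (fun j => c.Y k (B j)) (P i)) ∈ R := by
    repeat' first
      | assumption
      | exact hP _
      | exact hB _
      | exact two_mem_subalgebra R
      | intro _
      | apply hR.X_mem
      | apply hR.Y_mem
      | apply hR.along_mem
      | apply hR.spray_mem
      | apply R.add_mem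
      | apply R.sub_mem
      | apply R.mul_mem
  have h2 : (- 2 * B i * c.X k D + 2 * c.along B (c.Y k (B i)) + c.Y k (B i) * c.spray P D
        + c.spray P (B i * c.Y k D) + B i * c.along (fun j => c.Y k (P j)) D
        - c.along (fun j => c.Y k (B j)) (B i) + c.Y k D * c.along B (P i)) ∈ R := by
    repeat' first
      | assumption
      | exact hP _
      | exact hB _
      | exact two_mem_subalgebra R
      | intro _
      | apply hR.X_mem
      | apply hR.Y_mem
      | apply hR.along_mem
      | apply hR.spray_mem
      | apply R.add_mem
      | apply R.sub_mem
      | apply R.mul_mem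
      | apply R.neg_mem
  have h3 : (- 2 * c.along B D * c.Y k (B i) - 2 * c.along B (B i * c.Y k D)
        - 2 * B i * c.Y k D * c.spray P D + B i * c.along (fun j => c.Y k (B j)) D
        + c.Y k D * c.along B (B i)) ∈ R := by
    repeat' first
      | assumption
      | exact hP _
      | exact hB _
      | exact two_mem_subalgebra R
      | intro _
      | apply hR.X_mem
      | apply hR.Y_mem
      | apply hR.along_mem
      | apply hR.spray_mem
      | apply R.add_mem
      | apply R.sub_mem
      | apply R.mul_mem
      | apply R.neg_mem
  refine ⟨_, R.add_mem (R.add_mem (R.add_mem (R.mul_mem (R.pow_mem hD 3) hc)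
    (R.mul_mem (R.pow_mem hD 2) h1)) (R.mul_mem hD h2)) h3, ?_⟩
  rw [curv_expansion c P B h]
  generalize c.curv P i k = c0
  generalize (2 * c.X k (B i) - c.spray P (c.Y k (B i)) + 2 * c.along B (c.Y k (P i))
        - c.along (fun j => c.Y k (P j)) (B i) - c.along (fun j => c.Y k (B j)) (P i)) = c1
  generalize (- 2 * B i * c.X k D + 2 * c.along B (c.Y k (B i)) + c.Y k (B i) * c.spray P D
        + c.spray P (B i * c.Y k D) + B i * c.along (fun j => c.Y k (P j)) D
        - c.along (fun j => c.Y k (B j)) (B i) + c.Y k D * c.along B (P i)) = c2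
  generalize (- 2 * c.along B D * c.Y k (B i) - 2 * c.along B (B i * c.Y k D)
        - 2 * B i * c.Y k D * c.spray P D + B i * c.along (fun j => c.Y k (B j)) D
        + c.Y k D * c.along B (B i)) = c3
  generalize 3 * c.along B D * c.Y k D * B i = c4
  have e : ∀ m : ℕ, (D * D') ^ m = 1 := fun m => by rw [h, one_pow]
  linear_combination D ^ 3 * c1 * e 1 + D ^ 2 * c2 * e 2 + D * c3 * e 3 + c4 * e 4

lemma curv_pole_three (hR : c.IsStable R) {P B : Fin n → A} (hP : ∀ i, P i ∈ R)
    (hB : ∀ i, B i ∈ R) {D D' : A} (hD : D ∈ R) (h : D * D' = 1) (h0 : c.along B D = 0)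
    (i k : Fin n) :
    ∃ g ∈ R, D ^ 3 * c.curv (fun i => P i + B i * D') i k
      = - c.along B (B i) * c.Y k D - 3 * B i * c.along B (c.Y k D)
        - 2 * B i * c.Y k D * c.spray P D + D * g := by
  have hc := curv_mem hR hP i k
  have h1 : (2 * c.X k (B i) - c.spray P (c.Y k (B i)) + 2 * c.along B (c.Y k (P i))
        - c.along (fun j => c.Y k (P j)) (B i) - c.along (fun j => c.Y k (B j)) (P i)) ∈ R := by
    repeat' first
      | assumption
      | exact hP _
      | exact hB _
      | exact two_mem_subalgebra R
      | intro _
      | apply hR.X_mem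
      | apply hR.Y_mem
      | apply hR.along_mem
      | apply hR.spray_mem
      | apply R.add_mem
      | apply R.sub_mem
      | apply R.mul_mem
  have h2 : (- 2 * B i * c.X k D + 2 * c.along B (c.Y k (B i)) + c.Y k (B i) * c.spray P D
        + c.spray P (B i * c.Y k D) + B i * c.along (fun j => c.Y k (P j)) D
        - c.along (fun j => c.Y k (B j)) (B i) + c.Y k D * c.along B (P i)) ∈ R := by
    repeat' first
      | assumption
      | exact hP _
      | exact hB _
      | exact two_mem_subalgebra R
      | intro _
      | apply hR.X_mem
      | apply hR.Y_mem
      | apply hR.along_mem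
      | apply hR.spray_mem
      | apply R.add_mem
      | apply R.sub_mem
      | apply R.mul_mem
      | apply R.neg_mem
  refine ⟨_, R.add_mem (R.add_mem (R.mul_mem (R.pow_mem hD 2) hc) (R.mul_mem hD h1)) h2, ?_⟩
  rw [curv_expansion c P B h]
  generalize c.curv P i k = c0
  generalize (2 * c.X k (B i) - c.spray P (c.Y k (B i)) + 2 * c.along B (c.Y k (P i))
        - c.along (fun j => c.Y k (P j)) (B i) - c.along (fun j => c.Y k (B j)) (P i)) = c1
  generalize (- 2 * B i * c.X k D + 2 * c.along B (c.Y k (B i)) + c.Y k (B i) * c.spray P D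
        + c.spray P (B i * c.Y k D) + B i * c.along (fun j => c.Y k (P j)) D
        - c.along (fun j => c.Y k (B j)) (B i) + c.Y k D * c.along B (P i)) = c2
  have hBD : c.along (fun j => c.Y k (B j)) D = - c.along B (c.Y k D) := by
    have := c.Y_along k B D
    rw [h0, map_zero] at this
    linear_combination -this
  rw [hBD, h0, Derivation.leibniz]
  simp only [smul_eq_mul]
  have e : ∀ m : ℕ, (D * D') ^ m = 1 := fun m => by rw [h, one_pow]
  linear_combination D ^ 2 * c1 * e 1 + D * c2 * e 2 +
    (- c.along B (B i) * c.Y k D - 3 * B i * c.along B (c.Y k D)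
        - 2 * B i * c.Y k D * c.spray P D) * e 3

end FibreCalculus

end

section

variable {n : ℕ} {A : Type*} [CommRing A] [Algebra ℝ A]

/-- The scalar `1 / 2` of an algebra. -/
def halfOf (A : Type*) [CommRing A] [Algebra ℝ A] : A := algebraMap ℝ A (1 / 2)

lemma two_mul_halfOf : (2 : A) * halfOf A = 1 := by
  rw [halfOf, ← map_ofNat (algebraMap ℝ A) 2, ← map_mul]; norm_num

lemma eq_of_two_mul_eq {f g : A} (h : 2 * f = 2 * g) : f = g := by
  linear_combination halfOf A * h - (f - g) * two_mul_halfOf (A := A)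

lemma Derivation.map_halfOf_mul (D : Derivation ℝ A A) (f : A) :
    D (halfOf A * f) = halfOf A * D f := by
  rw [Derivation.leibniz, halfOf, Derivation.map_algebraMap]; simp

/-- A metric tensor `a`, its inverse and a `1`-form `b`, all independent of the fibre. -/
structure AlphaBeta (c : FibreCalculus n A) where
  a : Fin n → Fin n → A
  ai : Fin n → Fin n → A
  b : Fin n → A
  Y_a : ∀ k i j, c.Y k (a i j) = 0
  Y_ai : ∀ k i j, c.Y k (ai i j) = 0
  Y_b : ∀ k i, c.Y k (b i) = 0
  a_symm : ∀ i j, a i j = a j i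
  ai_symm : ∀ i j, ai i j = ai j i
  a_ai : ∀ i k, ∑ j, a i j * ai j k = if i = k then 1 else 0

namespace AlphaBeta

variable {c : FibreCalculus n A} (M : AlphaBeta c)

def Γ (k i j : Fin n) : A :=
  halfOf A * ∑ l, M.ai k l * (c.X j (M.a l i) + c.X i (M.a l j) - c.X l (M.a i j))

def G (i : Fin n) : A := halfOf A * ∑ j, ∑ k, M.Γ i j k * c.y j * c.y k

def cov (i j : Fin n) : A := c.X j (M.b i) - ∑ k, M.b k * M.Γ k i j

def q : A := ∑ i, ∑ j, M.a i j * c.y i * c.y j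

def β : A := ∑ i, M.b i * c.y i

def low (v : Fin n → A) (i : Fin n) : A := ∑ j, M.a i j * v j

def up (v : Fin n → A) (i : Fin n) : A := ∑ j, M.ai i j * v j

def dot (v w : Fin n → A) : A := ∑ i, v i * w i

def bsq : A := ∑ i, ∑ j, M.ai i j * M.b i * M.b j

def r00 : A := ∑ i, ∑ j, M.cov i j * c.y i * c.y j

/-- The antisymmetric part of `cov` contracted with `y` in the second slot. -/
def s0 (i : Fin n) : A := halfOf A * ∑ j, (M.cov i j - M.cov j i) * c.y j

lemma Y_Γ (m k i j : Fin n) : c.Y m (M.Γ k i j) = 0 := by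
  rw [Γ, Derivation.map_halfOf_mul]
  simp [Derivation.leibniz, M.Y_ai, c.Y_X, M.Y_a]

lemma Γ_symm (k i j : Fin n) : M.Γ k i j = M.Γ k j i := by
  simp only [Γ]
  congr 1
  refine Finset.sum_congr rfl fun l _ => ?_
  rw [M.a_symm i j]; ring

lemma Y_cov (m i j : Fin n) : c.Y m (M.cov i j) = 0 := by
  simp [cov, Derivation.leibniz, M.Y_b, c.Y_X, M.Y_Γ]

lemma low_up (v : Fin n → A) : M.low (M.up v) = v := by
  ext i
  simp only [low, up, Finset.mul_sum]
  rw [Finset.sum_comm]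
  simp only [← mul_assoc, ← Finset.sum_mul, M.a_ai]
  simp

lemma ai_a (i k : Fin n) : ∑ j, M.ai i j * M.a j k = if i = k then 1 else 0 := by
  have h := M.a_ai k i
  simp only [eq_comm (a := k)] at h
  rw [← h]
  refine Finset.sum_congr rfl fun j _ => by rw [M.ai_symm, M.a_symm]; ring

lemma up_low (v : Fin n → A) : M.up (M.low v) = v := by
  ext i
  simp only [low, up, Finset.mul_sum]
  rw [Finset.sum_comm]
  simp only [← mul_assoc, ← Finset.sum_mul, M.ai_a]
  simp

lemma dot_up (v w : Fin n → A) : dot (M.up v) w = dot (M.up w) v := by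
  simp only [dot, up, Finset.sum_mul]
  rw [Finset.sum_comm]
  refine Finset.sum_congr rfl fun i _ => Finset.sum_congr rfl fun j _ => ?_
  rw [M.ai_symm]; ring

lemma dot_low (v w : Fin n → A) : dot (M.low v) w = dot (M.low w) v := by
  simp only [dot, low, Finset.sum_mul]
  rw [Finset.sum_comm]
  refine Finset.sum_congr rfl fun i _ => Finset.sum_congr rfl fun j _ => ?_
  rw [M.a_symm]; ring

omit [Algebra ℝ A] in
lemma dot_comm (v w : Fin n → A) : dot v w = dot w v := by
  simp only [dot, mul_comm]

lemma two_low_Γ (m i j : Fin n) :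
    2 * M.low (fun k => M.Γ k i j) m = c.X j (M.a m i) + c.X i (M.a m j) - c.X m (M.a i j) := by
  have : (fun k => M.Γ k i j)
      = fun k => halfOf A *
          M.up (fun l => c.X j (M.a l i) + c.X i (M.a l j) - c.X l (M.a i j)) k := rfl
  have h2 := congrFun (M.low_up fun l => c.X j (M.a l i) + c.X i (M.a l j) - c.X l (M.a i j)) m
  rw [this]
  simp only [low] at h2 ⊢
  rw [← h2]
  simp only [mul_left_comm _ (halfOf A), ← Finset.mul_sum]
  linear_combination (∑ k, M.a m k *
    M.up (fun l => c.X j (M.a l i) + c.X i (M.a l j) - c.X l (M.a i j)) k) * two_mul_halfOf (A := A)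

lemma Y_sum_sum (k : Fin n) (f : Fin n → Fin n → A) (hf : ∀ i j, c.Y k (f i j) = 0) :
    c.Y k (∑ i, ∑ j, f i j * c.y i * c.y j) = ∑ i, (f i k + f k i) * c.y i := by
  simp only [map_sum, Derivation.leibniz, hf, c.Y_y, smul_eq_mul, mul_ite, mul_one, mul_zero,
    add_zero, Finset.sum_add_distrib, add_mul]
  congr 1
  · simp
  · rw [Finset.sum_comm]; simp [mul_comm]

lemma Y_G (i k : Fin n) : c.Y k (M.G i) = ∑ l, M.Γ i k l * c.y l := by
  rw [G, Derivation.map_halfOf_mul, Y_sum_sum _ _ fun _ _ => M.Y_Γ _ _ _ _]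
  simp only [M.Γ_symm i _ k, ← two_mul, mul_assoc, ← Finset.mul_sum]
  linear_combination (∑ l, M.Γ i k l * c.y l) * two_mul_halfOf (A := A)

lemma along_y_G (i : Fin n) : c.along c.y (M.G i) = 2 * M.G i := by
  rw [c.along_apply]
  simp only [Y_G]
  rw [G]
  simp only [Finset.mul_sum]
  refine Finset.sum_congr rfl fun j _ => Finset.sum_congr rfl fun k _ => ?_
  linear_combination - c.y j * (M.Γ i j k * c.y k) * two_mul_halfOf (A := A)

lemma spray_eq (f : A) : c.spray M.G f = ∑ k, c.y k * c.hor M.G k f := by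
  simp only [c.spray_apply, c.hor_apply, mul_sub, Finset.sum_sub_distrib]
  congr 1
  simp only [c.along_apply, Finset.mul_sum]
  rw [Finset.sum_comm]
  refine Finset.sum_congr rfl fun j _ => ?_
  rw [← mul_assoc, ← M.along_y_G, c.along_apply, Finset.sum_mul]
  refine Finset.sum_congr rfl fun k _ => by ring

lemma Y_q (k : Fin n) : c.Y k M.q = 2 * M.low c.y k := by
  rw [q, Y_sum_sum _ _ fun _ _ => M.Y_a _ _ _, low, Finset.mul_sum]
  refine Finset.sum_congr rfl fun i _ => ?_
  rw [M.a_symm i k]; ring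

lemma along_q (v : Fin n → A) : c.along v M.q = 2 * dot v (M.low c.y) := by
  simp only [c.along_apply, Y_q, dot, Finset.mul_sum, mul_left_comm]

lemma Y_β (k : Fin n) : c.Y k M.β = M.b k := by
  simp [β, Derivation.leibniz, M.Y_b, c.Y_y]

lemma along_β (v : Fin n → A) : c.along v M.β = dot v M.b := by
  simp only [c.along_apply, Y_β, dot]

lemma hor_q (k : Fin n) : c.hor M.G k M.q = 0 := by
  rw [c.hor_apply, along_q]
  have h1 : c.X k M.q = ∑ i, ∑ j, c.X k (M.a i j) * c.y i * c.y j := by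
    simp only [q, map_sum, Derivation.leibniz, c.X_y, smul_eq_mul]
    refine Finset.sum_congr rfl fun i _ => Finset.sum_congr rfl fun j _ => by ring
  have h2 : 2 * dot (fun j => c.Y k (M.G j)) (M.low c.y)
      = ∑ l, ∑ m, 2 * M.low (fun j => M.Γ j k l) m * c.y l * c.y m := by
    rw [dot_comm, dot_low]
    simp only [dot, Y_G, low, Finset.mul_sum, Finset.sum_mul]
    conv_rhs => rw [Finset.sum_comm]
    refine Finset.sum_congr rfl fun i _ => ?_
    rw [Finset.sum_comm]
    refine Finset.sum_congr rfl fun j _ => Finset.sum_congr rfl fun l _ => ?_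
    ring
  rw [h1, h2]
  simp only [two_low_Γ, sub_mul, add_mul, Finset.sum_sub_distrib, Finset.sum_add_distrib]
  rw [Finset.sum_comm (f := fun l m => c.X m (M.a k l) * c.y l * c.y m)]
  have e : ∀ x y, c.X x (M.a k y) * c.y y * c.y x = c.X x (M.a y k) * c.y x * c.y y := by
    intro x y; rw [M.a_symm]; ring
  have e2 : ∀ x y, c.X k (M.a y x) * c.y x * c.y y = c.X k (M.a x y) * c.y x * c.y y := by
    intro x y; rw [M.a_symm]
  have e3 : ∀ x y, c.X x (M.a y k) * c.y x * c.y y = c.X x (M.a k y) * c.y x * c.y y := by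
    intro x y; rw [M.a_symm]
  simp only [e, e2, e3]
  ring

lemma spray_q : c.spray M.G M.q = 0 := by simp [spray_eq, hor_q]

lemma hor_β (k : Fin n) : c.hor M.G k M.β = ∑ i, M.cov i k * c.y i := by
  rw [c.hor_apply, along_β]
  simp only [β, dot, Y_G, cov, map_sum, Derivation.leibniz, c.X_y, smul_eq_mul, mul_zero, zero_add,
    sub_mul, Finset.sum_sub_distrib, Finset.sum_mul]
  congr 1
  · simp only [mul_comm]
  · rw [Finset.sum_comm]
    refine Finset.sum_congr rfl fun i _ => Finset.sum_congr rfl fun j _ => ?_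
    rw [M.Γ_symm]; ring

lemma spray_β : c.spray M.G M.β = M.r00 := by
  simp only [spray_eq, hor_β, r00, Finset.mul_sum]
  rw [Finset.sum_comm]
  refine Finset.sum_congr rfl fun i _ => Finset.sum_congr rfl fun j _ => by ring

lemma Y_r00 (k : Fin n) : c.Y k M.r00 = 2 * c.hor M.G k M.β + 2 * M.s0 k := by
  rw [r00, Y_sum_sum _ _ fun _ _ => M.Y_cov _ _ _, hor_β, s0]
  simp only [sub_mul, add_mul, Finset.sum_add_distrib, Finset.sum_sub_distrib]
  linear_combination -(∑ j, M.cov k j * c.y j - ∑ j, M.cov j k * c.y j) * two_mul_halfOf (A := A)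

end AlphaBeta

end

section

variable {n : ℕ} {A : Type*} [CommRing A] [Algebra ℝ A]

lemma Derivation.map_two (d : Derivation ℝ A A) : d 2 = 0 := by simpa using d.map_natCast 2

namespace FibreCalculus

variable (c : FibreCalculus n A)

lemma spray_add (G T : Fin n → A) (f : A) :
    c.spray (fun i => G i + T i) f = c.spray G f - 2 * c.along T f := by
  rw [spray_apply, spray_apply, along_add]; ring

lemma along_y_X (k : Fin n) (f : A) : c.along c.y (c.X k f) = c.X k (c.along c.y f) := by
  simp only [along_apply, map_sum, Derivation.leibniz, c.X_y, smul_eq_mul, mul_zero, add_zero,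
    c.Y_X]

lemma along_y_along (v : Fin n → A) (f : A) :
    c.along c.y (c.along v f) =
      c.along (fun i => c.along c.y (v i)) f + c.along v (c.along c.y f) - c.along v f := by
  have h : c.along c.y (c.along v f)
      = ∑ i, (c.along c.y (v i) * c.Y i f + v i * c.along c.y (c.Y i f)) := by
    rw [c.along_apply v, map_sum]
    refine Finset.sum_congr rfl fun i _ => ?_
    rw [Derivation.leibniz]; simp only [smul_eq_mul]; ring
  rw [h, c.along_apply v, c.along_apply v, c.along_apply (fun i => c.along c.y (v i)),
    ← Finset.sum_add_distrib, ← Finset.sum_sub_distrib]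
  refine Finset.sum_congr rfl fun i _ => ?_
  rw [Y_euler]; ring

lemma along_y_spray (G : Fin n → A) (hG : ∀ i, c.along c.y (G i) = 2 * G i) (f : A) :
    c.along c.y (c.spray G f) = c.spray G (c.along c.y f) + c.spray G f := by
  have h1 : c.along c.y (∑ j, c.y j * c.X j f)
      = ∑ j, c.y j * c.X j (c.along c.y f) + ∑ j, c.y j * c.X j f := by
    rw [map_sum, ← Finset.sum_add_distrib]
    refine Finset.sum_congr rfl fun i _ => ?_
    rw [Derivation.leibniz, along_y_X, along_y]; simp only [smul_eq_mul]; ring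
  have h2 : c.along c.y (2 * c.along G f) = 2 * c.along c.y (c.along G f) := by
    rw [two_mul, map_add, two_mul]
  rw [spray_apply, spray_apply, map_sub, h1, h2, along_y_along]
  simp only [hG, along_mul]
  ring

/-- A solution of the Euler-Lagrange equations of `F` projectively changed so that `F` is
constant along the spray solves the Euler-Lagrange equations of `F ^ 2`. -/
lemma spray_Y_sq (G : Fin n → A) (F Fi : A) (hF : c.along c.y F = F) (hFi : F * Fi = 1)
    (hEL : ∀ l, c.spray G (c.Y l F) = c.X l F) (l : Fin n) :
    c.spray (fun i => G i + halfOf A * c.spray G F * Fi * c.y i) (c.Y l (F ^ 2))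
      = c.X l (F ^ 2) := by
  have h0 : c.along c.y (c.Y l F) = 0 := by
    have := c.Y_euler l F
    rw [hF] at this
    linear_combination -this
  simp only [pow_two, Derivation.leibniz, smul_eq_mul, map_add, spray_add, along_mul, hEL, hF, h0]
  linear_combination (-2 * c.spray G F * c.Y l F) * (F * Fi * two_mul_halfOf (A := A) + hFi)

end FibreCalculus

namespace AlphaBeta

variable {c : FibreCalculus n A} (M : AlphaBeta c)

/-- The vector `sⁱ₀`. -/
def V : Fin n → A := M.up M.s0

def σ : A := dot (M.up M.b) M.s0

def c0 : A := 1 + 2 * M.bsq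

def D : A := M.c0 * M.q - 3 * M.β ^ 2

lemma low_y_up_b : dot (M.up M.b) (M.low c.y) = M.β := by
  rw [dot_up, up_low]; simp only [dot, β, mul_comm]

lemma dot_y_s0 : dot c.y M.s0 = 0 := by
  simp only [dot, s0, Finset.mul_sum]
  have : ∀ i j, c.y i * (halfOf A * ((M.cov i j - M.cov j i) * c.y j))
      = halfOf A * c.y i * c.y j * M.cov i j - halfOf A * c.y i * c.y j * M.cov j i := by
    intros; ring
  simp only [this, Finset.sum_sub_distrib]
  rw [Finset.sum_comm, sub_eq_zero]
  refine Finset.sum_congr rfl fun i _ => Finset.sum_congr rfl fun j _ => by ring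

lemma dot_V_low : dot M.V (M.low c.y) = 0 := by
  rw [V, dot_up, up_low, dot_y_s0]

lemma dot_V_b : dot M.V M.b = M.σ := by rw [V, dot_up, σ]

lemma dot_upb_b : dot (M.up M.b) M.b = M.bsq := by
  simp only [dot, up, bsq, Finset.sum_mul]
  refine Finset.sum_congr rfl fun i _ => Finset.sum_congr rfl fun j _ => by ring

lemma low_V : M.low M.V = M.s0 := M.low_up _

lemma Y_bsq (k : Fin n) : c.Y k M.bsq = 0 := by
  simp [bsq, Derivation.leibniz, M.Y_ai, M.Y_b]

lemma Y_upb (k i : Fin n) : c.Y k (M.up M.b i) = 0 := by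
  simp [up, Derivation.leibniz, M.Y_ai, M.Y_b]

lemma along_low_y (v : Fin n → A) (l : Fin n) : c.along v (M.low c.y l) = M.low v l := by
  simp only [low, map_sum, Derivation.leibniz, c.along_y, smul_eq_mul]
  simp [c.along_apply, M.Y_a]

lemma along_b (v : Fin n → A) (l : Fin n) : c.along v (M.b l) = 0 := by
  simp [c.along_apply, M.Y_b]

lemma along_bsq (v : Fin n → A) : c.along v M.bsq = 0 := by
  simp [c.along_apply, M.Y_bsq]

lemma Y_s0 (i k : Fin n) : c.Y k (M.s0 i) = halfOf A * (M.cov i k - M.cov k i) := by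
  rw [s0, Derivation.map_halfOf_mul]
  simp [Derivation.leibniz, M.Y_cov, c.Y_y]

lemma euler_q : c.along c.y M.q = 2 * M.q := by
  rw [along_q, q]; simp only [dot, low, Finset.mul_sum]
  refine Finset.sum_congr rfl fun i _ => Finset.sum_congr rfl fun j _ => by ring

lemma euler_β : c.along c.y M.β = M.β := by
  rw [along_β]; simp only [dot, β, mul_comm]

lemma euler_s0 (i : Fin n) : c.along c.y (M.s0 i) = M.s0 i := by
  rw [c.along_apply]
  simp only [Y_s0]
  rw [s0, Finset.mul_sum]
  refine Finset.sum_congr rfl fun j _ => by ring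

lemma euler_r00 : c.along c.y M.r00 = 2 * M.r00 := by
  have h := fun f => c.along_y_spray M.G M.along_y_G f
  rw [← spray_β, h, euler_β]; ring

lemma along_up (v w : Fin n → A) (i : Fin n) :
    c.along v (M.up w i) = M.up (fun j => c.along v (w j)) i := by
  simp only [up, map_sum, Derivation.leibniz, smul_eq_mul]
  simp [c.along_apply, M.Y_ai]

lemma euler_V (i : Fin n) : c.along c.y (M.V i) = M.V i := by
  rw [V, along_up]; simp only [euler_s0]

lemma euler_upb (i : Fin n) : c.along c.y (M.up M.b i) = 0 := by
  simp [c.along_apply, M.Y_upb]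

lemma euler_σ : c.along c.y M.σ = M.σ := by
  simp [σ, dot, map_sum, Derivation.leibniz, euler_s0, euler_upb]

lemma euler_D : c.along c.y M.D = 2 * M.D := by
  have h3 : c.along c.y (3 : A) = 0 := by simpa using (c.along c.y).map_natCast 3
  simp only [D, c0, map_add, map_sub, Derivation.leibniz, Derivation.map_two, h3, pow_two,
    Derivation.map_one_eq_zero, M.along_bsq, M.euler_q, M.euler_β, smul_eq_mul]
  ring

/-- The square root of `q`, and the inverses entering the spray of the square metric. -/
structure Root where
  α : A
  αi : A
  mi : A
  Di : A
  α_sq : α ^ 2 = M.q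
  α_αi : α * αi = 1
  m_mi : (α - M.β) * mi = 1
  D_Di : M.D * Di = 1

namespace Root

variable {M} (N : M.Root)

lemma map_α (d : Derivation ℝ A A) : d N.α = halfOf A * N.αi * d M.q := by
  have h : d M.q = 2 * (N.α * d N.α) := by
    rw [← N.α_sq, pow_two, Derivation.leibniz]; simp only [smul_eq_mul]; ring
  rw [h]
  linear_combination (-(N.α * N.αi * d N.α)) * two_mul_halfOf (A := A) - d N.α * N.α_αi

lemma map_αi (d : Derivation ℝ A A) : d N.αi = - N.αi ^ 2 * d N.α := by
  rw [FibreCalculus.derivation_inv d N.α_αi]; ring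

def F : A := N.α + 2 * M.β + M.β ^ 2 * N.αi

/-- The deviation of the spray of the square metric from that of `α`, up to a projective
change. -/
def T (i : Fin n) : A := 2 * M.q * N.mi * M.V i
  + M.q * N.Di * (M.r00 - 4 * M.q * M.σ * N.mi) * M.up M.b i

lemma along_α (v : Fin n → A) : c.along v N.α = N.αi * dot v (M.low c.y) := by
  rw [map_α, along_q]
  linear_combination (N.αi * dot v (M.low c.y)) * two_mul_halfOf (A := A)

lemma Y_α (l : Fin n) : c.Y l N.α = N.αi * M.low c.y l := by
  rw [map_α, Y_q]
  linear_combination (N.αi * M.low c.y l) * two_mul_halfOf (A := A)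

lemma Y_F (l : Fin n) : c.Y l N.F = (N.αi - M.β ^ 2 * N.αi ^ 3) * M.low c.y l
    + (2 + 2 * M.β * N.αi) * M.b l := by
  simp only [F, map_add, Derivation.map_two, Derivation.leibniz, pow_two, N.map_αi, Y_β, Y_α,
    smul_eq_mul]
  ring

lemma map_F (d : Derivation ℝ A A) (hd : d M.q = 0) :
    d N.F = (2 + 2 * M.β * N.αi) * d M.β := by
  simp only [F, map_add, Derivation.map_two, Derivation.leibniz, pow_two, N.map_αi, N.map_α, hd,
    smul_eq_mul]
  ring

lemma along_T (f : A) : c.along N.T f = 2 * M.q * N.mi * c.along M.V f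
    + M.q * N.Di * (M.r00 - 4 * M.q * M.σ * N.mi) * c.along (M.up M.b) f := by
  rw [show N.T = fun i => 2 * M.q * N.mi * M.V i
    + M.q * N.Di * (M.r00 - 4 * M.q * M.σ * N.mi) * M.up M.b i from rfl]
  simp only [c.along_add, c.along_mul]

lemma along_Y_F (v : Fin n → A) (l : Fin n) : c.along v (c.Y l N.F)
    = (N.αi - M.β ^ 2 * N.αi ^ 3) * M.low v l
      + (-N.αi ^ 3 * dot v (M.low c.y) - 2 * M.β * N.αi ^ 3 * dot v M.b
        + 3 * M.β ^ 2 * N.αi ^ 5 * dot v (M.low c.y)) * M.low c.y l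
      + (2 * N.αi * dot v M.b - 2 * M.β * N.αi ^ 3 * dot v (M.low c.y)) * M.b l := by
  rw [Y_F]
  simp only [map_add, map_sub, Derivation.map_two, Derivation.leibniz, pow_succ, pow_zero, one_mul,
    N.map_αi, along_β, along_α, smul_eq_mul, along_b, along_low_y, mul_assoc]
  ring

lemma spray_T_Y_F (l : Fin n) :
    c.spray (fun i => M.G i + N.T i) (c.Y l N.F) = c.X l N.F := by
  have h1 : c.spray M.G N.F = (2 + 2 * M.β * N.αi) * M.r00 := by
    rw [N.map_F _ M.spray_q, spray_β]
  have h2 : c.hor M.G l N.F = (2 + 2 * M.β * N.αi) * c.hor M.G l M.β := N.map_F _ (M.hor_q l)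
  have h3 : c.Y l (c.spray M.G N.F) = (2 * N.αi * M.b l - 2 * M.β * N.αi ^ 3 * M.low c.y l) * M.r00
      + (2 + 2 * M.β * N.αi) * (2 * c.hor M.G l M.β + 2 * M.s0 l) := by
    rw [h1]
    simp only [map_add, Derivation.leibniz, N.map_αi, Y_β, Y_α, Y_r00, Derivation.map_two,
      smul_eq_mul]
    ring
  rw [c.hor_apply] at h2
  rw [c.spray_add, c.spray_Y, h3, along_T, along_Y_F, along_Y_F, dot_V_low, dot_V_b, low_V,
    low_y_up_b, dot_upb_b, low_up]
  have e1 := N.α_αi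
  have e2 := N.m_mi
  have e3 := N.D_Di
  rw [D, c0] at e3
  rw [← N.α_sq] at e3 ⊢
  generalize M.low c.y l = yl at *
  generalize M.b l = bl at *
  generalize M.s0 l = sl at *
  generalize M.bsq = B at *
  generalize M.β = β at *
  generalize N.α = α at *
  generalize N.αi = αi at *
  generalize N.mi = mi at *
  generalize N.Di = Di at *
  generalize M.σ = σ at *
  generalize M.r00 = r at *
  grind

lemma euler_α : c.along c.y N.α = N.α := by
  have h : dot c.y (M.low c.y) = N.α ^ 2 := by
    rw [N.α_sq, q]; simp only [dot, low, Finset.mul_sum]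
    refine Finset.sum_congr rfl fun i _ => Finset.sum_congr rfl fun j _ => by ring
  rw [along_α, h]
  linear_combination N.α * N.α_αi

lemma euler_αi : c.along c.y N.αi = - N.αi := by
  rw [map_αi, euler_α]
  linear_combination (-N.αi) * N.α_αi

lemma euler_mi : c.along c.y N.mi = - N.mi := by
  rw [FibreCalculus.derivation_inv _ N.m_mi, map_sub, euler_α, M.euler_β]
  linear_combination (-N.mi) * N.m_mi

lemma euler_Di : c.along c.y N.Di = - 2 * N.Di := by
  rw [FibreCalculus.derivation_inv _ N.D_Di, M.euler_D]
  linear_combination (-2 * N.Di) * N.D_Di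

lemma euler_F : c.along c.y N.F = N.F := by
  simp only [F, map_add, Derivation.map_two, Derivation.leibniz, pow_two, N.euler_α, N.euler_αi,
    M.euler_β, smul_eq_mul]
  ring

lemma euler_T (i : Fin n) : c.along c.y (N.T i) = 2 * N.T i := by
  have h4 : c.along c.y (4 : A) = 0 := by simpa using (c.along c.y).map_natCast 4
  simp only [T, map_add, map_sub, Derivation.map_two, Derivation.leibniz, N.euler_mi, N.euler_Di,
    M.euler_q, M.euler_r00, M.euler_V, M.euler_σ, M.euler_upb, smul_eq_mul, h4]
  ring

lemma euler_spray (i : Fin n) : c.along c.y (M.G i + N.T i) = 2 * (M.G i + N.T i) := by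
  rw [map_add, M.along_y_G, euler_T]; ring

/-- The factor of the projective change from `M.G + N.T` to the spray of `N.F`. -/
def P (Fi : A) : A := halfOf A * c.spray (fun i => M.G i + N.T i) N.F * Fi

lemma euler_P {Fi : A} (hFi : N.F * Fi = 1) : c.along c.y (N.P Fi) = N.P Fi := by
  have h1 := c.along_y_spray _ N.euler_spray N.F
  have h2 := FibreCalculus.derivation_inv (c.along c.y) hFi
  rw [euler_F] at h1 h2
  rw [P, mul_assoc, Derivation.map_halfOf_mul, Derivation.leibniz, h1, h2]
  simp only [smul_eq_mul]
  linear_combination (-halfOf A * c.spray (fun i => M.G i + N.T i) N.F * Fi) * hFi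

lemma spray_P_Y_sq {Fi : A} (hFi : N.F * Fi = 1) (l : Fin n) :
    c.spray (fun i => (M.G i + N.T i) + N.P Fi * c.y i) (c.Y l (N.F ^ 2)) = c.X l (N.F ^ 2) :=
  c.spray_Y_sq _ N.F Fi N.euler_F hFi N.spray_T_Y_F l

lemma curv_P {Fi : A} (hFi : N.F * Fi = 1) : ∃ (a : A) (b : Fin n → A), ∀ i k,
    c.curv (fun i => (M.G i + N.T i) + N.P Fi * c.y i) i k =
      c.curv (fun i => M.G i + N.T i) i k + a * (if i = k then 1 else 0) + b k * c.y i :=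
  c.curv_projective _ _ N.euler_spray (N.euler_P hFi)

end Root
end AlphaBeta

end

section

variable {n : ℕ} {A : Type*} [CommRing A] [Algebra ℝ A]

namespace AlphaBeta

variable {c : FibreCalculus n A} (M : AlphaBeta c)

/-- The nonlinear connection of `M.G` contracted with the metric dual of `y`. -/
lemma spray_low_y (k : Fin n) :
    c.spray M.G (M.low c.y k) = dot (fun l => c.Y k (M.G l)) (M.low c.y) := by
  have h := c.spray_Y M.G k M.q
  have h2 := M.hor_q k
  rw [c.hor_apply] at h2
  rw [M.spray_q, map_zero] at h
  rw [M.Y_q, Derivation.leibniz, Derivation.map_two] at h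
  simp only [smul_eq_mul] at h
  rw [M.along_q] at h h2
  apply eq_of_two_mul_eq
  linear_combination h - h2

lemma X_a (k m i : Fin n) : c.X k (M.a m i) =
    M.low (fun l => M.Γ l i k) m + M.low (fun l => M.Γ l m k) i := by
  have h1 := M.two_low_Γ m i k
  have h2 := M.two_low_Γ i m k
  rw [M.a_symm i m] at h2
  rw [M.a_symm i k, M.a_symm m k] at *
  apply eq_of_two_mul_eq
  linear_combination -h1 - h2

/-- Raising an index commutes with covariant differentiation. -/
lemma cov_up (i k : Fin n) : c.X k (M.up M.b i) + ∑ l, M.Γ i k l * M.up M.b l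
    = M.up (fun m => M.cov m k) i := by
  have h : M.low (fun i => c.X k (M.up M.b i) + ∑ l, M.Γ i k l * M.up M.b l)
      = fun m => M.cov m k := by
    ext m
    have h1 : c.X k (M.low (M.up M.b) m) = ∑ j, (c.X k (M.a m j) * M.up M.b j
        + M.a m j * c.X k (M.up M.b j)) := by
      simp only [low, map_sum, Derivation.leibniz, smul_eq_mul]
      refine Finset.sum_congr rfl fun j _ => by ring
    have h2 : ∑ j, M.low (fun l => M.Γ l m k) j * M.up M.b j = ∑ l, M.b l * M.Γ l m k := by
      have := M.dot_low (fun l => M.Γ l m k) (M.up M.b)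
      rw [low_up] at this
      exact this
    have h3 : ∑ j, M.low (fun l => M.Γ l j k) m * M.up M.b j
        = ∑ j, M.a m j * ∑ l, M.Γ j k l * M.up M.b l := by
      simp only [low, Finset.mul_sum, Finset.sum_mul]
      rw [Finset.sum_comm]
      refine Finset.sum_congr rfl fun j _ => Finset.sum_congr rfl fun l _ => ?_
      rw [M.Γ_symm]; ring
    rw [low_up] at h1
    simp only [X_a, add_mul, Finset.sum_add_distrib, h2, h3] at h1
    simp only [low, cov, mul_add, Finset.sum_add_distrib]
    linear_combination -h1
  rw [← h, up_low]

lemma X_bsq (k : Fin n) : c.X k M.bsq = 2 * dot (M.up M.b) (fun m => M.cov m k) := by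
  have h : ∀ i, c.X k (M.b i) = M.cov i k + ∑ l, M.b l * M.Γ l i k := by
    intro i; rw [cov]; ring
  have h' : ∀ i, c.X k (M.up M.b i)
      = M.up (fun m => M.cov m k) i - ∑ l, M.Γ i k l * M.up M.b l := by
    intro i; rw [← cov_up]; ring
  rw [← dot_upb_b, dot]
  simp only [map_sum, Derivation.leibniz, h, h', smul_eq_mul, mul_add, mul_sub,
    Finset.sum_add_distrib, Finset.sum_sub_distrib]
  have e1 : ∑ i, M.b i * M.up (fun m => M.cov m k) i = dot (M.up M.b) (fun m => M.cov m k) := by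
    rw [M.dot_up, dot_comm, dot]
  have e2 : ∑ i, M.b i * ∑ l, M.Γ i k l * M.up M.b l
      = ∑ i, M.up M.b i * ∑ l, M.b l * M.Γ l i k := by
    simp only [Finset.mul_sum]
    rw [Finset.sum_comm]
    refine Finset.sum_congr rfl fun j _ => Finset.sum_congr rfl fun l _ => ?_
    rw [M.Γ_symm]; ring
  rw [e1, e2, dot]
  ring

section Conformal

variable {τ : A} (hcov : ∀ i j, M.cov i j = τ * (M.c0 * M.a i j - 3 * M.b i * M.b j))
include hcov

lemma X_bsq_of_cov (k : Fin n) : c.X k M.bsq = 2 * τ * (1 - M.bsq) * M.b k := by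
  have h : dot (M.up M.b) (fun m => M.cov m k)
      = τ * (M.c0 * M.low (M.up M.b) k - 3 * dot (M.up M.b) M.b * M.b k) := by
    simp only [dot, hcov, low, Finset.mul_sum, Finset.sum_mul, ← Finset.sum_sub_distrib]
    refine Finset.sum_congr rfl fun j _ => ?_
    rw [M.a_symm]; ring
  rw [X_bsq, h, low_up, dot_upb_b, c0]
  ring

lemma cov_upb_of_cov (i k : Fin n) : c.X k (M.up M.b i) + ∑ l, M.Γ i k l * M.up M.b l
    = τ * (M.c0 * (if i = k then 1 else 0) - 3 * M.up M.b i * M.b k) := by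
  rw [cov_up, ← M.ai_a]
  simp only [up, hcov, Finset.mul_sum, Finset.sum_mul, ← Finset.sum_sub_distrib]
  refine Finset.sum_congr rfl fun j _ => by ring

lemma hor_β_of_cov (k : Fin n) :
    c.hor M.G k M.β = τ * (M.c0 * M.low c.y k - 3 * M.β * M.b k) := by
  rw [hor_β]
  simp only [hcov, β, low, Finset.mul_sum, Finset.sum_mul, ← Finset.sum_sub_distrib]
  refine Finset.sum_congr rfl fun j _ => ?_
  rw [M.a_symm]; ring

lemma r00_of_cov : M.r00 = τ * M.D := by
  have h : M.r00 = dot c.y (fun k => c.hor M.G k M.β) := by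
    rw [← M.spray_β, spray_eq, dot]
  have h2 : M.q = dot c.y (M.low c.y) := by
    simp only [q, dot, low, Finset.mul_sum]
    refine Finset.sum_congr rfl fun j _ => Finset.sum_congr rfl fun l _ => by ring
  have h3 : M.β = dot c.y M.b := by simp only [β, dot, mul_comm]
  rw [h, D, h2, pow_two]; nth_rewrite 3 [h3]
  simp only [hor_β_of_cov M hcov, dot, Finset.mul_sum,
    ← Finset.sum_sub_distrib]
  refine Finset.sum_congr rfl fun j _ => by ring

lemma s0_of_cov (i : Fin n) : M.s0 i = 0 := by
  have : ∀ i j, M.cov i j = M.cov j i := by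
    intro i j; rw [hcov, hcov, M.a_symm]; ring
  rw [s0]
  simp [this i]

variable (hτ : ∀ k, c.Y k τ = 0)
include hτ

lemma sum_curv_b (k : Fin n) : ∑ l, c.curv M.G l k * M.b l
    = (∑ j, c.y j * c.X j τ) * (M.c0 * M.low c.y k - 3 * M.β * M.b k)
      - c.X k τ * (M.c0 * M.q - 3 * M.β ^ 2)
      - τ ^ 2 * (7 + 2 * M.bsq) * (M.q * M.b k - M.β * M.low c.y k) := by
  have hy : ∀ v, c.along v τ = 0 := by intro v; simp [c.along_apply, hτ]
  have hSτ : c.spray M.G τ = ∑ j, c.y j * c.X j τ := by rw [c.spray_apply, hy]; ring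
  have hHτ : c.hor M.G k τ = c.X k τ := by rw [c.hor_apply, hy]; ring
  have hX := X_bsq_of_cov M hcov
  have h3 : ∀ d : Derivation ℝ A A, d 3 = 0 := fun d => by simpa using d.map_natCast 3
  have hSb : c.spray M.G M.bsq = 2 * τ * (1 - M.bsq) * M.β := by
    rw [c.spray_apply, along_bsq]
    simp only [hX, β, Finset.mul_sum]
    rw [mul_zero, sub_zero]
    refine Finset.sum_congr rfl fun j _ => by ring
  have hHb : c.hor M.G k M.bsq = 2 * τ * (1 - M.bsq) * M.b k := by
    rw [c.hor_apply, along_bsq, hX]; ring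
  have hSbk : c.spray M.G (M.b k) = c.hor M.G k M.β + dot (fun l => c.Y k (M.G l)) M.b := by
    have := c.spray_Y M.G k M.β
    rw [Y_β, spray_β, Y_r00, s0_of_cov M hcov, c.hor_apply, along_β] at this
    rw [c.hor_apply, along_β, this]; ring
  have h := c.sum_curv_mul M.G k M.β
  have hN : ∑ l, c.Y k (M.G l) * c.hor M.G l M.β
      = τ * (M.c0 * dot (fun l => c.Y k (M.G l)) (M.low c.y)
        - 3 * M.β * dot (fun l => c.Y k (M.G l)) M.b) := by
    simp only [hor_β_of_cov M hcov, dot, Finset.mul_sum, ← Finset.sum_sub_distrib]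
    refine Finset.sum_congr rfl fun j _ => by ring
  have hk := hor_β_of_cov M hcov k
  simp only [Y_β] at h
  rw [h, hN, hk, spray_β, r00_of_cov M hcov, D, c0]
  simp only [map_add, map_sub, Derivation.leibniz, Derivation.map_two, h3, pow_two,
    Derivation.map_one_eq_zero, smul_eq_mul, hSτ, hHτ, hSb, hHb, hSbk, hk, spray_low_y,
    M.spray_β, r00_of_cov M hcov, D, c0, M.hor_q]
  ring

/-- The curvature of the projective change of the square metric's spray. -/
lemma curv_add_upb (i k : Fin n) :
    c.curv (fun i => M.G i + τ * M.q * M.up M.b i) i k = c.curv M.G i k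
      + 2 * τ ^ 2 * M.c0 * (M.q * (if i = k then 1 else 0) - c.y i * M.low c.y k)
      + 2 * M.up M.b i * (M.q * (c.X k τ - τ ^ 2 * M.b k)
        - M.low c.y k * (∑ j, c.y j * c.X j τ - τ ^ 2 * M.β)) := by
  have hy : ∀ v, c.along v τ = 0 := by intro v; simp [c.along_apply, hτ]
  have hSτ : c.spray M.G τ = ∑ j, c.y j * c.X j τ := by rw [c.spray_apply, hy]; ring
  have hb0 : ∀ v j, c.along v (M.up M.b j) = 0 := by
    intro v j; simp [c.along_apply, M.Y_upb]
  have hYT : ∀ i k, c.Y k (τ * M.q * M.up M.b i) = 2 * τ * M.low c.y k * M.up M.b i := by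
    intro i k
    simp only [Derivation.leibniz, hτ, Y_q, Y_upb, smul_eq_mul]; ring
  have hcu := cov_upb_of_cov M hcov
  have hSup : c.spray M.G (M.up M.b i) + ∑ l, M.up M.b l * c.Y l (M.G i)
      = τ * (M.c0 * c.y i - 3 * M.β * M.up M.b i) := by
    have : c.y i = ∑ k, c.y k * (if i = k then 1 else 0) := by simp
    rw [c.spray_apply, hb0, this]
    simp only [Y_G, β, Finset.mul_sum, Finset.sum_mul]
    rw [mul_zero, sub_zero, Finset.sum_comm, ← Finset.sum_sub_distrib, Finset.mul_sum,
      ← Finset.sum_add_distrib]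
    refine Finset.sum_congr rfl fun k _ => ?_
    have e : ∑ x, M.up M.b x * (M.Γ i x k * c.y k) = c.y k * ∑ l, M.Γ i k l * M.up M.b l := by
      rw [Finset.mul_sum]
      refine Finset.sum_congr rfl fun l _ => ?_
      rw [M.Γ_symm]; ring
    rw [e]
    linear_combination c.y k * hcu i k
  have hA : c.along (M.up M.b) (c.Y k (M.G i)) = ∑ l, M.Γ i k l * M.up M.b l := by
    rw [Y_G, map_sum]
    refine Finset.sum_congr rfl fun l _ => ?_
    rw [Derivation.leibniz, c.along_y]
    simp [c.along_apply, M.Y_Γ]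
  have hq : c.X k M.q = 2 * dot (fun j => c.Y k (M.G j)) (M.low c.y) := by
    have := M.hor_q k
    rw [c.hor_apply, along_q] at this
    linear_combination this
  rw [c.curv_eq, c.curv_eq, c.spray_add]
  have e1 : c.along (fun j => c.Y k (M.G j + τ * M.q * M.up M.b j)) (M.G i + τ * M.q * M.up M.b i)
      = c.along (fun j => c.Y k (M.G j)) (M.G i + τ * M.q * M.up M.b i)
        + 2 * τ * M.low c.y k * c.along (M.up M.b) (M.G i + τ * M.q * M.up M.b i) := by
    simp only [map_add, hYT, c.along_add, c.along_mul]
  rw [e1, c.along_mul, map_add (c.Y k), hYT]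
  have e2 := c.along_apply (M.up M.b) (M.G i)
  simp only [map_add, Derivation.leibniz, smul_eq_mul, Derivation.map_two, hb0, along_q,
    hy, hSτ, M.spray_low_y, hA, M.low_y_up_b, M.along_low_y, hq, M.low_up, e2]
  linear_combination 2 * τ * M.q * hcu i k - 2 * τ * M.low c.y k * hSup

end Conformal

/-- The curvature of `M.G` maps into the orthogonal complement of `y`. -/
lemma sum_curv_low (k : Fin n) : ∑ l, c.curv M.G l k * M.low c.y l = 0 := by
  have h := c.sum_curv_mul M.G k M.q
  simp only [hor_q, spray_q, map_zero, mul_zero, Finset.sum_const_zero, sub_zero, Y_q] at h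
  apply eq_of_two_mul_eq
  rw [mul_zero, Finset.mul_sum, ← h]
  refine Finset.sum_congr rfl fun j _ => by ring

end AlphaBeta

end

section

open TopologicalSpace

variable {n : ℕ}

/-- The extension by zero of a function on an open set of pairs `(x, y)`. -/
def zeroExtend {Ω : Opens (Vec n × Vec n)} (f : Ω → ℝ) (p : Vec n × Vec n) : ℝ :=
  open Classical in if h : p ∈ Ω then f ⟨p, h⟩ else 0

lemma zeroExtend_of_mem {Ω : Opens (Vec n × Vec n)} (f : Ω → ℝ) {p : Vec n × Vec n}
    (h : p ∈ Ω) : zeroExtend f p = f ⟨p, h⟩ := dif_pos h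

lemma zeroExtend_eventuallyEq {Ω : Opens (Vec n × Vec n)} {f : Ω → ℝ} {F : Vec n × Vec n → ℝ}
    (hF : ∀ p : Ω, f p = F p) (p : Ω) : zeroExtend f =ᶠ[nhds p.1] F := by
  filter_upwards [Ω.isOpen.mem_nhds p.2] with r hr
  rw [zeroExtend_of_mem f hr, hF]

/-- The algebra of smooth functions on an open set of pairs `(x, y)`. -/
def SmoothAlg (Ω : Opens (Vec n × Vec n)) : Subalgebra ℝ (Ω → ℝ) where
  carrier := {f | ∃ F : Vec n × Vec n → ℝ, ContDiffOn ℝ (⊤ : ℕ∞) F Ω ∧ ∀ p : Ω, f p = F p}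
  mul_mem' := by
    rintro f g ⟨F, hF, h⟩ ⟨F', hF', h'⟩
    exact ⟨F * F', hF.mul hF', fun p => by simp [h, h']⟩
  add_mem' := by
    rintro f g ⟨F, hF, h⟩ ⟨F', hF', h'⟩
    exact ⟨F + F', hF.add hF', fun p => by simp [h, h']⟩
  algebraMap_mem' r := ⟨fun _ => r, contDiffOn_const, fun p => rfl⟩

namespace SmoothAlg

variable {Ω : Opens (Vec n × Vec n)}

/-- Evaluation at a point. -/
def ev (p : Ω) : SmoothAlg Ω →ₐ[ℝ] ℝ := (Pi.evalAlgHom ℝ (fun _ : Ω => ℝ) p).comp (SmoothAlg Ω).val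

lemma ext_ev {f g : SmoothAlg Ω} (h : ∀ p, ev p f = ev p g) : f = g :=
  Subtype.ext (funext h)

/-- A smooth function as an element of the algebra. -/
def mk (F : Vec n × Vec n → ℝ) (hF : ContDiffOn ℝ (⊤ : ℕ∞) F Ω) : SmoothAlg Ω :=
  ⟨fun p => F p, F, hF, fun _ => rfl⟩

@[simp] lemma ev_mk (F : Vec n × Vec n → ℝ) (hF : ContDiffOn ℝ (⊤ : ℕ∞) F Ω) (p : Ω) :
    ev p (mk F hF) = F p := rfl

lemma contDiffOn_zeroExtend (f : SmoothAlg Ω) : ContDiffOn ℝ (⊤ : ℕ∞) (zeroExtend f.1) Ω := by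
  obtain ⟨f, F, hF, h⟩ := f
  refine hF.congr fun p hp => ?_
  exact (zeroExtend_eventuallyEq h ⟨p, hp⟩).eq_of_nhds

lemma contDiffAt_zeroExtend (f : SmoothAlg Ω) (p : Ω) :
    ContDiffAt ℝ (⊤ : ℕ∞) (zeroExtend f.1) p :=
  (contDiffOn_zeroExtend f).contDiffAt (Ω.isOpen.mem_nhds p.2)

lemma differentiableAt_zeroExtend (f : SmoothAlg Ω) (p : Ω) :
    DifferentiableAt ℝ (zeroExtend f.1) p :=
  (contDiffAt_zeroExtend f p).differentiableAt (by simp)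

lemma hasFDerivAt_zeroExtend (f : SmoothAlg Ω) (p : Ω) :
    HasFDerivAt (zeroExtend f.1) (fderiv ℝ (zeroExtend f.1) p) p :=
  (differentiableAt_zeroExtend f p).hasFDerivAt

lemma zeroExtend_eventuallyEq_of_ev {f : SmoothAlg Ω} {F : Vec n × Vec n → ℝ}
    (hF : ∀ p : Ω, ev p f = F p) (p : Ω) : zeroExtend f.1 =ᶠ[nhds p.1] F :=
  zeroExtend_eventuallyEq hF p

lemma zeroExtend_eq_ev (f : SmoothAlg Ω) (p : Ω) : zeroExtend f.1 p = ev p f :=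
  zeroExtend_of_mem f.1 p.2

lemma ev_eq_zeroExtend (f : SmoothAlg Ω) (p : Ω) : ev p f = zeroExtend f.1 p :=
  (zeroExtend_of_mem f.1 p.2).symm

/-- The directional derivative as a function. -/
def derFun (v : Vec n × Vec n) (f : SmoothAlg Ω) : SmoothAlg Ω :=
  mk (fun p => fderiv ℝ (zeroExtend f.1) p v)
    (((contDiffOn_zeroExtend f).fderiv_of_isOpen Ω.isOpen (m := (⊤ : ℕ∞)) (by simp)).clm_apply
      contDiffOn_const)

lemma ev_derFun_of_hasFDerivAt {v : Vec n × Vec n} {f : SmoothAlg Ω} {F : Vec n × Vec n → ℝ}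
    (hF : ∀ p : Ω, ev p f = F p) {p : Ω} {L : Vec n × Vec n →L[ℝ] ℝ}
    (hL : HasFDerivAt F L p) : ev p (derFun v f) = L v := by
  rw [derFun, ev_mk, (zeroExtend_eventuallyEq_of_ev hF p).fderiv_eq, hL.fderiv]

/-- The directional derivative. -/
def der (v : Vec n × Vec n) : Derivation ℝ (SmoothAlg Ω) (SmoothAlg Ω) :=
  Derivation.mk'
    { toFun := derFun v
      map_add' := fun f g => ext_ev fun p => by
        rw [ev_derFun_of_hasFDerivAt (F := zeroExtend f.1 + zeroExtend g.1)
          (fun p => by simp [ev_eq_zeroExtend f, ev_eq_zeroExtend g])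
          ((hasFDerivAt_zeroExtend f p).add (hasFDerivAt_zeroExtend g p))]
        rfl
      map_smul' := fun r f => ext_ev fun p => by
        rw [ev_derFun_of_hasFDerivAt (F := fun p => r • zeroExtend f.1 p)
          (fun p => by simp [ev_eq_zeroExtend f])
          ((hasFDerivAt_zeroExtend f p).const_smul r)]
        rfl }
    (fun f g => ext_ev fun p => by
      change ev p (derFun v (f * g)) = _
      rw [ev_derFun_of_hasFDerivAt (F := fun p => zeroExtend f.1 p * zeroExtend g.1 p)
          (fun p => by simp [ev_eq_zeroExtend f, ev_eq_zeroExtend g])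
          ((hasFDerivAt_zeroExtend f p).mul (hasFDerivAt_zeroExtend g p))]
      simp [zeroExtend_eq_ev]
      rfl)

lemma ev_der (v : Vec n × Vec n) (f : SmoothAlg Ω) (p : Ω) :
    ev p (der v f) = fderiv ℝ (zeroExtend f.1) p v := rfl

lemma ev_der_of_hasFDerivAt {v : Vec n × Vec n} {f : SmoothAlg Ω} {F : Vec n × Vec n → ℝ}
    (hF : ∀ p : Ω, ev p f = F p) {p : Ω} {L : Vec n × Vec n →L[ℝ] ℝ}
    (hL : HasFDerivAt F L p) : ev p (der v f) = L v := ev_derFun_of_hasFDerivAt hF hL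

lemma der_der (v w : Vec n × Vec n) (f : SmoothAlg Ω) : der v (der w f) = der w (der v f) := by
  have key : ∀ (v w : Vec n × Vec n) (p : Ω), ev p (der v (der w f))
      = fderiv ℝ (fderiv ℝ (zeroExtend f.1)) p v w := by
    intro v w p
    have h1 : DifferentiableAt ℝ (fderiv ℝ (zeroExtend f.1)) p :=
      ((contDiffAt_zeroExtend f p).fderiv_right
        (m := (⊤ : ℕ∞)) (by simp)).differentiableAt (by simp)
    rw [ev_der_of_hasFDerivAt (ev_der w f) (h1.hasFDerivAt.clm_apply (hasFDerivAt_const w p.1))]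
    simp
  refine ext_ev fun p => ?_
  rw [key, key]
  exact ((contDiffAt_zeroExtend f p).isSymmSndFDerivAt
    (by simp; exact WithTop.coe_le_coe.2 le_top)).eq v w

/-- The calculus of partial derivatives on smooth functions of `(x, y)`. -/
def calculus (Ω : Opens (Vec n × Vec n)) : FibreCalculus n (SmoothAlg Ω) where
  X k := der (Pi.single k 1, 0)
  Y k := der (0, Pi.single k 1)
  y k := mk (fun p => p.2 k) (by fun_prop)
  X_X i j f := der_der _ _ f
  Y_X i j f := der_der _ _ f
  Y_Y i j f := der_der _ _ f
  X_y i j := ext_ev fun p => by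
    have h : HasFDerivAt (fun p : Vec n × Vec n => p.2 j)
        ((ContinuousLinearMap.proj j).comp (ContinuousLinearMap.snd ℝ (Vec n) (Vec n))) p.1 :=
      ((ContinuousLinearMap.proj j).comp
        (ContinuousLinearMap.snd ℝ (Vec n) (Vec n))).hasFDerivAt
    rw [ev_der_of_hasFDerivAt (fun _ => rfl) h]
    simp
  Y_y i j := ext_ev fun p => by
    have h : HasFDerivAt (fun p : Vec n × Vec n => p.2 j)
        ((ContinuousLinearMap.proj j).comp (ContinuousLinearMap.snd ℝ (Vec n) (Vec n))) p.1 :=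
      ((ContinuousLinearMap.proj j).comp
        (ContinuousLinearMap.snd ℝ (Vec n) (Vec n))).hasFDerivAt
    rw [ev_der_of_hasFDerivAt (fun _ => rfl) h]
    by_cases hij : i = j
    · subst hij; simp
    · simp [hij, Ne.symm hij]

@[simp] lemma ev_y (k : Fin n) (p : Ω) : ev p ((calculus Ω).y k) = p.1.2 k := rfl

/-- The element `f` of the algebra represents the function `F` of `(x, y)`. -/
def Rep (f : SmoothAlg Ω) (F : Vec n → Vec n → ℝ) : Prop := ∀ p : Ω, ev p f = F p.1.1 p.1.2

lemma Rep.pdx {f : SmoothAlg Ω} {F : Vec n → Vec n → ℝ} (h : Rep f F) (k : Fin n) :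
    Rep ((calculus Ω).X k f) (pdx F k) := by
  intro p
  have h1 : (fun r : Vec n × Vec n => F r.1 r.2) =ᶠ[nhds p.1] zeroExtend f.1 :=
    (zeroExtend_eventuallyEq_of_ev (F := fun r => F r.1 r.2) h p).symm
  have h2 := (hasFDerivAt_zeroExtend f p).congr_of_eventuallyEq h1
  have h3 : HasFDerivAt (fun x => F x p.1.2) _ p.1.1 :=
    HasFDerivAt.comp (f := fun x => (x, p.1.2)) p.1.1 h2 (hasFDerivAt_prodMk_left p.1.1 p.1.2)
  rw [_root_.pdx, h3.fderiv]
  rfl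

lemma Rep.pdy {f : SmoothAlg Ω} {F : Vec n → Vec n → ℝ} (h : Rep f F) (k : Fin n) :
    Rep ((calculus Ω).Y k f) (pdy F k) := by
  intro p
  have h1 : (fun r : Vec n × Vec n => F r.1 r.2) =ᶠ[nhds p.1] zeroExtend f.1 :=
    (zeroExtend_eventuallyEq_of_ev (F := fun r => F r.1 r.2) h p).symm
  have h2 := (hasFDerivAt_zeroExtend f p).congr_of_eventuallyEq h1
  have h3 : HasFDerivAt (fun y => F p.1.1 y) _ p.1.2 :=
    HasFDerivAt.comp (f := fun y => (p.1.1, y)) p.1.2 h2 (hasFDerivAt_prodMk_right p.1.1 p.1.2)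
  rw [_root_.pdy, h3.fderiv]
  rfl

lemma exists_inv (f : SmoothAlg Ω) (hf : ∀ p, ev p f ≠ 0) : ∃ g : SmoothAlg Ω, f * g = 1 := by
  refine ⟨mk (fun p => (zeroExtend f.1 p)⁻¹) ((contDiffOn_zeroExtend f).inv fun p hp => ?_),
    ext_ev fun p => ?_⟩
  · rw [zeroExtend_eq_ev f ⟨p, hp⟩]; exact hf _
  · rw [map_mul, ev_mk, zeroExtend_eq_ev, map_one]; exact mul_inv_cancel₀ (hf p)

lemma exists_sqrt (f : SmoothAlg Ω) (hf : ∀ p, 0 < ev p f) :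
    ∃ g : SmoothAlg Ω, g ^ 2 = f ∧ ∀ p, ev p g = Real.sqrt (ev p f) := by
  refine ⟨mk (fun p => Real.sqrt (zeroExtend f.1 p))
    ((contDiffOn_zeroExtend f).sqrt fun p hp => ?_), ext_ev fun p => ?_, fun p => ?_⟩
  · rw [zeroExtend_eq_ev f ⟨p, hp⟩]; exact (hf _).ne'
  · rw [map_pow, ev_mk, zeroExtend_eq_ev]; exact Real.sq_sqrt (hf p).le
  · rw [ev_mk, zeroExtend_eq_ev]

lemma rep_curv {G : Fin n → SmoothAlg Ω} {G' : Fin n → Vec n → Vec n → ℝ}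
    (h : ∀ i, Rep (G i) (G' i)) (i k : Fin n) :
    Rep ((calculus Ω).curv G i k) (curvOfSpray G' i k) := by
  intro p
  simp only [FibreCalculus.curv, curvOfSpray, map_sub, map_add, map_mul, map_sum, map_ofNat, ev_y,
    (h i).pdx k p, ((h i).pdy k).pdx _ p, ((h i).pdy k).pdy _ p, (h _).pdy _ p, h _ p]

end SmoothAlg

end

section

open TopologicalSpace

variable {n : ℕ}

/-- A metric tensor that is independent of the fibre, with the inverse tensor. -/
def AlphaBeta.ofMatrix {A : Type*} [CommRing A] [Algebra ℝ A] (c : FibreCalculus n A)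
    (a : Matrix (Fin n) (Fin n) A) (b : Fin n → A) (hdet : IsUnit a.det) (hs : a.IsSymm)
    (hYa : ∀ k i j, c.Y k (a i j) = 0) (hYb : ∀ k i, c.Y k (b i) = 0) : AlphaBeta c where
  a := a
  ai i j := a⁻¹ i j
  b := b
  Y_a := hYa
  Y_ai k i j := by
    have h1 := congrFun₂ (Matrix.mul_nonsing_inv a hdet)
    have h2 : ∀ l, ∑ m, a l m * c.Y k (a⁻¹ m j) = 0 := by
      intro l
      have h3 := congrArg (c.Y k) (h1 l j)
      rw [Matrix.mul_apply, Matrix.one_apply] at h3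
      have h4 : c.Y k (if l = j then 1 else 0) = 0 := by split_ifs <;> simp
      rw [h4] at h3
      simpa [Derivation.leibniz, hYa] using h3
    have h5 : a.mulVec (fun m => c.Y k (a⁻¹ m j)) = 0 := funext h2
    have h6 := congrArg (a⁻¹.mulVec) h5
    rw [Matrix.mulVec_mulVec, Matrix.nonsing_inv_mul a hdet, Matrix.one_mulVec,
      Matrix.mulVec_zero] at h6
    exact congrFun h6 i
  Y_b := hYb
  a_symm i j := hs.apply j i
  ai_symm i j := by
    have : (a⁻¹).IsSymm := by rw [Matrix.IsSymm, Matrix.transpose_nonsing_inv, hs]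
    exact this.apply j i
  a_ai i k := by
    have h1 := congrFun₂ (Matrix.mul_nonsing_inv a hdet) i k
    rwa [Matrix.mul_apply, Matrix.one_apply] at h1

/-- Smooth coefficients of a square metric on an open set. -/
structure SquareData (U : Set (Vec n)) (a : Vec n → Matrix (Fin n) (Fin n) ℝ)
    (b : Vec n → Vec n) : Prop where
  isOpen : IsOpen U
  contDiffOn_a : ∀ i j, ContDiffOn ℝ (⊤ : ℕ∞) (fun x => a x i j) U
  contDiffOn_b : ∀ i, ContDiffOn ℝ (⊤ : ℕ∞) (fun x => b x i) U
  isSymm : ∀ x ∈ U, (a x).IsSymm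
  posDef : ∀ x ∈ U, (a x).PosDef
  bsq_pos : ∀ x ∈ U, 0 < bsq a b x
  bsq_lt_one : ∀ x ∈ U, bsq a b x < 1

namespace SmoothAlg

variable {Ω : Opens (Vec n × Vec n)}

@[simp] lemma ev_halfOf (p : Ω) : ev p (halfOf (SmoothAlg Ω)) = 1 / 2 :=
  (ev p).commutes _

/-- A function of `x` as an element of the algebra. -/
def base {U : Set (Vec n)} (hΩ : ∀ p ∈ Ω, p.1 ∈ U) (f : Vec n → ℝ)
    (hf : ContDiffOn ℝ (⊤ : ℕ∞) f U) : SmoothAlg Ω :=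
  mk (fun p => f p.1) (hf.comp contDiffOn_fst hΩ)

lemma rep_base {U : Set (Vec n)} (hΩ : ∀ p ∈ Ω, p.1 ∈ U) (f : Vec n → ℝ)
    (hf : ContDiffOn ℝ (⊤ : ℕ∞) f U) : Rep (base hΩ f hf) fun x _ => f x := fun _ => rfl

lemma Y_of_rep {f : SmoothAlg Ω} {F : Vec n → ℝ} (h : Rep f fun x _ => F x) (k : Fin n) :
    (calculus Ω).Y k f = 0 := by
  refine ext_ev fun p => ?_
  rw [h.pdy k p]
  simp [pdy]

variable {U : Set (Vec n)} {a : Vec n → Matrix (Fin n) (Fin n) ℝ} {b : Vec n → Vec n}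

/-- The metric tensor as a matrix over the algebra of smooth functions. -/
def metric (H : SquareData U a b) (hΩ : ∀ p ∈ Ω, p.1 ∈ U) :
    Matrix (Fin n) (Fin n) (SmoothAlg Ω) :=
  Matrix.of fun i j => base hΩ (fun x => a x i j) (H.contDiffOn_a i j)

lemma metric_map (H : SquareData U a b) (hΩ : ∀ p ∈ Ω, p.1 ∈ U) (p : Ω) :
    (metric H hΩ).map (ev p) = a p.1.1 := rfl

lemma isUnit_det_metric (H : SquareData U a b) (hΩ : ∀ p ∈ Ω, p.1 ∈ U) :
    IsUnit (metric H hΩ).det := by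
  obtain ⟨g, hg⟩ := exists_inv (metric H hΩ).det fun p => by
    rw [AlgHom.map_det, AlgHom.mapMatrix_apply, metric_map]
    exact (H.posDef _ (hΩ p p.2)).det_pos.ne'
  exact IsUnit.of_mul_eq_one g hg

/-- The data of a square metric over the algebra of smooth functions. -/
def alphaBeta (H : SquareData U a b) (hΩ : ∀ p ∈ Ω, p.1 ∈ U) : AlphaBeta (calculus Ω) :=
  AlphaBeta.ofMatrix (calculus Ω) (metric H hΩ)
    (fun i => base hΩ (fun x => b x i) (H.contDiffOn_b i)) (isUnit_det_metric H hΩ)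
    (Matrix.IsSymm.ext fun i j => ext_ev fun p => (H.isSymm _ (hΩ p p.2)).apply i j)
    (fun k i j => Y_of_rep (rep_base hΩ (fun x => a x i j) (H.contDiffOn_a i j)) k)
    (fun k _ => Y_of_rep (rep_base hΩ _ _) k)

section

variable (H : SquareData U a b) (hΩ : ∀ p ∈ Ω, p.1 ∈ U)

lemma rep_a (i j : Fin n) : Rep ((alphaBeta H hΩ).a i j) fun x _ => a x i j := fun _ => rfl

lemma rep_b (i : Fin n) : Rep ((alphaBeta H hΩ).b i) fun x _ => b x i := fun _ => rfl

lemma rep_ai (i j : Fin n) : Rep ((alphaBeta H hΩ).ai i j) fun x _ => (a x)⁻¹ i j := by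
  intro p
  have h : a p.1.1 * (metric H hΩ)⁻¹.map (ev p) = 1 := by
    rw [← metric_map H hΩ p, ← Matrix.map_mul, Matrix.mul_nonsing_inv _ (isUnit_det_metric H hΩ)]
    simp
  exact (congrFun₂ (Matrix.inv_eq_right_inv h) i j).symm

lemma rep_Γ (k i j : Fin n) :
    Rep ((alphaBeta H hΩ).Γ k i j) fun x _ => christoffel a k i j x := by
  intro p
  simp only [AlphaBeta.Γ, christoffel, map_mul, map_sum, map_add, map_sub, ev_halfOf,
    rep_ai H hΩ _ _ p, (rep_a H hΩ _ _).pdx _ p]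
  rfl

lemma rep_G (i : Fin n) : Rep ((alphaBeta H hΩ).G i) (sprayOf a i) := by
  intro p
  simp only [AlphaBeta.G, sprayOf, map_mul, map_sum, ev_halfOf, rep_Γ H hΩ _ _ _ p, ev_y]

lemma rep_cov (i j : Fin n) : Rep ((alphaBeta H hΩ).cov i j) fun x _ => covDeriv a b i j x := by
  intro p
  simp only [AlphaBeta.cov, covDeriv, map_mul, map_sum, map_sub, rep_Γ H hΩ _ _ _ p,
    (rep_b H hΩ _).pdx _ p, rep_b H hΩ _ p]
  rfl

lemma rep_bsq : Rep (alphaBeta H hΩ).bsq fun x _ => bsq a b x := by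
  intro p
  simp only [AlphaBeta.bsq, bsq, map_mul, map_sum, rep_ai H hΩ _ _ p, rep_b H hΩ _ p]

lemma rep_q : Rep (alphaBeta H hΩ).q fun x y => ∑ i, ∑ j, a x i j * y i * y j := by
  intro p
  simp only [AlphaBeta.q, map_mul, map_sum, rep_a H hΩ _ _ p, ev_y]

lemma rep_β : Rep (alphaBeta H hΩ).β (betaOf b) := by
  intro p
  simp only [AlphaBeta.β, betaOf, map_mul, map_sum, rep_b H hΩ _ p, ev_y]

lemma rep_low_y (k : Fin n) :
    Rep ((alphaBeta H hΩ).low (calculus Ω).y k) fun x y => ∑ j, a x k j * y j := by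
  intro p
  simp only [AlphaBeta.low, map_mul, map_sum, rep_a H hΩ _ _ p, ev_y]

lemma rep_upb (i : Fin n) :
    Rep ((alphaBeta H hΩ).up (alphaBeta H hΩ).b i) fun x _ => ∑ j, (a x)⁻¹ i j * b x j := by
  intro p
  simp only [AlphaBeta.up, map_mul, map_sum, rep_ai H hΩ _ _ p, rep_b H hΩ _ p]

end

end SmoothAlg

end

section

open TopologicalSpace

variable {n : ℕ}

/-- The bilinear form of a matrix. -/
def ip (g : Matrix (Fin n) (Fin n) ℝ) (v w : Vec n) : ℝ := v ⬝ᵥ g.mulVec w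

section ip

variable {g : Matrix (Fin n) (Fin n) ℝ}

lemma ip_eq_sum (v w : Vec n) : ip g v w = ∑ i, ∑ j, g i j * v i * w j := by
  simp only [ip, dotProduct, Matrix.mulVec, Finset.mul_sum]
  refine Finset.sum_congr rfl fun i _ => Finset.sum_congr rfl fun j _ => by ring

lemma ip_add_left (v v' w : Vec n) : ip g (v + v') w = ip g v w + ip g v' w := add_dotProduct _ _ _

lemma ip_add_right (v w w' : Vec n) : ip g v (w + w') = ip g v w + ip g v w' := by
  rw [ip, Matrix.mulVec_add, dotProduct_add]; rfl

lemma ip_smul_left (r : ℝ) (v w : Vec n) : ip g (r • v) w = r * ip g v w := smul_dotProduct _ _ _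

lemma ip_smul_right (r : ℝ) (v w : Vec n) : ip g v (r • w) = r * ip g v w := by
  rw [ip, Matrix.mulVec_smul, dotProduct_smul]; rfl

lemma ip_zero_left (w : Vec n) : ip g 0 w = 0 := zero_dotProduct _

lemma ip_sub_left (v v' w : Vec n) : ip g (v - v') w = ip g v w - ip g v' w := sub_dotProduct _ _ _

lemma ip_sub_right (v w w' : Vec n) : ip g v (w - w') = ip g v w - ip g v w' := by
  rw [ip, Matrix.mulVec_sub, dotProduct_sub]; rfl

lemma ip_comm (hs : g.IsSymm) (v w : Vec n) : ip g v w = ip g w v := by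
  rw [ip, ip, dotProduct_comm, ← Matrix.vecMul_transpose, hs, Matrix.dotProduct_mulVec]

variable (hg : g.PosDef)
include hg

lemma ip_pos {v : Vec n} (hv : v ≠ 0) : 0 < ip g v v := by
  have := hg.dotProduct_mulVec_pos hv
  rwa [star_trivial] at this

lemma ip_nonneg (v : Vec n) : 0 ≤ ip g v v := by
  rcases eq_or_ne v 0 with rfl | h
  · rw [ip_zero_left]
  · exact (ip_pos hg h).le

lemma ip_symm (v w : Vec n) : ip g v w = ip g w v :=
  ip_comm (by
    have h := hg.isHermitian
    rwa [Matrix.IsHermitian, Matrix.conjTranspose_eq_transpose_of_trivial] at h) v w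

lemma ip_sq_le (v w : Vec n) : ip g v w ^ 2 ≤ ip g v v * ip g w w := by
  rcases eq_or_ne w 0 with rfl | h
  · rw [ip_symm hg v 0, ip_zero_left, ip_zero_left]; simp
  · have h1 := ip_pos hg h
    have h2 := ip_nonneg hg (ip g w w • v - ip g v w • w)
    simp only [ip_sub_left, ip_sub_right, ip_smul_left, ip_smul_right, ip_symm hg w v] at h2
    nlinarith

/-- The vector dual to a covector. -/
lemma ip_sharp (b v : Vec n) : ip g (g⁻¹.mulVec b) v = b ⬝ᵥ v := by
  rw [ip_symm hg, ip, Matrix.mulVec_mulVec, Matrix.mul_nonsing_inv _ hg.det_pos.ne'.isUnit,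
    Matrix.one_mulVec, dotProduct_comm]

lemma exists_unit_orthogonal (hn : 3 ≤ n) (v w : Vec n) :
    ∃ z, ip g z z = 1 ∧ ip g v z = 0 ∧ ip g w z = 0 := by
  let f : Vec n →ₗ[ℝ] (Fin 2 → ℝ) :=
    Matrix.mulVecLin (Matrix.of ![Matrix.vecMul v g, Matrix.vecMul w g])
  obtain ⟨z, hz, hz0⟩ := f.ker.exists_mem_ne_zero_of_ne_bot
    (LinearMap.ker_ne_bot_of_finrank_lt (by simp; lia))
  have hf : f z = 0 := hz
  have h0 : ip g v z = 0 := by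
    have := congrFun hf 0
    simpa [f, Matrix.mulVec, ip, Matrix.dotProduct_mulVec] using this
  have h1 : ip g w z = 0 := by
    have := congrFun hf 1
    simpa [f, Matrix.mulVec, ip, Matrix.dotProduct_mulVec] using this
  have hp := ip_pos hg hz0
  refine ⟨(Real.sqrt (ip g z z))⁻¹ • z, ?_, ?_, ?_⟩
  · rw [ip_smul_left, ip_smul_right, ← mul_assoc, ← mul_inv, Real.mul_self_sqrt hp.le,
      inv_mul_cancel₀ hp.ne']
  · rw [ip_smul_right, h0, mul_zero]
  · rw [ip_smul_right, h1, mul_zero]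

end ip

namespace SquareData

variable {U : Set (Vec n)} {a : Vec n → Matrix (Fin n) (Fin n) ℝ} {b : Vec n → Vec n}
  (H : SquareData U a b)
include H

/-- The pairs `(x, y)` with `x ∈ U`. -/
def total : Opens (Vec n × Vec n) := ⟨{p | p.1 ∈ U}, H.isOpen.preimage continuous_fst⟩

/-- The pairs `(x, y)` with `x ∈ U` and `y ≠ 0`. -/
def slit : Opens (Vec n × Vec n) :=
  ⟨{p | p.1 ∈ U ∧ p.2 ≠ 0}, (H.isOpen.preimage continuous_fst).inter
    (isOpen_ne.preimage continuous_snd)⟩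

lemma slit_fst : ∀ p ∈ H.slit, p.1 ∈ U := fun _ h => h.1

lemma total_fst : ∀ p ∈ H.total, p.1 ∈ U := fun _ h => h

omit H in
lemma bsq_eq (x : Vec n) : bsq a b x = b x ⬝ᵥ (a x)⁻¹.mulVec (b x) := by
  rw [← ip, ip_eq_sum, bsq]

variable {x : Vec n} (hx : x ∈ U)
include hx

lemma ip_sharp_sharp :
    ip (a x) ((a x)⁻¹.mulVec (b x)) ((a x)⁻¹.mulVec (b x)) = bsq a b x := by
  rw [ip_sharp (H.posDef x hx), bsq_eq]

lemma beta_sq_le (y : Vec n) : betaOf b x y ^ 2 ≤ bsq a b x * ip (a x) y y := by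
  have h := ip_sq_le (H.posDef x hx) ((a x)⁻¹.mulVec (b x)) y
  rwa [H.ip_sharp_sharp hx, ip_sharp (H.posDef x hx)] at h

lemma alpha_sq (y : Vec n) : alphaOf a x y ^ 2 = ip (a x) y y := by
  rw [alphaOf, ← ip_eq_sum, Real.sq_sqrt (ip_nonneg (H.posDef x hx) y)]

variable {y : Vec n} (hy : y ≠ 0)
include hy

lemma alpha_pos : 0 < alphaOf a x y := by
  rw [alphaOf, ← ip_eq_sum]; exact Real.sqrt_pos.2 (ip_pos (H.posDef x hx) hy)

lemma abs_beta_lt_alpha : |betaOf b x y| < alphaOf a x y := by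
  refine abs_lt_of_sq_lt_sq ?_ (H.alpha_pos hx hy).le
  rw [H.alpha_sq hx]
  nlinarith [H.beta_sq_le hx y, H.bsq_lt_one x hx, ip_pos (H.posDef x hx) hy]

lemma disc_pos : 0 < (1 + 2 * bsq a b x) * alphaOf a x y ^ 2 - 3 * betaOf b x y ^ 2 := by
  rw [H.alpha_sq hx]
  nlinarith [H.beta_sq_le hx y, H.bsq_lt_one x hx, ip_pos (H.posDef x hx) hy]

end SquareData

namespace SmoothAlg

variable {U : Set (Vec n)} {a : Vec n → Matrix (Fin n) (Fin n) ℝ} {b : Vec n → Vec n}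
  (H : SquareData U a b)

/-- The data of a square metric over the smooth functions of `(x, y)`, `y ≠ 0`. -/
def slitAB : AlphaBeta (calculus H.slit) := alphaBeta H H.slit_fst

lemma ev_q (p : H.slit) : ev p (slitAB H).q = ip (a p.1.1) p.1.2 p.1.2 := by
  rw [ip_eq_sum]; exact rep_q H H.slit_fst p

lemma ev_β (p : H.slit) : ev p (slitAB H).β = betaOf b p.1.1 p.1.2 := rep_β H H.slit_fst p

lemma ev_bsq (p : H.slit) : ev p (slitAB H).bsq = bsq a b p.1.1 := rep_bsq H H.slit_fst p

lemma ev_D (p : H.slit) : ev p (slitAB H).D = (1 + 2 * bsq a b p.1.1) * ip (a p.1.1) p.1.2 p.1.2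
    - 3 * betaOf b p.1.1 p.1.2 ^ 2 := by
  simp only [AlphaBeta.D, AlphaBeta.c0, map_sub, map_add, map_mul, map_pow, map_ofNat, map_one,
    ev_bsq, ev_q, ev_β]

lemma exists_root : ∃ N : (slitAB H).Root, ∃ Fi : SmoothAlg H.slit,
    N.F * Fi = 1 ∧ (∀ p, ev p N.α = alphaOf a p.1.1 p.1.2) ∧ Rep N.F (sqMetric a b) := by
  obtain ⟨α, hα, hα'⟩ := exists_sqrt (slitAB H).q fun p => by
    rw [ev_q]; exact ip_pos (H.posDef _ p.2.1) p.2.2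
  have hα2 : ∀ p, ev p α = alphaOf a p.1.1 p.1.2 := fun p => by
    rw [hα', ev_q, alphaOf, ip_eq_sum]
  obtain ⟨αi, hαi⟩ := exists_inv α fun p => by
    rw [hα2]; exact (H.alpha_pos p.2.1 p.2.2).ne'
  obtain ⟨mi, hmi⟩ := exists_inv (α - (slitAB H).β) fun p => by
    rw [map_sub, hα2, ev_β]
    exact (sub_pos.2 (lt_of_abs_lt (H.abs_beta_lt_alpha p.2.1 p.2.2))).ne'
  obtain ⟨Di, hDi⟩ := exists_inv (slitAB H).D fun p => by
    rw [ev_D, ← H.alpha_sq p.2.1]; exact (H.disc_pos p.2.1 p.2.2).ne'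
  let N : (slitAB H).Root := ⟨α, αi, mi, Di, hα, hαi, hmi, hDi⟩
  have hF : Rep N.F (sqMetric a b) := fun p => by
    have h1 := congrArg (ev p) hαi
    rw [map_mul, map_one, hα2] at h1
    have h2 := (H.alpha_pos p.2.1 p.2.2).ne'
    have h3 : ev p αi = (alphaOf a p.1.1 p.1.2)⁻¹ := eq_inv_of_mul_eq_one_right h1
    have e1 : N.α = α := rfl
    have e2 : N.αi = αi := rfl
    simp only [AlphaBeta.Root.F, map_add, map_mul, map_ofNat, map_pow, e1, e2, hα2, h3, ev_β,
      sqMetric]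
    field_simp
    ring
  obtain ⟨Fi, hFi⟩ := exists_inv N.F fun p => by
    rw [hF p]
    have h1 := H.alpha_pos p.2.1 p.2.2
    have h2 := neg_lt_of_abs_lt (H.abs_beta_lt_alpha p.2.1 p.2.2)
    have h3 : 0 < alphaOf a p.1.1 p.1.2 + betaOf b p.1.1 p.1.2 := by linarith
    exact (div_pos (pow_pos h3 2) h1).ne'
  exact ⟨N, Fi, hFi, hα2, hF⟩

end SmoothAlg

end

section

open TopologicalSpace

variable {n : ℕ}

namespace AlphaBeta

variable {A : Type*} [CommRing A] [Algebra ℝ A] {c : FibreCalculus n A} (M : AlphaBeta c)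
  (φ : A →ₐ[ℝ] ℝ)

/-- The metric tensor at a point. -/
def metricAt : Matrix (Fin n) (Fin n) ℝ := Matrix.of fun i j => φ (M.a i j)

lemma map_low (v : Fin n → A) (i : Fin n) :
    φ (M.low v i) = (M.metricAt φ).mulVec (fun j => φ (v j)) i := by
  simp only [low, map_sum, map_mul, Matrix.mulVec, dotProduct, metricAt, Matrix.of_apply]

lemma map_dot (v w : Fin n → A) : φ (dot v w) = (fun i => φ (v i)) ⬝ᵥ fun i => φ (w i) := by
  simp only [dot, map_sum, map_mul, dotProduct]

lemma map_q : φ M.q = ip (M.metricAt φ) (fun i => φ (c.y i)) fun i => φ (c.y i) := by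
  simp only [q, ip_eq_sum, map_sum, map_mul, metricAt, Matrix.of_apply]

namespace Root

variable {M} (N : M.Root)

lemma map_αi_eq : φ N.αi = (φ N.α)⁻¹ :=
  eq_inv_of_mul_eq_one_right (by rw [← map_mul, N.α_αi, map_one])

/-- The fundamental tensor at a point. -/
def fundAt : Matrix (Fin n) (Fin n) ℝ := Matrix.of fun i j => 1 / 2 * φ (c.Y i (c.Y j (N.F ^ 2)))

lemma fundAt_apply (i j : Fin n) : N.fundAt φ i j =
    φ (c.Y i N.F) * φ (c.Y j N.F) + φ N.F * φ (c.Y i (c.Y j N.F)) := by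
  simp only [fundAt, Matrix.of_apply, pow_two, Derivation.leibniz, map_add, smul_eq_mul, map_mul]
  ring

lemma sum_map_Y_F (v : Vec n) (h0 : φ N.α ≠ 0) : ∑ i, v i * φ (c.Y i N.F) =
    (φ N.α ^ 2 - φ M.β ^ 2) / φ N.α ^ 3 * ip (M.metricAt φ) v (fun i => φ (c.y i))
      + 2 * (φ N.α + φ M.β) / φ N.α * (v ⬝ᵥ fun i => φ (M.b i)) := by
  simp only [Y_F, map_add, map_sub, map_mul, map_pow, map_ofNat, map_low, map_αi_eq, ip, dotProduct,
    mul_add, Finset.sum_add_distrib, mul_left_comm (v _), ← Finset.mul_sum]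
  field_simp

lemma fundAt_form (v : Vec n) (h0 : φ N.α ≠ 0) :
    v ⬝ᵥ (N.fundAt φ).mulVec v = (∑ i, v i * φ (c.Y i N.F)) ^ 2 + φ N.F *
        (((φ N.α ^ 2 - φ M.β ^ 2) * (φ N.α ^ 2 * ip (M.metricAt φ) v v
            - ip (M.metricAt φ) v (fun i => φ (c.y i)) ^ 2)
          + 2 * (φ N.α ^ 2 * (v ⬝ᵥ fun i => φ (M.b i))
            - φ M.β * ip (M.metricAt φ) v fun i => φ (c.y i)) ^ 2) / φ N.α ^ 5) := by
  have hv : (fun i => φ (algebraMap ℝ A (v i))) = v := funext fun _ => φ.commutes _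
  have h1 : ∀ l, ∑ i, v i * φ (c.Y i (c.Y l N.F))
      = φ (c.along (fun i => algebraMap ℝ A (v i)) (c.Y l N.F)) := by
    intro l
    simp only [FibreCalculus.along_apply, map_sum, map_mul, φ.commutes, Algebra.algebraMap_self,
      RingHom.id_apply]
  have h2 : v ⬝ᵥ (N.fundAt φ).mulVec v = (∑ i, v i * φ (c.Y i N.F)) ^ 2 + φ N.F *
        ∑ l, v l * ∑ i, v i * φ (c.Y i (c.Y l N.F)) := by
    rw [← ip, ip_eq_sum, pow_two, Finset.sum_mul_sum]
    simp only [fundAt_apply, Finset.mul_sum]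
    rw [Finset.sum_comm (f := fun l i => φ N.F * (v l * (v i * _))), ← Finset.sum_add_distrib]
    refine Finset.sum_congr rfl fun i _ => ?_
    rw [← Finset.sum_add_distrib]
    refine Finset.sum_congr rfl fun j _ => by ring
  rw [h2]
  congr 2
  simp only [h1, along_Y_F, map_add, map_sub, map_mul, map_neg, map_pow, map_ofNat,
    map_low, map_dot, hv, map_αi_eq]
  simp only [mul_add, Finset.sum_add_distrib, mul_left_comm (v _), ← Finset.mul_sum]
  rw [← dotProduct, ← dotProduct, ← dotProduct, ← ip, ← ip]
  field_simp
  ring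

lemma isUnit_det_fundAt (hg : (M.metricAt φ).PosDef) (hs : 0 < φ N.α)
    (hb : |φ M.β| < φ N.α) : IsUnit (N.fundAt φ).det := by
  rw [isUnit_iff_ne_zero]
  intro hdet
  obtain ⟨v, hv, hv0⟩ := Matrix.exists_mulVec_eq_zero_iff.2 hdet
  have h := N.fundAt_form φ v hs.ne'
  rw [hv0, dotProduct_zero, N.sum_map_Y_F φ v hs.ne'] at h
  have hb1 := neg_lt_of_abs_lt hb
  have hb2 := lt_of_abs_lt hb
  have hq := congrArg φ N.α_sq
  rw [map_pow, map_q] at hq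
  have hcs := ip_sq_le hg v fun i => φ (c.y i)
  have hvv := ip_pos hg hv
  have hFp : 0 < φ N.F := by
    have : φ N.F = (φ N.α + φ M.β) ^ 2 / φ N.α := by
      simp only [F, map_add, map_mul, map_pow, map_ofNat, map_αi_eq]
      field_simp
      ring
    rw [this]
    exact div_pos (pow_pos (by linarith) 2) hs
  generalize φ N.F = F at *
  generalize φ N.α = s at *
  generalize φ M.β = β at *
  generalize ip (M.metricAt φ) v (fun i => φ (c.y i)) = vy at *
  generalize ip (M.metricAt φ) v v = vv at *
  generalize (v ⬝ᵥ fun i => φ (M.b i)) = vb at *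
  rw [← hq] at hcs
  have hsb : 0 < s ^ 2 - β ^ 2 := by nlinarith
  have h5 : 0 ≤ (s ^ 2 - β ^ 2) * (s ^ 2 * vv - vy ^ 2) :=
    mul_nonneg hsb.le (by nlinarith)
  have h6 : 0 ≤ F * (((s ^ 2 - β ^ 2) * (s ^ 2 * vv - vy ^ 2) + 2 * (s ^ 2 * vb - β * vy) ^ 2)
      / s ^ 5) := by positivity
  have h7 : F * (((s ^ 2 - β ^ 2) * (s ^ 2 * vv - vy ^ 2) + 2 * (s ^ 2 * vb - β * vy) ^ 2)
      / s ^ 5) = 0 := by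
    refine le_antisymm ?_ h6
    have := sq_nonneg ((s ^ 2 - β ^ 2) / s ^ 3 * vy + 2 * (s + β) / s * vb)
    linarith
  have h8 : (s ^ 2 - β ^ 2) / s ^ 3 * vy + 2 * (s + β) / s * vb = 0 := by
    rw [h7, add_zero] at h
    exact pow_eq_zero_iff (two_ne_zero) |>.1 h.symm
  have h9 : (s ^ 2 - β ^ 2) * (s ^ 2 * vv - vy ^ 2) + 2 * (s ^ 2 * vb - β * vy) ^ 2 = 0 := by
    rw [mul_eq_zero, div_eq_zero_iff] at h7
    rcases h7 with h7 | h7 | h7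
    · exact absurd h7 hFp.ne'
    · exact h7
    · exact absurd h7 (by positivity)
  have h10 : s ^ 2 * vb = β * vy := by
    have : (s ^ 2 * vb - β * vy) ^ 2 = 0 := by nlinarith [sq_nonneg (s ^ 2 * vb - β * vy)]
    linarith [pow_eq_zero_iff (two_ne_zero) |>.1 this]
  have h11 : s ^ 2 * vv = vy ^ 2 := by
    have : (s ^ 2 - β ^ 2) * (s ^ 2 * vv - vy ^ 2) = 0 := by
      nlinarith [sq_nonneg (s ^ 2 * vb - β * vy)]
    rcases mul_eq_zero.1 this with h | h
    · exact absurd h hsb.ne'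
    · linarith
  have h12 : (s + β) ^ 2 * vy = 0 := by
    field_simp at h8
    have h8' : (s + β) * ((s - β) * vy + 2 * (s ^ 2 * vb)) = 0 := by linear_combination h8
    rw [h10] at h8'
    linear_combination h8'
  have h13 : vy = 0 := by
    rcases mul_eq_zero.1 h12 with h | h
    · have := pow_eq_zero_iff (two_ne_zero) |>.1 h
      linarith
    · exact h
  rw [h13] at h11
  have : 0 < s ^ 2 * vv := by positivity
  simp [h11] at this

lemma fundAt_inv_mul {Fi : A} (hFi : N.F * Fi = 1) (hdet : IsUnit (N.fundAt φ).det) (i : Fin n) :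
    1 / 4 * ∑ l, (N.fundAt φ)⁻¹ i l *
      ((∑ k, φ (c.y k) * φ (c.X k (c.Y l (N.F ^ 2)))) - φ (c.X l (N.F ^ 2)))
      = φ (M.G i + N.T i + N.P Fi * c.y i) := by
  set w : Vec n := fun i => φ (M.G i + N.T i + N.P Fi * c.y i) with hw
  have h1 : ∀ l, (∑ k, φ (c.y k) * φ (c.X k (c.Y l (N.F ^ 2)))) - φ (c.X l (N.F ^ 2))
      = 4 * (N.fundAt φ).mulVec w l := by
    intro l
    have h2 := congrArg φ (N.spray_P_Y_sq hFi l)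
    rw [FibreCalculus.spray_apply, FibreCalculus.along_apply, map_sub, map_mul, map_sum, map_sum,
      map_ofNat] at h2
    simp only [Matrix.mulVec, dotProduct, fundAt, Matrix.of_apply, hw]
    simp only [map_mul (f := φ)] at h2
    rw [← h2, sub_sub_cancel, Finset.mul_sum, Finset.mul_sum]
    refine Finset.sum_congr rfl fun j _ => ?_
    rw [c.Y_Y j l]
    ring
  have h4 : (N.fundAt φ)⁻¹.mulVec ((N.fundAt φ).mulVec w) i = w i := by
    rw [Matrix.mulVec_mulVec, Matrix.nonsing_inv_mul _ hdet, Matrix.one_mulVec]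
  simp only [h1]
  change _ = w i
  rw [← h4, Matrix.mulVec, dotProduct, Finset.mul_sum]
  refine Finset.sum_congr rfl fun l _ => by ring

end Root

end AlphaBeta

namespace SmoothAlg

variable {U : Set (Vec n)} {a : Vec n → Matrix (Fin n) (Fin n) ℝ} {b : Vec n → Vec n}
  {H : SquareData U a b} (N : (slitAB H).Root)

lemma fundAt_eq (hF : Rep N.F (sqMetric a b)) (p : H.slit) :
    N.fundAt (ev p) = fundTensor (sqMetric a b) p.1.1 p.1.2 := by
  have h : Rep (N.F ^ 2) (fun x y => sqMetric a b x y ^ 2) := fun p => by rw [map_pow, hF p]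
  ext i j
  exact congrArg (fun r : ℝ => 1 / 2 * r) (((h.pdy j).pdy i) p)

/-- The geodesic coefficients of the square metric. -/
lemma rep_geoCoeff (hα : ∀ p, ev p N.α = alphaOf a p.1.1 p.1.2) (hF : Rep N.F (sqMetric a b))
    {Fi : SmoothAlg H.slit} (hFi : N.F * Fi = 1) (i : Fin n) :
    Rep ((slitAB H).G i + N.T i + N.P Fi * (calculus H.slit).y i) (geoCoeff (sqMetric a b) i) := by
  intro p
  have h : Rep (N.F ^ 2) (fun x y => sqMetric a b x y ^ 2) := fun p => by rw [map_pow, hF p]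
  have hdet : IsUnit (N.fundAt (ev p)).det := by
    refine N.isUnit_det_fundAt (ev p) (H.posDef _ p.2.1) ?_ ?_
    · rw [hα]; exact H.alpha_pos p.2.1 p.2.2
    · rw [hα, ev_β]; exact H.abs_beta_lt_alpha p.2.1 p.2.2
  rw [← N.fundAt_inv_mul (ev p) hFi hdet, fundAt_eq N hF]
  have h1 : ∀ k l, ev p ((calculus H.slit).X k ((calculus H.slit).Y l (N.F ^ 2)))
      = pdx (fun x y => pdy (fun x y => sqMetric a b x y ^ 2) l x y) k p.1.1 p.1.2 :=
    fun k l => ((h.pdy l).pdx k) p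
  have h2 : ∀ l, ev p ((calculus H.slit).X l (N.F ^ 2))
      = pdx (fun x y => sqMetric a b x y ^ 2) l p.1.1 p.1.2 := fun l => h.pdx l p
  simp only [h1, h2, ev_y, geoCoeff]

end SmoothAlg

end

section

open TopologicalSpace

variable {n : ℕ}

namespace SmoothAlg

variable {U : Set (Vec n)} {a : Vec n → Matrix (Fin n) (Fin n) ℝ} {b : Vec n → Vec n}
  {H : SquareData U a b} (N : (slitAB H).Root)

/-- Scalar flag curvature forces the curvature of the projectively equivalent spray to be
isotropic up to the direction of `y`. -/
lemma exists_curv_eq (hα : ∀ p, ev p N.α = alphaOf a p.1.1 p.1.2) (hF : Rep N.F (sqMetric a b))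
    {Fi : SmoothAlg H.slit} (hFi : N.F * Fi = 1) (hK : IsScalarFlag U (sqMetric a b))
    (p : H.slit) : ∃ (r : ℝ) (s : Vec n), ∀ i k,
      ev p ((calculus H.slit).curv (fun i => (slitAB H).G i + N.T i) i k)
        = r * (if i = k then 1 else 0) + s k * p.1.2 i := by
  obtain ⟨K, hK⟩ := hK
  obtain ⟨f, g, hfg⟩ := N.curv_P hFi
  refine ⟨K p.1.1 p.1.2 * sqMetric a b p.1.1 p.1.2 ^ 2 - ev p f,
    fun k => - (K p.1.1 p.1.2 * ∑ j, fundTensor (sqMetric a b) p.1.1 p.1.2 k j * p.1.2 j)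
      - ev p (g k), fun i k => ?_⟩
  have h1 := rep_curv (fun i => rep_geoCoeff N hα hF hFi i) i k p
  rw [hK _ p.2.1 _ p.2.2] at h1
  have h2 := congrArg (ev p) (hfg i k)
  have h3 : ev p (if i = k then 1 else 0) = if i = k then 1 else 0 := by split_ifs <;> simp
  rw [map_add, map_add, map_mul, map_mul, h3, ev_y] at h2
  linear_combination h1 - h2

/-- The curvature form is the same on all unit vectors orthogonal to `y`. -/
lemma sum_curv_eq {p : H.slit} {R : Fin n → Fin n → SmoothAlg H.slit}
    (h : ∃ (r : ℝ) (s : Vec n), ∀ i k, ev p (R i k) = r * (if i = k then 1 else 0) + s k * p.1.2 i)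
    {v w : Vec n} (hv : ip (a p.1.1) v v = ip (a p.1.1) w w) (hv0 : ip (a p.1.1) v p.1.2 = 0)
    (hw0 : ip (a p.1.1) w p.1.2 = 0) :
    ∑ i, ∑ k, (a p.1.1).mulVec v i * v k * ev p (R i k)
      = ∑ i, ∑ k, (a p.1.1).mulVec w i * w k * ev p (R i k) := by
  obtain ⟨r, s, h⟩ := h
  have hs := H.isSymm _ p.2.1
  have key : ∀ v, ip (a p.1.1) v p.1.2 = 0 →
      ∑ i, ∑ k, (a p.1.1).mulVec v i * v k * ev p (R i k) = r * ip (a p.1.1) v v := by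
    intro v hv0
    have h1 : ∑ i, (a p.1.1).mulVec v i * p.1.2 i = 0 := by
      rw [ip_comm hs] at hv0
      rw [← hv0, ip, dotProduct]
      exact Finset.sum_congr rfl fun i _ => mul_comm _ _
    have h2 : ∀ i, ∑ k, (a p.1.1).mulVec v i * v k * ev p (R i k)
        = r * (v i * (a p.1.1).mulVec v i)
          + (a p.1.1).mulVec v i * p.1.2 i * ∑ k, v k * s k := by
      intro i
      simp only [h, mul_add, Finset.sum_add_distrib, Finset.mul_sum]
      congr 1
      · simp; ring
      · exact Finset.sum_congr rfl fun k _ => by ring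
    simp only [h2, Finset.sum_add_distrib, ← Finset.sum_mul, h1, ← Finset.mul_sum, zero_mul,
      add_zero]
    rfl
  rw [key v hv0, key w hw0, hv]

end SmoothAlg

open Polynomial in
/-- The function `f` of an angle is a rational function of `exp (θ * I)` with value `v` at `w`. -/
def HasRatVal (w : ℂ) (f : ℝ → ℝ) (v : ℂ) : Prop :=
  ∃ P Q : ℂ[X], Q.eval w ≠ 0 ∧
    (∀ θ : ℝ, Q.eval (Complex.exp (θ * Complex.I)) * f θ = P.eval (Complex.exp (θ * Complex.I)))
    ∧ v * Q.eval w = P.eval w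

namespace HasRatVal

open Polynomial

variable {w : ℂ} {f g : ℝ → ℝ} {v v' : ℂ}

lemma const (w : ℂ) (r : ℝ) : HasRatVal w (fun _ => r) r :=
  ⟨C (r : ℂ), 1, by simp, by simp, by simp⟩

lemma add (hf : HasRatVal w f v) (hg : HasRatVal w g v') :
    HasRatVal w (fun θ => f θ + g θ) (v + v') := by
  obtain ⟨P, Q, h1, h2, h3⟩ := hf
  obtain ⟨P', Q', h1', h2', h3'⟩ := hg
  refine ⟨P * Q' + P' * Q, Q * Q', by simp [h1, h1'], fun θ => ?_, ?_⟩
  · simp only [eval_mul, eval_add, ← h2, ← h2']; push_cast; ring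
  · simp only [eval_mul, eval_add, ← h3, ← h3']; ring

lemma mul (hf : HasRatVal w f v) (hg : HasRatVal w g v') :
    HasRatVal w (fun θ => f θ * g θ) (v * v') := by
  obtain ⟨P, Q, h1, h2, h3⟩ := hf
  obtain ⟨P', Q', h1', h2', h3'⟩ := hg
  refine ⟨P * P', Q * Q', by simp [h1, h1'], fun θ => ?_, ?_⟩
  · simp only [eval_mul, ← h2, ← h2']; push_cast; ring
  · simp only [eval_mul, ← h3, ← h3']; ring

lemma const_mul (r : ℝ) (hf : HasRatVal w f v) : HasRatVal w (fun θ => r * f θ) (r * v) :=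
  (const w r).mul hf

lemma neg (hf : HasRatVal w f v) : HasRatVal w (fun θ => - f θ) (-v) := by
  simpa using hf.const_mul (-1)

lemma sub (hf : HasRatVal w f v) (hg : HasRatVal w g v') :
    HasRatVal w (fun θ => f θ - g θ) (v - v') := by
  simpa [sub_eq_add_neg] using hf.add hg.neg

lemma pow (hf : HasRatVal w f v) (k : ℕ) : HasRatVal w (fun θ => f θ ^ k) (v ^ k) := by
  induction k with
  | zero => simpa using const w 1
  | succ k ih => simpa [pow_succ] using ih.mul hf

lemma sum {ι : Type*} (s : Finset ι) {F : ι → ℝ → ℝ} {V : ι → ℂ}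
    (h : ∀ i ∈ s, HasRatVal w (F i) (V i)) :
    HasRatVal w (fun θ => ∑ i ∈ s, F i θ) (∑ i ∈ s, V i) := by
  classical
  induction s using Finset.induction_on with
  | empty => simpa using const w 0
  | insert i s hi ih =>
    simp only [Finset.sum_insert hi]
    exact (h i (by simp)).add (ih fun j hj => h j (by simp [hj]))

lemma inv (hf : HasRatVal w f v) (hfg : ∀ θ, f θ * g θ = 1) (hv : v ≠ 0) :
    HasRatVal w g v⁻¹ := by
  obtain ⟨P, Q, h1, h2, h3⟩ := hf
  refine ⟨Q, P, by rw [← h3]; exact mul_ne_zero hv h1, fun θ => ?_, ?_⟩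
  · rw [← h2, mul_assoc, ← Complex.ofReal_mul, hfg, Complex.ofReal_one, mul_one]
  · rw [← h3, inv_mul_cancel_left₀ hv]

section

variable {C₀ S₀ : ℂ} (h : C₀ ^ 2 + S₀ ^ 2 = 1)
include h

lemma point_ne_zero : C₀ + S₀ * Complex.I ≠ 0 := by
  intro h0
  have : (C₀ + S₀ * Complex.I) * (C₀ - S₀ * Complex.I) = 1 := by
    linear_combination h - S₀ ^ 2 * Complex.I_sq
  rw [h0, zero_mul] at this
  exact zero_ne_one this

lemma cos : HasRatVal (C₀ + S₀ * Complex.I) Real.cos C₀ := by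
  refine ⟨X ^ 2 + 1, 2 * X, by simpa using point_ne_zero h, fun θ => ?_, ?_⟩
  · simp only [eval_mul, eval_X, eval_add, eval_pow, eval_one, eval_ofNat, Complex.exp_mul_I,
      Complex.ofReal_cos]
    linear_combination Complex.sin_sq_add_cos_sq (θ : ℂ)
      - Complex.sin θ ^ 2 * Complex.I_sq
  · simp only [eval_mul, eval_X, eval_add, eval_pow, eval_one, eval_ofNat]
    linear_combination h - S₀ ^ 2 * Complex.I_sq

lemma sin : HasRatVal (C₀ + S₀ * Complex.I) Real.sin S₀ := by
  refine ⟨X ^ 2 - 1, C (2 * Complex.I) * X, by simpa using point_ne_zero h, fun θ => ?_, ?_⟩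
  · simp only [eval_mul, eval_X, eval_sub, eval_pow, eval_one, eval_C, Complex.exp_mul_I,
      Complex.ofReal_sin]
    linear_combination (-1 : ℂ) * Complex.sin_sq_add_cos_sq (θ : ℂ)
      + Complex.sin θ ^ 2 * Complex.I_sq
  · simp only [eval_mul, eval_X, eval_sub, eval_pow, eval_one, eval_C]
    linear_combination -h + S₀ ^ 2 * Complex.I_sq

end

lemma eq_zero (h : HasRatVal w (fun _ => 0) v) : v = 0 := by
  obtain ⟨P, Q, h1, h2, h3⟩ := h
  have hP : P = 0 := by
    refine eq_zero_of_infinite_isRoot P (Set.Infinite.mono ?_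
      (Set.infinite_range_of_injective (f := fun k : ℕ =>
        Complex.exp (((k : ℝ) : ℂ) * Complex.I)) ?_))
    · rintro _ ⟨k, rfl⟩
      simpa [IsRoot] using (h2 k).symm
    · intro k l hkl
      obtain ⟨m, hm⟩ := Complex.exp_eq_exp_iff_exists_int.1 hkl
      have h4 : (k : ℝ) = l + m * (2 * Real.pi) := by
        have : ((k : ℝ) : ℂ) = ((l + m * (2 * Real.pi) : ℝ) : ℂ) := by
          apply mul_right_cancel₀ Complex.I_ne_zero
          rw [hm]; push_cast; ring
        exact_mod_cast this
      by_contra hne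
      have hm0 : m ≠ 0 := by
        rintro rfl
        simp at h4
        exact hne h4
      refine irrational_pi ?_
      refine ⟨((k : ℚ) - l) / (2 * m), ?_⟩
      push_cast
      rw [h4]
      field_simp
      ring
  rw [hP, eval_zero] at h3
  exact (mul_eq_zero.1 h3).resolve_right h1

lemma unique (h : HasRatVal w f v) (h' : HasRatVal w f v') : v = v' := by
  exact sub_eq_zero.1 (eq_zero (w := w) (by simpa using h.sub h'))

end HasRatVal

end

section

open TopologicalSpace

variable {n : ℕ}

lemma FibreCalculus.isStable_adjoin {A : Type*} [CommRing A] [Algebra ℝ A]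
    {c : FibreCalculus n A} {S : Set A} (hX : ∀ k, ∀ f ∈ S, c.X k f ∈ Algebra.adjoin ℝ S)
    (hY : ∀ k, ∀ f ∈ S, c.Y k f ∈ Algebra.adjoin ℝ S) (hy : ∀ k, c.y k ∈ Algebra.adjoin ℝ S) :
    c.IsStable (Algebra.adjoin ℝ S) := by
  have key : ∀ d : Derivation ℝ A A, (∀ f ∈ S, d f ∈ Algebra.adjoin ℝ S) →
      ∀ f ∈ Algebra.adjoin ℝ S, d f ∈ Algebra.adjoin ℝ S := by
    intro d hd f hf
    induction hf using Algebra.adjoin_induction with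
    | mem f hf => exact hd f hf
    | algebraMap r => simp
    | add f g hf hg h1 h2 => rw [map_add]; exact add_mem h1 h2
    | mul f g hf hg h1 h2 =>
      rw [Derivation.leibniz, smul_eq_mul, smul_eq_mul]
      exact add_mem (mul_mem hf h2) (mul_mem hg h1)
  exact ⟨fun k => key _ (hX k), fun k => key _ (hY k), hy⟩

namespace SmoothAlg

variable {U : Set (Vec n)} {a : Vec n → Matrix (Fin n) (Fin n) ℝ} {b : Vec n → Vec n}
  {H : SquareData U a b} (N : (slitAB H).Root)

/-- Functions of the base point, the fibre coordinates, and the norm `α` with its inverse. -/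
def gens : Set (SmoothAlg H.slit) :=
  {f | ∃ F : Vec n → ℝ, Rep f fun x _ => F x} ∪ Set.range (calculus H.slit).y ∪ {N.α, N.αi}

/-- The functions that are regular in `α`, `α⁻¹` and the fibre coordinates. -/
def regular : Subalgebra ℝ (SmoothAlg H.slit) := Algebra.adjoin ℝ (gens N)

/-- The functions that are regular in `α`, `α⁻¹`, `(α - β)⁻¹` and the fibre coordinates. -/
def regularAway : Subalgebra ℝ (SmoothAlg H.slit) := Algebra.adjoin ℝ (insert N.mi (gens N))

lemma regular_le : regular N ≤ regularAway N := Algebra.adjoin_mono (Set.subset_insert _ _)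

lemma mem_regular_of_rep {f : SmoothAlg H.slit} {F : Vec n → ℝ} (h : Rep f fun x _ => F x) :
    f ∈ regular N := Algebra.subset_adjoin (Or.inl (Or.inl ⟨F, h⟩))

lemma y_mem_regular (k : Fin n) : (calculus H.slit).y k ∈ regular N :=
  Algebra.subset_adjoin (Or.inl (Or.inr ⟨k, rfl⟩))

lemma α_mem_regular : N.α ∈ regular N := Algebra.subset_adjoin (Or.inr (Or.inl rfl))

lemma αi_mem_regular : N.αi ∈ regular N := Algebra.subset_adjoin (Or.inr (Or.inr rfl))

lemma mi_mem_regularAway : N.mi ∈ regularAway N := Algebra.subset_adjoin (Set.mem_insert _ _)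

lemma a_mem_regular (i j : Fin n) : (slitAB H).a i j ∈ regular N :=
  mem_regular_of_rep N (rep_a H H.slit_fst i j)

lemma ai_mem_regular (i j : Fin n) : (slitAB H).ai i j ∈ regular N :=
  mem_regular_of_rep N (rep_ai H H.slit_fst i j)

lemma b_mem_regular (i : Fin n) : (slitAB H).b i ∈ regular N :=
  mem_regular_of_rep N (rep_b H H.slit_fst i)

lemma cov_mem_regular (i j : Fin n) : (slitAB H).cov i j ∈ regular N :=
  mem_regular_of_rep N (rep_cov H H.slit_fst i j)

lemma bsq_mem_regular : (slitAB H).bsq ∈ regular N :=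
  mem_regular_of_rep N (rep_bsq H H.slit_fst)

lemma q_mem_regular : (slitAB H).q ∈ regular N :=
  sum_mem fun i _ => sum_mem fun j _ =>
    mul_mem (mul_mem (a_mem_regular N i j) (y_mem_regular N i)) (y_mem_regular N j)

lemma β_mem_regular : (slitAB H).β ∈ regular N :=
  sum_mem fun i _ => mul_mem (b_mem_regular N i) (y_mem_regular N i)

lemma halfOf_mem_regular : halfOf (SmoothAlg H.slit) ∈ regular N :=
  Subalgebra.algebraMap_mem _ _

lemma G_mem_regular (i : Fin n) : (slitAB H).G i ∈ regular N :=
  mul_mem (halfOf_mem_regular N) <| sum_mem fun _ _ => sum_mem fun _ _ =>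
    mul_mem (mul_mem (mem_regular_of_rep N (rep_Γ H H.slit_fst _ _ _)) (y_mem_regular N _))
      (y_mem_regular N _)

lemma up_mem_regular {v : Fin n → SmoothAlg H.slit} (hv : ∀ i, v i ∈ regular N) (i : Fin n) :
    (slitAB H).up v i ∈ regular N :=
  sum_mem fun j _ => mul_mem (ai_mem_regular N i j) (hv j)

lemma s0_mem_regular (i : Fin n) : (slitAB H).s0 i ∈ regular N :=
  mul_mem (halfOf_mem_regular N) <| sum_mem fun j _ =>
    mul_mem (sub_mem (cov_mem_regular N i j) (cov_mem_regular N j i)) (y_mem_regular N j)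

lemma V_mem_regular (i : Fin n) : (slitAB H).V i ∈ regular N :=
  up_mem_regular N (s0_mem_regular N) i

lemma upb_mem_regular (i : Fin n) : (slitAB H).up (slitAB H).b i ∈ regular N :=
  up_mem_regular N (b_mem_regular N) i

lemma σ_mem_regular : (slitAB H).σ ∈ regular N := by
  rw [AlphaBeta.σ, AlphaBeta.dot]
  exact sum_mem fun i _ => mul_mem (upb_mem_regular N i) (s0_mem_regular N i)

lemma r00_mem_regular : (slitAB H).r00 ∈ regular N :=
  sum_mem fun i _ => sum_mem fun j _ =>
    mul_mem (mul_mem (cov_mem_regular N i j) (y_mem_regular N i)) (y_mem_regular N j)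

lemma D_mem_regular : (slitAB H).D ∈ regular N :=
  sub_mem (mul_mem (add_mem (one_mem _) (mul_mem (FibreCalculus.two_mem_subalgebra _)
    (bsq_mem_regular N))) (q_mem_regular N))
    (mul_mem (ofNat_mem _ 3) (pow_mem (β_mem_regular N) 2))

lemma X_base_mem_regular {f : SmoothAlg H.slit} {F : Vec n → ℝ} (h : Rep f fun x _ => F x)
    (k : Fin n) : (calculus H.slit).X k f ∈ regular N :=
  mem_regular_of_rep N (F := fun x => pd F k x) (h.pdx k)

lemma X_q_mem_regular (k : Fin n) : (calculus H.slit).X k (slitAB H).q ∈ regular N := by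
  simp only [AlphaBeta.q, map_sum, Derivation.leibniz, (calculus H.slit).X_y, smul_eq_mul,
    mul_zero, zero_add]
  exact sum_mem fun i _ => sum_mem fun j _ => mul_mem (y_mem_regular N j)
    (mul_mem (y_mem_regular N i) (X_base_mem_regular N (rep_a H H.slit_fst i j) k))

lemma X_β_mem_regular (k : Fin n) : (calculus H.slit).X k (slitAB H).β ∈ regular N := by
  simp only [AlphaBeta.β, map_sum, Derivation.leibniz, (calculus H.slit).X_y, smul_eq_mul,
    mul_zero, zero_add]
  exact sum_mem fun i _ => mul_mem (y_mem_regular N i)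
    (X_base_mem_regular N (rep_b H H.slit_fst i) k)

lemma Y_q_mem_regular (k : Fin n) : (calculus H.slit).Y k (slitAB H).q ∈ regular N := by
  rw [AlphaBeta.Y_q]
  exact mul_mem (FibreCalculus.two_mem_subalgebra _)
    (sum_mem fun j _ => mul_mem (a_mem_regular N k j) (y_mem_regular N j))

lemma Y_β_mem_regular (k : Fin n) : (calculus H.slit).Y k (slitAB H).β ∈ regular N := by
  rw [AlphaBeta.Y_β]
  exact b_mem_regular N k

lemma derivation_α_mem_regular {d : Derivation ℝ (SmoothAlg H.slit) (SmoothAlg H.slit)}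
    (h : d (slitAB H).q ∈ regular N) : d N.α ∈ regular N := by
  rw [N.map_α]
  exact mul_mem (mul_mem (halfOf_mem_regular N) (αi_mem_regular N)) h

lemma derivation_αi_mem_regular {d : Derivation ℝ (SmoothAlg H.slit) (SmoothAlg H.slit)}
    (h : d (slitAB H).q ∈ regular N) : d N.αi ∈ regular N := by
  rw [N.map_αi]
  exact mul_mem (neg_mem (pow_mem (αi_mem_regular N) 2)) (derivation_α_mem_regular N h)

lemma derivation_mi_mem_regularAway {d : Derivation ℝ (SmoothAlg H.slit) (SmoothAlg H.slit)}
    (h : d (slitAB H).q ∈ regular N) (h' : d (slitAB H).β ∈ regular N) :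
    d N.mi ∈ regularAway N := by
  have := FibreCalculus.derivation_inv d N.m_mi
  rw [this, map_sub]
  have h1 := regular_le N (sub_mem (derivation_α_mem_regular N h) h')
  have h2 := mi_mem_regularAway N
  exact mul_mem (neg_mem h1) (pow_mem h2 2)

lemma X_gens_mem (k : Fin n) : ∀ f ∈ gens N, (calculus H.slit).X k f ∈ regular N := by
  rintro f ((⟨F, hF⟩ | ⟨j, rfl⟩) | (rfl | rfl))
  · exact X_base_mem_regular N hF k
  · rw [(calculus H.slit).X_y]; exact zero_mem _
  · exact derivation_α_mem_regular N (X_q_mem_regular N k)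
  · exact derivation_αi_mem_regular N (X_q_mem_regular N k)

lemma Y_gens_mem (k : Fin n) : ∀ f ∈ gens N, (calculus H.slit).Y k f ∈ regular N := by
  rintro f ((⟨F, hF⟩ | ⟨j, rfl⟩) | (rfl | rfl))
  · rw [Y_of_rep hF]; exact zero_mem _
  · rw [(calculus H.slit).Y_y]; split_ifs
    exacts [one_mem _, zero_mem _]
  · exact derivation_α_mem_regular N (Y_q_mem_regular N k)
  · exact derivation_αi_mem_regular N (Y_q_mem_regular N k)

lemma isStable_regular : (calculus H.slit).IsStable (regular N) :=
  FibreCalculus.isStable_adjoin (X_gens_mem N) (Y_gens_mem N) (y_mem_regular N)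

lemma isStable_regularAway : (calculus H.slit).IsStable (regularAway N) := by
  refine FibreCalculus.isStable_adjoin ?_ ?_ fun k => regular_le N (y_mem_regular N k)
  · rintro k f (rfl | hf)
    · exact derivation_mi_mem_regularAway N (X_q_mem_regular N k) (X_β_mem_regular N k)
    · exact regular_le N (X_gens_mem N k f hf)
  · rintro k f (rfl | hf)
    · exact derivation_mi_mem_regularAway N (Y_q_mem_regular N k) (Y_β_mem_regular N k)
    · exact regular_le N (Y_gens_mem N k f hf)

end SmoothAlg

end

section

open TopologicalSpace

variable {n : ℕ}

/-- An orthonormal frame at a point whose first vector is dual to the one-form. -/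
structure SliceFrame (U : Set (Vec n)) (a : Vec n → Matrix (Fin n) (Fin n) ℝ)
    (b : Vec n → Vec n) where
  x : Vec n
  B : ℝ
  e : Vec n
  u : Vec n
  z : Vec n
  mem : x ∈ U
  B_pos : 0 < B
  B_lt_one : B < 1
  bsq_eq : bsq a b x = B ^ 2
  b_dot : ∀ v, b x ⬝ᵥ v = B * ip (a x) e v
  sharp_eq : (a x)⁻¹.mulVec (b x) = B • e
  e_e : ip (a x) e e = 1
  u_u : ip (a x) u u = 1
  z_z : ip (a x) z z = 1
  e_u : ip (a x) e u = 0
  e_z : ip (a x) e z = 0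
  u_z : ip (a x) u z = 0

namespace SliceFrame

variable {U : Set (Vec n)} {a : Vec n → Matrix (Fin n) (Fin n) ℝ} {b : Vec n → Vec n}
  (H : SquareData U a b) (E : SliceFrame U a b)

include H in
lemma u_e : ip (a E.x) E.u E.e = 0 := by rw [ip_comm (H.isSymm _ E.mem), E.e_u]

include H in
lemma z_e : ip (a E.x) E.z E.e = 0 := by rw [ip_comm (H.isSymm _ E.mem), E.e_z]

include H in
lemma z_u : ip (a E.x) E.z E.u = 0 := by rw [ip_comm (H.isSymm _ E.mem), E.u_z]

/-- The unit vectors in the plane of the frame. -/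
def dir (θ : ℝ) : Vec n := Real.cos θ • E.e + Real.sin θ • E.u

/-- The unit vectors in the plane of the frame, orthogonal to `dir`. -/
def perp (θ : ℝ) : Vec n := -Real.sin θ • E.e + Real.cos θ • E.u

include H in
lemma ip_dir_dir (θ : ℝ) : ip (a E.x) (E.dir θ) (E.dir θ) = 1 := by
  simp only [dir, ip_add_left, ip_add_right, ip_smul_left, ip_smul_right, E.e_e, E.u_u, E.e_u,
    E.u_e H]
  linear_combination Real.sin_sq_add_cos_sq θ

include H in
lemma ip_perp_perp (θ : ℝ) : ip (a E.x) (E.perp θ) (E.perp θ) = 1 := by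
  simp only [perp, ip_add_left, ip_add_right, ip_smul_left, ip_smul_right, E.e_e, E.u_u, E.e_u,
    E.u_e H]
  linear_combination Real.sin_sq_add_cos_sq θ

include H in
lemma ip_perp_dir (θ : ℝ) : ip (a E.x) (E.perp θ) (E.dir θ) = 0 := by
  simp only [perp, dir, ip_add_left, ip_add_right, ip_smul_left, ip_smul_right, E.e_e, E.u_u, E.e_u,
    E.u_e H]
  ring

include H in
lemma ip_z_dir (θ : ℝ) : ip (a E.x) E.z (E.dir θ) = 0 := by
  simp only [dir, ip_add_right, ip_smul_right, E.z_e H, E.z_u H]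
  ring

lemma b_dot_dir (θ : ℝ) : b E.x ⬝ᵥ E.dir θ = E.B * Real.cos θ := by
  simp only [E.b_dot, dir, ip_add_right, ip_smul_right, E.e_e, E.e_u]
  ring

lemma b_dot_perp (θ : ℝ) : b E.x ⬝ᵥ E.perp θ = -E.B * Real.sin θ := by
  simp only [E.b_dot, perp, ip_add_right, ip_smul_right, E.e_e, E.e_u]
  ring

lemma b_dot_z : b E.x ⬝ᵥ E.z = 0 := by rw [E.b_dot, E.e_z, mul_zero]

/-- The circle of unit vectors in the plane of the frame. -/
def pt (θ : ℝ) : H.slit := ⟨(E.x, E.dir θ), E.mem, fun h => by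
  have := E.ip_dir_dir H θ
  rw [show E.dir θ = 0 from h, ip_zero_left] at this
  exact zero_ne_one this⟩

open SmoothAlg

lemma ev_y_pt (θ : ℝ) (k : Fin n) : ev (E.pt H θ) ((calculus H.slit).y k)
    = Real.cos θ * E.e k + Real.sin θ * E.u k := rfl

lemma ev_q_pt (θ : ℝ) : ev (E.pt H θ) (slitAB H).q = 1 := by
  rw [ev_q]; exact E.ip_dir_dir H θ

lemma ev_β_pt (θ : ℝ) : ev (E.pt H θ) (slitAB H).β = E.B * Real.cos θ := by
  rw [ev_β]; exact E.b_dot_dir θ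

lemma ev_bsq_pt (θ : ℝ) : ev (E.pt H θ) (slitAB H).bsq = E.B ^ 2 := by
  rw [ev_bsq]; exact E.bsq_eq

lemma ev_D_pt (θ : ℝ) : ev (E.pt H θ) (slitAB H).D
    = 1 + 2 * E.B ^ 2 - 3 * E.B ^ 2 * Real.cos θ ^ 2 := by
  simp only [AlphaBeta.D, AlphaBeta.c0, map_sub, map_add, map_mul, map_pow, map_ofNat, map_one,
    ev_bsq_pt, ev_q_pt, ev_β_pt]
  ring

variable {H} (N : (slitAB H).Root)

lemma ev_α_pt (hα : ∀ p, ev p N.α = alphaOf a p.1.1 p.1.2) (θ : ℝ) :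
    ev (E.pt H θ) N.α = 1 := by
  rw [hα, alphaOf, ← ip_eq_sum]
  change Real.sqrt (ip (a E.x) (E.dir θ) (E.dir θ)) = 1
  rw [E.ip_dir_dir H, Real.sqrt_one]

lemma ev_αi_pt (hα : ∀ p, ev p N.α = alphaOf a p.1.1 p.1.2) (θ : ℝ) :
    ev (E.pt H θ) N.αi = 1 := by
  rw [N.map_αi_eq, E.ev_α_pt N hα, inv_one]

lemma ev_mi_pt (hα : ∀ p, ev p N.α = alphaOf a p.1.1 p.1.2) (θ : ℝ) :
    (1 - E.B * Real.cos θ) * ev (E.pt H θ) N.mi = 1 := by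
  have h := congrArg (ev (E.pt H θ)) N.m_mi
  rwa [map_mul, map_sub, E.ev_α_pt N hα, E.ev_β_pt, map_one] at h

section

variable (hα : ∀ p, ev p N.α = alphaOf a p.1.1 p.1.2) {C₀ S₀ : ℂ} (h : C₀ ^ 2 + S₀ ^ 2 = 1)
include hα h

lemma exists_val_gens : ∀ f ∈ gens N,
    ∃ v, HasRatVal (C₀ + S₀ * Complex.I) (fun θ => ev (E.pt H θ) f) v := by
  rintro f ((⟨F, hF⟩ | ⟨j, rfl⟩) | (rfl | rfl))
  · refine ⟨(F E.x : ℂ), ?_⟩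
    rw [show (fun θ => ev (E.pt H θ) f) = fun _ => F E.x from funext fun θ => hF (E.pt H θ)]
    exact HasRatVal.const (C₀ + S₀ * Complex.I) _
  · simp only [E.ev_y_pt]
    exact ⟨_, ((HasRatVal.cos h).mul (HasRatVal.const (C₀ + S₀ * Complex.I) (E.e j))).add
      ((HasRatVal.sin h).mul (HasRatVal.const _ (E.u j)))⟩
  · exact ⟨_, by simpa only [E.ev_α_pt N hα] using HasRatVal.const (C₀ + S₀ * Complex.I) 1⟩
  · exact ⟨_, by simpa only [E.ev_αi_pt N hα] using HasRatVal.const (C₀ + S₀ * Complex.I) 1⟩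

omit hα h in
lemma exists_val_adjoin {w : ℂ} {S : Set (SmoothAlg H.slit)}
    (hS : ∀ f ∈ S, ∃ v, HasRatVal w (fun θ => ev (E.pt H θ) f) v) {f : SmoothAlg H.slit}
    (hf : f ∈ Algebra.adjoin ℝ S) : ∃ v, HasRatVal w (fun θ => ev (E.pt H θ) f) v := by
  induction hf using Algebra.adjoin_induction with
  | mem f hf => exact hS f hf
  | algebraMap r =>
    refine ⟨(r : ℂ), ?_⟩
    simp only [AlgHom.commutes]
    exact HasRatVal.const w r
  | add f g hf hg h1 h2 =>
    obtain ⟨v, hv⟩ := h1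
    obtain ⟨w, hw⟩ := h2
    exact ⟨_, by simpa only [map_add] using hv.add hw⟩
  | mul f g hf hg h1 h2 =>
    obtain ⟨v, hv⟩ := h1
    obtain ⟨w, hw⟩ := h2
    exact ⟨_, by simpa only [map_mul] using hv.mul hw⟩

lemma exists_val_regular {f : SmoothAlg H.slit} (hf : f ∈ regular N) :
    ∃ v, HasRatVal (C₀ + S₀ * Complex.I) (fun θ => ev (E.pt H θ) f) v :=
  E.exists_val_adjoin (E.exists_val_gens N hα h) hf

lemma exists_val_regularAway (h0 : 1 - E.B * C₀ ≠ 0) {f : SmoothAlg H.slit}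
    (hf : f ∈ regularAway N) :
    ∃ v, HasRatVal (C₀ + S₀ * Complex.I) (fun θ => ev (E.pt H θ) f) v := by
  refine E.exists_val_adjoin ?_ hf
  rintro f (rfl | hf)
  · refine ⟨_, HasRatVal.inv (v := 1 - E.B * C₀) ?_ (E.ev_mi_pt N hα) h0⟩
    simpa using (HasRatVal.const _ 1).sub ((HasRatVal.cos h).const_mul E.B)
  · exact E.exists_val_gens N hα h f hf

end

/-- The contraction of a matrix with the metric in both slots. -/
def contr (E : SliceFrame U a b) (v : Vec n) (R : Fin n → Fin n → ℝ) : ℝ :=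
  ∑ i, ∑ k, (a E.x).mulVec v i * v k * R i k

lemma contr_add (v : Vec n) (R R' : Fin n → Fin n → ℝ) :
    E.contr v (fun i k => R i k + R' i k) = E.contr v R + E.contr v R' := by
  simp only [contr, mul_add, Finset.sum_add_distrib]

lemma contr_smul (v : Vec n) (r : ℝ) (R : Fin n → Fin n → ℝ) :
    E.contr v (fun i k => r * R i k) = r * E.contr v R := by
  simp only [contr, Finset.mul_sum]
  exact Finset.sum_congr rfl fun i _ => Finset.sum_congr rfl fun k _ => by ring

lemma contr_mul (v f g : Vec n) :
    E.contr v (fun i k => f i * g k) = ((a E.x).mulVec v ⬝ᵥ f) * (v ⬝ᵥ g) := by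
  rw [dotProduct, dotProduct, Finset.sum_mul_sum]
  exact Finset.sum_congr rfl fun i _ => Finset.sum_congr rfl fun k _ => by ring

lemma contr_eq {R : Fin n → Fin n → SmoothAlg H.slit} {θ : ℝ}
    (hR : ∃ (r : ℝ) (s : Vec n), ∀ i k, ev (E.pt H θ) (R i k)
      = r * (if i = k then 1 else 0) + s k * E.dir θ i) :
    E.contr (E.perp θ) (fun i k => ev (E.pt H θ) (R i k))
      = E.contr E.z (fun i k => ev (E.pt H θ) (R i k)) :=
  sum_curv_eq hR ((E.ip_perp_perp H θ).trans E.z_z.symm) (E.ip_perp_dir H θ) (E.ip_z_dir H θ)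

lemma exists_val_contr {w : ℂ} {g : Fin n → Fin n → SmoothAlg H.slit}
    (hg : ∀ i k, ∃ v, HasRatVal w (fun θ => ev (E.pt H θ) (g i k)) v) {v : ℝ → Vec n}
    (hv : ∀ k, ∃ r, HasRatVal w (fun θ => v θ k) r) :
    ∃ r, HasRatVal w (fun θ => E.contr (v θ) fun i k => ev (E.pt H θ) (g i k)) r := by
  choose G hG using hg
  choose V hV using hv
  exact ⟨_, HasRatVal.sum Finset.univ fun i _ => HasRatVal.sum Finset.univ fun k _ =>
    ((HasRatVal.sum Finset.univ fun j _ => (hV j).const_mul (a E.x i j)).mul (hV k)).mul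
      (hG i k)⟩

lemma exists_val_perp {C₀ S₀ : ℂ} (h : C₀ ^ 2 + S₀ ^ 2 = 1) (k : Fin n) :
    ∃ r, HasRatVal (C₀ + S₀ * Complex.I) (fun θ => E.perp θ k) r :=
  ⟨_, ((HasRatVal.sin h).neg.mul (HasRatVal.const _ _)).add
      ((HasRatVal.cos h).mul (HasRatVal.const _ _))⟩

/-- A contracted curvature identity modulo `D` restricts to the zeros of `D` on the circle. -/
lemma eq_zero_of_pole {R g M : Fin n → Fin n → SmoothAlg H.slit} {D : SmoothAlg H.slit} {j : ℕ}
    (hR : ∀ p, ∃ (r : ℝ) (s : Vec n), ∀ i k, ev p (R i k)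
      = r * (if i = k then 1 else 0) + s k * p.1.2 i)
    (hD : ∀ i k, D ^ j * R i k = M i k + D * g i k) {C₀ S₀ : ℂ} (h : C₀ ^ 2 + S₀ ^ 2 = 1)
    (hg : ∀ i k, ∃ v, HasRatVal (C₀ + S₀ * Complex.I) (fun θ => ev (E.pt H θ) (g i k)) v)
    (hD0 : HasRatVal (C₀ + S₀ * Complex.I) (fun θ => ev (E.pt H θ) D) 0) {v : ℂ}
    (hM : HasRatVal (C₀ + S₀ * Complex.I)
      (fun θ => E.contr (E.perp θ) (fun i k => ev (E.pt H θ) (M i k))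
        - E.contr E.z (fun i k => ev (E.pt H θ) (M i k))) v) : v = 0 := by
  obtain ⟨r, hr⟩ := E.exists_val_contr hg (E.exists_val_perp h)
  obtain ⟨s, hs⟩ := E.exists_val_contr hg (v := fun _ => E.z) fun k => ⟨_, HasRatVal.const _ _⟩
  have h1 := hM.add (hD0.mul (hr.sub hs))
  rw [zero_mul, add_zero] at h1
  refine HasRatVal.eq_zero (w := C₀ + S₀ * Complex.I) ?_
  convert h1 using 2 with θ
  have key : ∀ v, ev (E.pt H θ) D ^ j * E.contr v (fun i k => ev (E.pt H θ) (R i k))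
      = E.contr v (fun i k => ev (E.pt H θ) (M i k))
        + ev (E.pt H θ) D * E.contr v (fun i k => ev (E.pt H θ) (g i k)) := by
    intro v
    rw [← contr_smul, ← contr_smul, ← contr_add]
    congr 1
    funext i k
    rw [← map_pow, ← map_mul, hD, map_add, map_mul]
  have h2 := key (E.perp θ)
  rw [E.contr_eq (hR (E.pt H θ)), key] at h2
  linear_combination h2

end SliceFrame

end

section

open TopologicalSpace

variable {n : ℕ}

/-- The covariant derivative of the one-form as a matrix. -/
def covMat (a : Vec n → Matrix (Fin n) (Fin n) ℝ) (b : Vec n → Vec n) (x : Vec n) :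
    Matrix (Fin n) (Fin n) ℝ := Matrix.of fun i j => covDeriv a b i j x

/-- The exterior part of the covariant derivative. -/
def curlMat (a : Vec n → Matrix (Fin n) (Fin n) ℝ) (b : Vec n → Vec n) (x : Vec n) :
    Matrix (Fin n) (Fin n) ℝ := (1 / 2 : ℝ) • (covMat a b x - (covMat a b x).transpose)

variable {U : Set (Vec n)} {a : Vec n → Matrix (Fin n) (Fin n) ℝ} {b : Vec n → Vec n}

lemma ip_curlMat (x v w : Vec n) :
    ip (curlMat a b x) v w = (ip (covMat a b x) v w - ip (covMat a b x) w v) / 2 := by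
  have h : ip (covMat a b x) w v = ip (covMat a b x).transpose v w := by
    rw [ip, ip, Matrix.mulVec_transpose, dotProduct_comm v, ← Matrix.dotProduct_mulVec]
  rw [h, ip, ip, ip, curlMat, Matrix.smul_mulVec, Matrix.sub_mulVec, dotProduct_smul,
    dotProduct_sub, smul_eq_mul]
  ring

namespace SmoothAlg

variable (H : SquareData U a b) (p : H.slit)

lemma ev_r00 : ev p (slitAB H).r00 = ip (covMat a b p.1.1) p.1.2 p.1.2 := by
  simp only [AlphaBeta.r00, ip_eq_sum, map_sum, map_mul, covMat, Matrix.of_apply, ev_y]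
  refine Finset.sum_congr rfl fun i _ => Finset.sum_congr rfl fun j _ => ?_
  rw [slitAB, rep_cov H H.slit_fst i j p]

lemma ev_s0 (i : Fin n) : ev p ((slitAB H).s0 i) = (curlMat a b p.1.1).mulVec p.1.2 i := by
  simp only [AlphaBeta.s0, map_sum, map_mul, map_sub, ev_halfOf, Matrix.mulVec, dotProduct,
    curlMat, covMat, Matrix.smul_apply, Matrix.sub_apply, Matrix.transpose_apply, Matrix.of_apply,
    ev_y, Finset.mul_sum, smul_eq_mul]
  refine Finset.sum_congr rfl fun j _ => ?_
  rw [slitAB, rep_cov H H.slit_fst i j p, rep_cov H H.slit_fst j i p]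
  ring

lemma ev_low_y (k : Fin n) :
    ev p ((slitAB H).low (calculus H.slit).y k) = (a p.1.1).mulVec p.1.2 k :=
  rep_low_y H H.slit_fst k p

lemma ev_b (k : Fin n) : ev p ((slitAB H).b k) = b p.1.1 k := rep_b H H.slit_fst k p

lemma ev_upb (i : Fin n) :
    ev p ((slitAB H).up (slitAB H).b i) = (a p.1.1)⁻¹.mulVec (b p.1.1) i :=
  rep_upb H H.slit_fst i p

lemma ev_σ : ev p (slitAB H).σ
    = ip (curlMat a b p.1.1) ((a p.1.1)⁻¹.mulVec (b p.1.1)) p.1.2 := by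
  simp only [AlphaBeta.σ, AlphaBeta.dot, map_sum, map_mul, ev_upb, ev_s0]
  rfl

end SmoothAlg

namespace AlphaBeta

variable {A : Type*} [CommRing A] [Algebra ℝ A] {c : FibreCalculus n A} (M : AlphaBeta c)

lemma map_D (d : Derivation ℝ A A) :
    d M.D = 2 * d M.bsq * M.q + M.c0 * d M.q - 6 * M.β * d M.β := by
  have h3 : d 3 = 0 := by simpa using d.map_natCast 3
  simp only [D, c0, map_sub, map_add, Derivation.leibniz, smul_eq_mul,
    Derivation.map_one_eq_zero, Derivation.map_two, Derivation.leibniz_pow, h3]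
  simp
  ring

lemma along_D_upb : c.along (M.up M.b) M.D = 2 * (1 - M.bsq) * M.β := by
  rw [map_D, along_bsq, along_q, along_β, low_y_up_b, dot_upb_b, c0]
  ring

lemma Y_D (k : Fin n) : c.Y k M.D = 2 * M.c0 * M.low c.y k - 6 * M.β * M.b k := by
  rw [map_D, Y_bsq, Y_q, Y_β]
  ring

end AlphaBeta

namespace SliceFrame

open SmoothAlg

variable (H : SquareData U a b) (E : SliceFrame U a b)

lemma ev_σ_pt (θ : ℝ) : ev (E.pt H θ) (slitAB H).σ
    = E.B * ip (curlMat a b E.x) E.e (E.dir θ) := by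
  rw [ev_σ]
  change ip (curlMat a b E.x) ((a E.x)⁻¹.mulVec (b E.x)) (E.dir θ) = _
  rw [E.sharp_eq, ip_smul_left]

include H in
lemma mulVec_dot_sharp (v : Vec n) :
    (a E.x).mulVec v ⬝ᵥ (a E.x)⁻¹.mulVec (b E.x) = b E.x ⬝ᵥ v := by
  rw [dotProduct_comm, ← ip, ip_sharp (H.posDef _ E.mem)]

variable {H} (N : (slitAB H).Root)

/-- The coefficient of the pole of the spray along the zeros of `D`. -/
def poleCoeff : SmoothAlg H.slit :=
  (slitAB H).q * ((slitAB H).r00 - 4 * (slitAB H).q * (slitAB H).σ * N.mi)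

lemma contr_pole_D (v : Vec n) (θ : ℝ) :
    E.contr v (fun i k => ev (E.pt H θ) (3 * (calculus H.slit).along
      (fun j => poleCoeff N * (slitAB H).up (slitAB H).b j) (slitAB H).D
        * (calculus H.slit).Y k (slitAB H).D * (poleCoeff N * (slitAB H).up (slitAB H).b i)))
      = 6 * (1 - E.B ^ 2) * E.B * Real.cos θ * ev (E.pt H θ) (poleCoeff N) ^ 2
        * (b E.x ⬝ᵥ v) * (2 * (1 + 2 * E.B ^ 2) * ip (a E.x) v (E.dir θ)
          - 6 * E.B * Real.cos θ * (b E.x ⬝ᵥ v)) := by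
  have h1 : (calculus H.slit).along (fun j => poleCoeff N * (slitAB H).up (slitAB H).b j)
      (slitAB H).D = poleCoeff N * (2 * (1 - (slitAB H).bsq) * (slitAB H).β) := by
    rw [← AlphaBeta.along_D_upb, FibreCalculus.along_apply, FibreCalculus.along_apply,
      Finset.mul_sum]
    exact Finset.sum_congr rfl fun i _ => by ring
  have h2 : ∀ i k, ev (E.pt H θ) (3 * (calculus H.slit).along
      (fun j => poleCoeff N * (slitAB H).up (slitAB H).b j) (slitAB H).D
        * (calculus H.slit).Y k (slitAB H).D * (poleCoeff N * (slitAB H).up (slitAB H).b i))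
      = (6 * (1 - E.B ^ 2) * E.B * Real.cos θ * ev (E.pt H θ) (poleCoeff N) ^ 2)
        * ((a E.x)⁻¹.mulVec (b E.x) i * ((2 * (1 + 2 * E.B ^ 2)) * (a E.x).mulVec (E.dir θ) k
          - (6 * E.B * Real.cos θ) * b E.x k)) := by
    intro i k
    rw [h1, AlphaBeta.Y_D, AlphaBeta.c0]
    simp only [map_mul, map_sub, map_add, map_ofNat, map_one, ev_bsq_pt, ev_β_pt, ev_low_y, ev_b,
      ev_upb]
    simp only [pt]
    ring
  simp only [h2]
  rw [contr_smul, contr_mul, E.mulVec_dot_sharp H]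
  have h3 : (v ⬝ᵥ fun k => 2 * (1 + 2 * E.B ^ 2) * (a E.x).mulVec (E.dir θ) k
      - 6 * E.B * Real.cos θ * b E.x k) = 2 * (1 + 2 * E.B ^ 2) * ip (a E.x) v (E.dir θ)
          - 6 * E.B * Real.cos θ * (b E.x ⬝ᵥ v) := by
    simp only [ip, dotProduct, Finset.mul_sum,
      ← Finset.sum_sub_distrib]
    exact Finset.sum_congr rfl fun k _ => by ring
  rw [h3]
  ring

lemma ev_poleCoeff (hα : ∀ p, ev p N.α = alphaOf a p.1.1 p.1.2) (θ : ℝ) :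
    (1 - E.B * Real.cos θ) * ev (E.pt H θ) (poleCoeff N)
      = (1 - E.B * Real.cos θ) * (ip (covMat a b E.x) E.e E.e * Real.cos θ ^ 2
        + (ip (covMat a b E.x) E.e E.u + ip (covMat a b E.x) E.u E.e) * Real.cos θ * Real.sin θ
        + ip (covMat a b E.x) E.u E.u * Real.sin θ ^ 2)
        - 2 * E.B * (ip (covMat a b E.x) E.e E.u - ip (covMat a b E.x) E.u E.e) * Real.sin θ := by
  have h1 : ev (E.pt H θ) (slitAB H).r00 = ip (covMat a b E.x) (E.dir θ) (E.dir θ) := ev_r00 H _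
  simp only [poleCoeff, map_mul, map_sub, map_ofNat, ev_q_pt, ev_σ_pt, h1, ip_curlMat]
  simp only [dir, ip_add_left, ip_add_right, ip_smul_left, ip_smul_right]
  linear_combination (-2 * E.B * (ip (covMat a b E.x) E.e E.u - ip (covMat a b E.x) E.u E.e)
    * Real.sin θ) * E.ev_mi_pt N hα θ

lemma poleCoeff_mem : poleCoeff N ∈ regularAway N := by
  have h := regular_le N
  refine mul_mem (h (q_mem_regular N)) (sub_mem (h (r00_mem_regular N)) (mul_mem (mul_mem (mul_mem
    (ofNat_mem _ 4) (h (q_mem_regular N))) (h (σ_mem_regular N))) (mi_mem_regularAway N)))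

/-- The pole of the curvature along the complex zeros of `D` constrains the covariant
derivative. -/
lemma cov_eq_zero_of_D_eq_zero (hα : ∀ p, ev p N.α = alphaOf a p.1.1 p.1.2)
    (hR : ∀ p, ∃ (r : ℝ) (s : Vec n), ∀ i k,
      ev p ((calculus H.slit).curv (fun i => (slitAB H).G i + N.T i) i k)
        = r * (if i = k then 1 else 0) + s k * p.1.2 i)
    {C₀ S₀ : ℂ} (h : C₀ ^ 2 + S₀ ^ 2 = 1) (hC : 1 + 2 * (E.B : ℂ) ^ 2 - 3 * E.B ^ 2 * C₀ ^ 2 = 0)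
    (hB : 1 - E.B * C₀ ≠ 0) :
    (1 - E.B * C₀) * (ip (covMat a b E.x) E.e E.e * C₀ ^ 2
        + (ip (covMat a b E.x) E.e E.u + ip (covMat a b E.x) E.u E.e) * C₀ * S₀
        + ip (covMat a b E.x) E.u E.u * S₀ ^ 2)
        - 2 * E.B * (ip (covMat a b E.x) E.e E.u - ip (covMat a b E.x) E.u E.e) * S₀ = 0 := by
  have hcos := HasRatVal.cos h
  have hsin := HasRatVal.sin h
  obtain ⟨w, hw⟩ := E.exists_val_regularAway N hα h hB (poleCoeff_mem N)
  have hPB : (fun i => (slitAB H).G i + N.T i) = fun i => ((slitAB H).G i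
      + 2 * (slitAB H).q * N.mi * (slitAB H).V i)
      + poleCoeff N * (slitAB H).up (slitAB H).b i * N.Di := by
    funext i
    rw [AlphaBeta.Root.T, poleCoeff]
    ring
  have hle := regular_le N
  choose g hg hgR using fun i k => FibreCalculus.curv_pole_four (isStable_regularAway N)
    (P := fun i => (slitAB H).G i + 2 * (slitAB H).q * N.mi * (slitAB H).V i)
    (B := fun i => poleCoeff N * (slitAB H).up (slitAB H).b i)
    (fun i => add_mem (hle (G_mem_regular N i)) (mul_mem (mul_mem (mul_mem (ofNat_mem _ 2)
      (hle (q_mem_regular N))) (mi_mem_regularAway N)) (hle (V_mem_regular N i))))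
    (fun i => mul_mem (poleCoeff_mem N) (hle (upb_mem_regular N i)))
    (hle (D_mem_regular N)) N.D_Di i k
  rw [hPB] at hR
  have hD0 : HasRatVal (C₀ + S₀ * Complex.I) (fun θ => ev (E.pt H θ) (slitAB H).D) 0 := by
    simp only [ev_D_pt]
    rw [← hC]
    have := (HasRatVal.const (C₀ + S₀ * Complex.I) (1 + 2 * E.B ^ 2)).sub
      ((hcos.pow 2).const_mul (3 * E.B ^ 2))
    push_cast at this
    exact this
  have hM : HasRatVal (C₀ + S₀ * Complex.I) (fun θ =>
      E.contr (E.perp θ) (fun i k => ev (E.pt H θ) (3 * (calculus H.slit).along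
      (fun j => poleCoeff N * (slitAB H).up (slitAB H).b j) (slitAB H).D
        * (calculus H.slit).Y k (slitAB H).D * (poleCoeff N * (slitAB H).up (slitAB H).b i)))
      - E.contr E.z (fun i k => ev (E.pt H θ) (3 * (calculus H.slit).along
      (fun j => poleCoeff N * (slitAB H).up (slitAB H).b j) (slitAB H).D
        * (calculus H.slit).Y k (slitAB H).D * (poleCoeff N * (slitAB H).up (slitAB H).b i))))
      ((-36 * (1 - E.B ^ 2) * E.B ^ 4 : ℝ) * (C₀ ^ 2 * S₀ ^ 2 * w ^ 2)) := by
    have := ((((hcos.pow 2).mul (hsin.pow 2)).mul (hw.pow 2)).const_mul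
      (-36 * (1 - E.B ^ 2) * E.B ^ 4))
    convert this using 2 with θ
    rw [contr_pole_D, contr_pole_D, E.ip_perp_dir H, E.b_dot_perp, E.b_dot_z]
    ring
  have h0 := E.eq_zero_of_pole hR hgR h
    (fun i k => E.exists_val_regularAway N hα h hB (hg i k)) hD0 hM
  have hBpos := E.B_pos
  have hB1 : 0 < 1 - E.B ^ 2 := by nlinarith [E.B_lt_one]
  have hBc : (E.B : ℂ) ≠ 0 := by exact_mod_cast hBpos.ne'
  have hC0 : C₀ ≠ 0 := by
    rintro rfl
    have : (1 + 2 * E.B ^ 2 : ℝ) = 0 := by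
      apply Complex.ofReal_injective
      push_cast
      linear_combination hC
    have h2 : 0 < 1 + 2 * E.B ^ 2 := by positivity
    exact h2.ne' this
  have hS0 : S₀ ≠ 0 := by
    rintro rfl
    have : (1 - E.B ^ 2 : ℝ) = 0 := by
      apply Complex.ofReal_injective
      push_cast
      linear_combination hC + 3 * (E.B : ℂ) ^ 2 * h
    exact hB1.ne' this
  have hw0 : w = 0 := by
    have hk : ((-36 * (1 - E.B ^ 2) * E.B ^ 4 : ℝ) : ℂ) ≠ 0 := by
      have : (-36 * (1 - E.B ^ 2) * E.B ^ 4 : ℝ) ≠ 0 := by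
        have := mul_pos hB1 (pow_pos hBpos 4)
        intro h
        linarith
      exact_mod_cast this
    have h1 := (mul_eq_zero.1 h0).resolve_left hk
    simpa [hC0, hS0] using h1
  subst hw0
  have h1 := ((HasRatVal.const (C₀ + S₀ * Complex.I) 1).sub (hcos.const_mul E.B)).mul hw
  have h2 := ((((HasRatVal.const (C₀ + S₀ * Complex.I) 1).sub (hcos.const_mul E.B)).mul
    ((((hcos.pow 2).const_mul (ip (covMat a b E.x) E.e E.e)).add
      (((hcos.const_mul (ip (covMat a b E.x) E.e E.u + ip (covMat a b E.x) E.u E.e))).mul hsin)).add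
      ((hsin.pow 2).const_mul (ip (covMat a b E.x) E.u E.u)))).sub
    (hsin.const_mul (2 * E.B * (ip (covMat a b E.x) E.e E.u - ip (covMat a b E.x) E.u E.e))))
  have h3 := h1.unique (by simpa only [E.ev_poleCoeff N hα] using h2)
  rw [mul_zero] at h3
  push_cast at h3
  exact h3.symm

end SliceFrame

end

section

open TopologicalSpace

variable {n : ℕ} {U : Set (Vec n)} {a : Vec n → Matrix (Fin n) (Fin n) ℝ} {b : Vec n → Vec n}

/-- The conformal factor of the covariant derivative. -/
def tauOf (a : Vec n → Matrix (Fin n) (Fin n) ℝ) (b : Vec n → Vec n) (x : Vec n) : ℝ :=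
  ip (covMat a b x) ((a x)⁻¹.mulVec (b x)) ((a x)⁻¹.mulVec (b x))
    / (bsq a b x * (1 - bsq a b x))

namespace SliceFrame

open SmoothAlg

variable (H : SquareData U a b) (E : SliceFrame U a b)

include H in
lemma exists_of_orthogonal (hn : 3 ≤ n) {x u : Vec n} (hx : x ∈ U) (hu : ip (a x) u u = 1)
    (hbu : b x ⬝ᵥ u = 0) : ∃ E : SliceFrame U a b, E.x = x ∧ E.u = u := by
  have hg := H.posDef x hx
  have h0 := H.bsq_pos x hx
  have hs := Real.sqrt_pos.2 h0
  have hsq := Real.sq_sqrt h0.le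
  have hdot : ∀ v, ip (a x) ((Real.sqrt (bsq a b x))⁻¹ • (a x)⁻¹.mulVec (b x)) v
      = (Real.sqrt (bsq a b x))⁻¹ * (b x ⬝ᵥ v) := fun v => by
    rw [ip_smul_left, ip_sharp hg]
  obtain ⟨z, hz, hez, huz⟩ := exists_unit_orthogonal hg hn
    ((Real.sqrt (bsq a b x))⁻¹ • (a x)⁻¹.mulVec (b x)) u
  refine ⟨⟨x, Real.sqrt (bsq a b x), (Real.sqrt (bsq a b x))⁻¹ • (a x)⁻¹.mulVec (b x), u, z, hx,
    hs, ?_, hsq.symm, fun v => ?_, ?_, ?_, hu, hz, ?_, hez, huz⟩, rfl, rfl⟩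
  · rw [Real.sqrt_lt' one_pos, one_pow]
    exact H.bsq_lt_one x hx
  · rw [hdot, mul_inv_cancel_left₀ hs.ne']
  · rw [smul_smul, mul_inv_cancel₀ hs.ne', one_smul]
  · rw [hdot, dotProduct_smul, ← SquareData.bsq_eq, smul_eq_mul]
    nth_rewrite 3 [← hsq]
    field_simp
  · rw [hdot, hbu, mul_zero]

include H in
lemma exists_eq_smul_add_smul (hn : 3 ≤ n) {x : Vec n} (hx : x ∈ U) (v : Vec n) :
    ∃ (E : SliceFrame U a b) (r t : ℝ), E.x = x ∧ v = r • E.e + t • E.u := by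
  have hg := H.posDef x hx
  obtain ⟨u₀, hu₀, hbu₀, -⟩ := exists_unit_orthogonal hg hn ((a x)⁻¹.mulVec (b x)) 0
  rw [ip_sharp hg] at hbu₀
  obtain ⟨E₀, rfl, -⟩ := exists_of_orthogonal H hn hx hu₀ hbu₀
  set w := v - ip (a E₀.x) E₀.e v • E₀.e with hw
  have hew : ip (a E₀.x) E₀.e w = 0 := by
    rw [hw, ip_sub_right, ip_smul_right, E₀.e_e]; ring
  by_cases hw0 : w = 0
  · exact ⟨E₀, ip (a E₀.x) E₀.e v, 0, rfl, by rw [zero_smul, add_zero, ← sub_eq_zero, ← hw, hw0]⟩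
  · have hp := ip_pos hg hw0
    have hs := Real.sqrt_pos.2 hp
    have hsq := Real.sq_sqrt hp.le
    obtain ⟨E, hE, hEu⟩ := exists_of_orthogonal H hn hx
      (u := (Real.sqrt (ip (a E₀.x) w w))⁻¹ • w) (by
        rw [ip_smul_left, ip_smul_right]
        nth_rewrite 3 [← hsq]
        field_simp) (by rw [E₀.b_dot, ip_smul_right, hew, mul_zero, mul_zero])
    refine ⟨E, ip (a E₀.x) E₀.e v, Real.sqrt (ip (a E₀.x) w w), hE, ?_⟩
    have hEe : E.e = E₀.e := by
      have h1 := E.sharp_eq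
      have h2 := E.bsq_eq
      rw [hE] at h1 h2
      have h3 : E.B = E₀.B := by
        rw [E₀.bsq_eq] at h2
        exact ((sq_eq_sq₀ E₀.B_pos.le E.B_pos.le).1 h2).symm
      rw [E₀.sharp_eq, h3] at h1
      exact (smul_right_injective _ E₀.B_pos.ne' h1).symm
    rw [hEu, hEe, smul_smul, mul_inv_cancel₀ hs.ne', one_smul, hw, add_sub_cancel]

variable {H} (N : (slitAB H).Root)

variable (hα : ∀ p, ev p N.α = alphaOf a p.1.1 p.1.2)
  (hR : ∀ p, ∃ (r : ℝ) (s : Vec n), ∀ i k,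
    ev p ((calculus H.slit).curv (fun i => (slitAB H).G i + N.T i) i k)
      = r * (if i = k then 1 else 0) + s k * p.1.2 i)
include hα hR

lemma cov_relations : ip (covMat a b E.x) E.e E.u = 0 ∧ ip (covMat a b E.x) E.u E.e = 0 ∧
    (1 + 2 * E.B ^ 2) * ip (covMat a b E.x) E.e E.e
      = (1 - E.B ^ 2) * ip (covMat a b E.x) E.u E.u := by
  have hBpos := E.B_pos
  have hB1 : 0 < 1 - E.B ^ 2 := by nlinarith [E.B_lt_one]
  obtain ⟨c, hc0, hc⟩ : ∃ c : ℝ, 0 < c ∧ 3 * E.B ^ 2 * c ^ 2 = 1 + 2 * E.B ^ 2 := by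
    have h : 0 < (1 + 2 * E.B ^ 2) / (3 * E.B ^ 2) := by positivity
    refine ⟨Real.sqrt ((1 + 2 * E.B ^ 2) / (3 * E.B ^ 2)), Real.sqrt_pos.2 h, ?_⟩
    rw [Real.sq_sqrt h.le]
    field_simp
  obtain ⟨d, hd0, hd⟩ : ∃ d : ℝ, 0 < d ∧ 3 * E.B ^ 2 * d ^ 2 = 1 - E.B ^ 2 := by
    have h : 0 < (1 - E.B ^ 2) / (3 * E.B ^ 2) := by positivity
    refine ⟨Real.sqrt ((1 - E.B ^ 2) / (3 * E.B ^ 2)), Real.sqrt_pos.2 h, ?_⟩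
    rw [Real.sq_sqrt h.le]
    field_simp
  have hcd : c ^ 2 - d ^ 2 = 1 := by
    have : 3 * E.B ^ 2 * (c ^ 2 - d ^ 2 - 1) = 0 := by linear_combination hc - hd
    have := (mul_eq_zero.1 this).resolve_left (by positivity)
    linarith
  have hBc : (E.B * c) ^ 2 < 1 := by nlinarith
  have key : ∀ c : ℝ, 3 * E.B ^ 2 * c ^ 2 = 1 + 2 * E.B ^ 2 → c ^ 2 - d ^ 2 = 1 →
      (E.B * c) ^ 2 < 1 →
      ((1 - E.B * c) * (ip (covMat a b E.x) E.e E.e * c ^ 2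
        - ip (covMat a b E.x) E.u E.u * d ^ 2) = 0 ∧
      (1 - E.B * c) * (ip (covMat a b E.x) E.e E.u + ip (covMat a b E.x) E.u E.e) * c * d
        - 2 * E.B * (ip (covMat a b E.x) E.e E.u - ip (covMat a b E.x) E.u E.e) * d = 0) := by
    intro c hc hcd hBc
    have hcd' : (c : ℂ) ^ 2 - (d : ℂ) ^ 2 = 1 := by exact_mod_cast hcd
    have hc' : 3 * (E.B : ℂ) ^ 2 * (c : ℂ) ^ 2 = 1 + 2 * (E.B : ℂ) ^ 2 := by exact_mod_cast hc
    have h := E.cov_eq_zero_of_D_eq_zero N hα hR (C₀ := c) (S₀ := d * Complex.I)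
      (by linear_combination hcd' + (d : ℂ) ^ 2 * Complex.I_sq) (by linear_combination -hc') (by
        intro h0
        have h1 : (1 : ℝ) - E.B * c = 0 := by exact_mod_cast h0
        nlinarith)
    generalize ip (covMat a b E.x) E.e E.e = ree at h ⊢
    generalize ip (covMat a b E.x) E.u E.u = ruu at h ⊢
    generalize ip (covMat a b E.x) E.e E.u = reu at h ⊢
    generalize ip (covMat a b E.x) E.u E.e = rue at h ⊢
    have h2 : ((((1 - E.B * c) * (ree * c ^ 2 - ruu * d ^ 2) : ℝ) : ℂ)
        + (((1 - E.B * c) * (reu + rue) * c * d - 2 * E.B * (reu - rue) * d : ℝ) : ℂ)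
          * Complex.I) = 0 := by
      push_cast
      linear_combination h - (1 - E.B * c) * ruu * d ^ 2 * Complex.I_sq
    have h3 := congrArg Complex.re h2
    have h4 := congrArg Complex.im h2
    rw [Complex.add_re, Complex.re_ofReal_mul, Complex.I_re, mul_zero, add_zero] at h3
    rw [Complex.add_im, Complex.im_ofReal_mul, Complex.I_im, mul_one, Complex.ofReal_im,
      zero_add] at h4
    exact ⟨h3, h4⟩
  obtain ⟨h1, h2⟩ := key c hc hcd hBc
  obtain ⟨-, h4⟩ := key (-c) (by rw [neg_sq]; exact hc) (by rw [neg_sq]; exact hcd)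
    (by rw [mul_neg, neg_sq]; exact hBc)
  have h5 := (mul_eq_zero.1 h1).resolve_left (by nlinarith)
  have hs : ip (covMat a b E.x) E.e E.u + ip (covMat a b E.x) E.u E.e = 0 := by
    have : 2 * c * d * (ip (covMat a b E.x) E.e E.u + ip (covMat a b E.x) E.u E.e) = 0 := by
      linear_combination h2 - h4
    exact (mul_eq_zero.1 this).resolve_left (by positivity)
  have ht : ip (covMat a b E.x) E.e E.u - ip (covMat a b E.x) E.u E.e = 0 := by
    have : 2 * E.B * d * (ip (covMat a b E.x) E.e E.u - ip (covMat a b E.x) E.u E.e) = 0 := by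
      linear_combination (1 - E.B * c) * c * d * hs - h2
    exact (mul_eq_zero.1 this).resolve_left (by positivity)
  refine ⟨by linarith, by linarith, ?_⟩
  linear_combination 3 * E.B ^ 2 * h5 - ip (covMat a b E.x) E.e E.e * hc
    + ip (covMat a b E.x) E.u E.u * hd

lemma tauOf_eq : ip (covMat a b E.x) E.e E.e = tauOf a b E.x * (1 - E.B ^ 2) ∧
    ip (covMat a b E.x) E.u E.u = tauOf a b E.x * (1 + 2 * E.B ^ 2) := by
  have hBpos := E.B_pos
  have hB1 : 0 < 1 - E.B ^ 2 := by nlinarith [E.B_lt_one]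
  have h1 : ip (covMat a b E.x) E.e E.e = tauOf a b E.x * (1 - E.B ^ 2) := by
    rw [tauOf, E.sharp_eq, E.bsq_eq, ip_smul_left, ip_smul_right]
    field_simp
  refine ⟨h1, mul_left_cancel₀ hB1.ne' ?_⟩
  rw [← (E.cov_relations N hα hR).2.2, h1]
  ring

end SliceFrame

namespace SmoothAlg

variable {H : SquareData U a b} (N : (slitAB H).Root) (hn : 3 ≤ n)
  (hα : ∀ p, ev p N.α = alphaOf a p.1.1 p.1.2)
  (hR : ∀ p, ∃ (r : ℝ) (s : Vec n), ∀ i k,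
    ev p ((calculus H.slit).curv (fun i => (slitAB H).G i + N.T i) i k)
      = r * (if i = k then 1 else 0) + s k * p.1.2 i)
include hn hα hR

lemma cov_quadratic {x : Vec n} (hx : x ∈ U) (v : Vec n) : ip (covMat a b x) v v
    = tauOf a b x * ((1 + 2 * bsq a b x) * ip (a x) v v - 3 * (b x ⬝ᵥ v) ^ 2) := by
  obtain ⟨E, r, t, rfl, rfl⟩ := SliceFrame.exists_eq_smul_add_smul H hn hx v
  obtain ⟨h1, h2, -⟩ := E.cov_relations N hα hR
  obtain ⟨h3, h4⟩ := E.tauOf_eq N hα hR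
  simp only [E.b_dot, E.bsq_eq, ip_add_left, ip_add_right, ip_smul_left, ip_smul_right, h1, h2, h3,
    h4, E.e_e, E.e_u, E.u_e H, E.u_u]
  ring

lemma curl_sharp {x : Vec n} (hx : x ∈ U) (v : Vec n) :
    ip (curlMat a b x) ((a x)⁻¹.mulVec (b x)) v = 0 := by
  obtain ⟨E, r, t, rfl, rfl⟩ := SliceFrame.exists_eq_smul_add_smul H hn hx v
  obtain ⟨h1, h2, -⟩ := E.cov_relations N hα hR
  rw [E.sharp_eq, ip_curlMat]
  simp only [ip_add_left, ip_add_right, ip_smul_left, ip_smul_right, h1, h2]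
  ring

end SmoothAlg

end

section

open TopologicalSpace

variable {n : ℕ} {U : Set (Vec n)} {a : Vec n → Matrix (Fin n) (Fin n) ℝ} {b : Vec n → Vec n}

namespace SmoothAlg

lemma exists_rep_tauOf {Ω : Opens (Vec n × Vec n)} (H : SquareData U a b)
    (hΩ : ∀ p ∈ Ω, p.1 ∈ U) : ∃ t : SmoothAlg Ω, Rep t fun x _ => tauOf a b x := by
  have hb := rep_bsq H hΩ
  obtain ⟨d, hd⟩ := exists_inv ((alphaBeta H hΩ).bsq * (1 - (alphaBeta H hΩ).bsq)) fun p => by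
    have h1 := H.bsq_pos _ (hΩ p p.2)
    have h2 := H.bsq_lt_one _ (hΩ p p.2)
    rw [map_mul, map_sub, map_one, hb p]
    exact (mul_pos h1 (sub_pos.2 h2)).ne'
  refine ⟨(∑ i, ∑ j, (alphaBeta H hΩ).cov i j * (alphaBeta H hΩ).up (alphaBeta H hΩ).b i
    * (alphaBeta H hΩ).up (alphaBeta H hΩ).b j) * d, fun p => ?_⟩
  have h := congrArg (ev p) hd
  rw [map_mul, map_mul, map_sub, map_one, hb p] at h
  change _ = tauOf a b p.1.1
  rw [map_mul, tauOf, div_eq_mul_inv, inv_eq_of_mul_eq_one_right h, ip_eq_sum]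
  simp only [map_sum, map_mul, rep_cov H hΩ _ _ p, rep_upb H hΩ _ p]
  rfl

end SmoothAlg

namespace AlphaBeta

variable {A : Type*} [CommRing A] [Algebra ℝ A] {c : FibreCalculus n A} {M : AlphaBeta c}
  (N : M.Root)

lemma Root.along_V_m (hσ : M.σ = 0) : c.along M.V (N.α - M.β) = 0 := by
  rw [map_sub, N.along_α, M.along_β, M.dot_V_low, M.dot_V_b, hσ]
  ring

lemma Root.Y_m (k : Fin n) : c.Y k (N.α - M.β) = N.αi * M.low c.y k - M.b k := by
  rw [map_sub, N.Y_α, M.Y_β]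

lemma along_smul (f : A) (v : Fin n → A) (g : A) :
    c.along (fun i => f * v i) g = f * c.along v g := by
  simp only [FibreCalculus.along_apply, Finset.mul_sum, mul_assoc]

lemma Root.along_V_Y_m (k : Fin n) :
    c.along M.V (c.Y k (N.α - M.β)) = N.αi * M.s0 k := by
  have h : c.along M.V N.αi = 0 := by
    rw [N.map_αi, N.along_α, M.dot_V_low]
    ring
  rw [Root.Y_m, map_sub, M.along_b, Derivation.leibniz, h, M.along_low_y, M.low_V, smul_eq_mul,
    smul_zero]
  ring

lemma along_V_two_q_V (i : Fin n) : c.along M.V (2 * M.q * M.V i)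
    = 2 * M.q * M.up (fun l => c.along M.V (M.s0 l)) i := by
  rw [Derivation.leibniz, Derivation.leibniz, Derivation.map_two, M.along_q, M.dot_V_low]
  simp only [smul_eq_mul, mul_zero, add_zero, V, M.along_up]

end AlphaBeta

namespace SmoothAlg

variable (H : SquareData U a b) (p : H.slit)

lemma mulVec_ev_up (v : Fin n → SmoothAlg H.slit) (w : Vec n) :
    (a p.1.1).mulVec w ⬝ᵥ (fun i => ev p ((slitAB H).up v i)) = w ⬝ᵥ fun i => ev p (v i) := by
  have h := AlphaBeta.map_low (slitAB H) (ev p) ((slitAB H).up v)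
  rw [AlphaBeta.low_up] at h
  have h2 : (slitAB H).metricAt (ev p) = a p.1.1 := by
    ext i j
    exact rep_a H H.slit_fst i j p
  rw [h2] at h
  have h3 : (fun i => ev p (v i)) = (a p.1.1).mulVec fun i => ev p ((slitAB H).up v i) := funext h
  rw [h3, ← ip, dotProduct_comm, ← ip, ip_comm (H.isSymm _ p.2.1)]

end SmoothAlg

namespace SliceFrame

open SmoothAlg

variable (H : SquareData U a b) (E : SliceFrame U a b)

lemma ip_curlMat_comm (x v w : Vec n) : ip (curlMat a b x) v w = - ip (curlMat a b x) w v := by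
  rw [ip_curlMat, ip_curlMat]
  ring

/-- The dual of the contraction of the exterior derivative with the second frame vector. -/
def curlVec : Vec n := (a E.x)⁻¹.mulVec ((curlMat a b E.x).mulVec E.u)

include H in
lemma ip_curl_u_curlVec :
    ip (curlMat a b E.x) E.u E.curlVec = - ip (a E.x) E.curlVec E.curlVec := by
  rw [ip_curlMat_comm, curlVec, ip_sharp (H.posDef _ E.mem), dotProduct_comm]
  rfl

variable {H}
variable (hcurl : ∀ v, ip (curlMat a b E.x) E.e v = 0)

include hcurl in
lemma curl_dir (θ : ℝ) : (curlMat a b E.x).mulVec (E.dir θ)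
    = Real.sin θ • (curlMat a b E.x).mulVec E.u := by
  have h : (curlMat a b E.x).mulVec E.e = 0 := by
    refine dotProduct_eq_zero _ fun w => ?_
    rw [dotProduct_comm, ← ip, ip_curlMat_comm, hcurl, neg_zero]
  rw [dir, Matrix.mulVec_add, Matrix.mulVec_smul, Matrix.mulVec_smul, h, smul_zero, zero_add]

include hcurl in
lemma ev_V_pt (θ : ℝ) : (fun i => ev (E.pt H θ) ((slitAB H).V i)) = Real.sin θ • E.curlVec := by
  have h : ∀ i, ev (E.pt H θ) ((slitAB H).V i)
      = (a E.x)⁻¹.mulVec ((curlMat a b E.x).mulVec (E.dir θ)) i := by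
    intro i
    simp only [AlphaBeta.V, AlphaBeta.up, map_sum, map_mul, ev_s0]
    refine Finset.sum_congr rfl fun j _ => ?_
    rw [slitAB, rep_ai H H.slit_fst i j (E.pt H θ)]
    rfl
  funext i
  rw [h, E.curl_dir hcurl, Matrix.mulVec_smul]
  rfl

lemma ev_along_V_s0 (θ : ℝ) (l : Fin n) :
    ev (E.pt H θ) ((calculus H.slit).along (slitAB H).V ((slitAB H).s0 l))
      = (curlMat a b E.x).mulVec (fun i => ev (E.pt H θ) ((slitAB H).V i)) l := by
  simp only [FibreCalculus.along_apply, AlphaBeta.Y_s0, map_sum, map_mul, map_sub, ev_halfOf,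
    Matrix.mulVec, dotProduct, curlMat, covMat, Matrix.smul_apply, Matrix.sub_apply,
    Matrix.transpose_apply, Matrix.of_apply, smul_eq_mul]
  refine Finset.sum_congr rfl fun j _ => ?_
  rw [slitAB, rep_cov H H.slit_fst l j (E.pt H θ), rep_cov H H.slit_fst j l (E.pt H θ)]
  change _ = 1 / 2 * (covDeriv a b l j E.x - covDeriv a b j l E.x) * _
  simp only [pt]
  ring

variable (N : (slitAB H).Root) (hα : ∀ p, ev p N.α = alphaOf a p.1.1 p.1.2)

/-- The leading coefficient of the curvature at the zeros of `α - β`. -/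
def poleM (Z : SmoothAlg H.slit) (i k : Fin n) : SmoothAlg H.slit :=
  - (calculus H.slit).along (fun i => 2 * (slitAB H).q * (slitAB H).V i)
      (2 * (slitAB H).q * (slitAB H).V i) * (calculus H.slit).Y k (N.α - (slitAB H).β)
    - 3 * (2 * (slitAB H).q * (slitAB H).V i)
      * (calculus H.slit).along (fun i => 2 * (slitAB H).q * (slitAB H).V i)
        ((calculus H.slit).Y k (N.α - (slitAB H).β))
    - 2 * (2 * (slitAB H).q * (slitAB H).V i) * (calculus H.slit).Y k (N.α - (slitAB H).β) * Z

include hα hcurl in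
lemma contr_poleM (Z : SmoothAlg H.slit) (v : Vec n) (θ : ℝ) :
    E.contr v (fun i k => ev (E.pt H θ) (poleM N Z i k))
      = -4 * Real.sin θ * ip (curlMat a b E.x) v E.curlVec
          * (ip (a E.x) v (E.dir θ) - b E.x ⬝ᵥ v)
        - 12 * (Real.sin θ * ip (curlMat a b E.x) v E.u) ^ 2
        - 4 * ev (E.pt H θ) Z * (Real.sin θ * ip (curlMat a b E.x) v E.u)
          * (ip (a E.x) v (E.dir θ) - b E.x ⬝ᵥ v) := by
  have h1 : ∀ i k, ev (E.pt H θ) (poleM N Z i k)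
      = -4 * (ev (E.pt H θ) ((slitAB H).up (fun l => (calculus H.slit).along (slitAB H).V
            ((slitAB H).s0 l)) i) * ((a E.x).mulVec (E.dir θ) k - b E.x k))
        + (-12 * (ev (E.pt H θ) ((slitAB H).V i) * (curlMat a b E.x).mulVec (E.dir θ) k)
        + (-4 * ev (E.pt H θ) Z) * (ev (E.pt H θ) ((slitAB H).V i)
          * ((a E.x).mulVec (E.dir θ) k - b E.x k))) := by
    intro i k
    rw [poleM, AlphaBeta.along_smul, AlphaBeta.along_smul, AlphaBeta.along_V_two_q_V,
      AlphaBeta.Root.along_V_Y_m, AlphaBeta.Root.Y_m]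
    simp only [map_mul, map_sub, map_neg, map_ofNat, ev_q_pt, ev_low_y, ev_b, ev_s0,
      E.ev_αi_pt N hα]
    simp only [pt]
    ring
  have h2 : (v ⬝ᵥ fun k => (a E.x).mulVec (E.dir θ) k - b E.x k)
      = ip (a E.x) v (E.dir θ) - b E.x ⬝ᵥ v := by
    rw [ip, dotProduct_comm (b E.x), ← dotProduct_sub]
    rfl
  have h3 : (a E.x).mulVec v ⬝ᵥ (fun i => ev (E.pt H θ) ((slitAB H).up
      (fun l => (calculus H.slit).along (slitAB H).V ((slitAB H).s0 l)) i))
      = Real.sin θ * ip (curlMat a b E.x) v E.curlVec := by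
    refine (mulVec_ev_up H (E.pt H θ) _ v).trans ?_
    simp only [ev_along_V_s0, E.ev_V_pt hcurl]
    rw [← ip_smul_right]
    rfl
  have h4 : (v ⬝ᵥ fun k => (curlMat a b E.x).mulVec (E.dir θ) k)
      = Real.sin θ * ip (curlMat a b E.x) v E.u := by
    rw [E.curl_dir hcurl, ip, ← smul_eq_mul, ← dotProduct_smul]
  have h5 : (a E.x).mulVec v ⬝ᵥ (fun i => ev (E.pt H θ) ((slitAB H).V i))
      = Real.sin θ * ip (curlMat a b E.x) v E.u := by
    refine (mulVec_ev_up H (E.pt H θ) _ v).trans ?_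
    rw [← h4]
    simp only [ev_s0]
    rfl
  simp only [h1]
  rw [contr_add, contr_add, contr_smul, contr_smul, contr_smul, contr_mul, contr_mul, contr_mul,
    h2, h3, h4, h5]
  ring

include hα hcurl in
/-- The pole of the curvature along the complex zeros of `α - β` forces the one-form to be
closed. -/
lemma curlVec_eq_zero {τ : SmoothAlg H.slit} (hτ : τ ∈ regular N) (hσ : (slitAB H).σ = 0)
    (hr : (slitAB H).r00 = τ * (slitAB H).D)
    (hR : ∀ p, ∃ (r : ℝ) (s : Vec n), ∀ i k,
      ev p ((calculus H.slit).curv (fun i => (slitAB H).G i + N.T i) i k)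
        = r * (if i = k then 1 else 0) + s k * p.1.2 i) : E.curlVec = 0 := by
  have hBpos := E.B_pos
  have hPB : (fun i => (slitAB H).G i + N.T i) = fun i => ((slitAB H).G i
      + τ * (slitAB H).q * (slitAB H).up (slitAB H).b i)
      + 2 * (slitAB H).q * (slitAB H).V i * N.mi := by
    funext i
    rw [AlphaBeta.Root.T, hσ, hr]
    linear_combination ((slitAB H).q * τ * (slitAB H).up (slitAB H).b i) * N.D_Di
  choose g hg hgR using fun i k => FibreCalculus.curv_pole_three (isStable_regular N)
    (P := fun i => (slitAB H).G i + τ * (slitAB H).q * (slitAB H).up (slitAB H).b i)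
    (B := fun i => 2 * (slitAB H).q * (slitAB H).V i)
    (fun i => add_mem (G_mem_regular N i) (mul_mem (mul_mem hτ
      (q_mem_regular N)) (upb_mem_regular N i)))
    (fun i => mul_mem (mul_mem (ofNat_mem _ 2) (q_mem_regular N)) (V_mem_regular N i))
    (sub_mem (α_mem_regular N) (β_mem_regular N)) N.m_mi
    (by rw [AlphaBeta.along_smul, N.along_V_m hσ, mul_zero]) i k
  rw [hPB] at hR
  obtain ⟨S, hS⟩ := IsAlgClosed.exists_pow_nat_eq (1 - ((E.B : ℂ)⁻¹) ^ 2) (n := 2) (by norm_num)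
  have h : ((E.B : ℂ)⁻¹) ^ 2 + S ^ 2 = 1 := by rw [hS]; ring
  have hcos := HasRatVal.cos h
  have hsin := HasRatVal.sin h
  have hBc : (E.B : ℂ) ≠ 0 := by exact_mod_cast hBpos.ne'
  have hD0 : HasRatVal ((E.B : ℂ)⁻¹ + S * Complex.I)
      (fun θ => ev (E.pt H θ) (N.α - (slitAB H).β)) 0 := by
    simp only [map_sub, ev_β_pt, E.ev_α_pt N hα]
    have := (HasRatVal.const ((E.B : ℂ)⁻¹ + S * Complex.I) 1).sub (hcos.const_mul E.B)
    rwa [mul_inv_cancel₀ hBc, Complex.ofReal_one, sub_self] at this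
  have hM : HasRatVal ((E.B : ℂ)⁻¹ + S * Complex.I) (fun θ =>
      E.contr (E.perp θ) (fun i k => ev (E.pt H θ) (poleM N ((calculus H.slit).spray
        (fun i => (slitAB H).G i + τ * (slitAB H).q * (slitAB H).up (slitAB H).b i)
          (N.α - (slitAB H).β)) i k))
      - E.contr E.z (fun i k => ev (E.pt H θ) (poleM N ((calculus H.slit).spray
        (fun i => (slitAB H).G i + τ * (slitAB H).q * (slitAB H).up (slitAB H).b i)
          (N.α - (slitAB H).β)) i k)))
      (4 * S ^ 2 * (ip (a E.x) E.curlVec E.curlVec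
        + 3 * ip (curlMat a b E.x) E.z E.u ^ 2 : ℝ)) := by
    have := ((hcos.mul (hsin.pow 2)).const_mul
      (4 * E.B * ip (a E.x) E.curlVec E.curlVec)).add
      ((hsin.pow 2).const_mul (12 * ip (curlMat a b E.x) E.z E.u ^ 2))
    have hv : 4 * S ^ 2 * ((ip (a E.x) E.curlVec E.curlVec
        + 3 * ip (curlMat a b E.x) E.z E.u ^ 2 : ℝ) : ℂ)
      = ((4 * E.B * ip (a E.x) E.curlVec E.curlVec : ℝ) : ℂ) * ((E.B : ℂ)⁻¹ * S ^ 2)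
        + ((12 * ip (curlMat a b E.x) E.z E.u ^ 2 : ℝ) : ℂ) * S ^ 2 := by
      push_cast
      field_simp
      ring
    rw [hv]
    convert this using 2 with θ
    have h1 : ∀ v, ip (curlMat a b E.x) (E.perp θ) v
        = Real.cos θ * ip (curlMat a b E.x) E.u v := fun v => by
      rw [perp, ip_add_left, ip_smul_left, ip_smul_left, hcurl, mul_zero, zero_add]
    have h2 : ip (curlMat a b E.x) E.u E.u = 0 := by
      have := ip_curlMat_comm (a := a) (b := b) E.x E.u E.u
      linarith
    rw [E.contr_poleM hcurl N hα, E.contr_poleM hcurl N hα, E.ip_perp_dir H, E.ip_z_dir H,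
      E.b_dot_perp, E.b_dot_z, h1, h1, h2, E.ip_curl_u_curlVec H]
    ring
  have h0 := E.eq_zero_of_pole hR hgR h
    (fun i k => E.exists_val_regular N hα h (hg i k)) hD0 hM
  have hS0 : S ≠ 0 := by
    rintro rfl
    have : (E.B : ℂ) ^ 2 = 1 := by
      field_simp at h
      linear_combination -h
    have h3 : E.B ^ 2 = 1 := by exact_mod_cast this
    nlinarith [E.B_lt_one]
  have h4 : ip (a E.x) E.curlVec E.curlVec + 3 * ip (curlMat a b E.x) E.z E.u ^ 2 = 0 := by
    have := (mul_eq_zero.1 h0).resolve_left (by simp [hS0])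
    exact_mod_cast this
  by_contra hne
  have := ip_pos (H.posDef _ E.mem) hne
  nlinarith [sq_nonneg (ip (curlMat a b E.x) E.z E.u)]

end SliceFrame

end

section

open TopologicalSpace

variable {n : ℕ} {U : Set (Vec n)} {a : Vec n → Matrix (Fin n) (Fin n) ℝ} {b : Vec n → Vec n}

lemma ip_single (g : Matrix (Fin n) (Fin n) ℝ) (i j : Fin n) :
    ip g (Pi.single i 1) (Pi.single j 1) = g i j := by
  simp [ip]

namespace SmoothAlg

variable {H : SquareData U a b} (N : (slitAB H).Root) (hn : 3 ≤ n)
  (hα : ∀ p, ev p N.α = alphaOf a p.1.1 p.1.2)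
  (hR : ∀ p, ∃ (r : ℝ) (s : Vec n), ∀ i k,
    ev p ((calculus H.slit).curv (fun i => (slitAB H).G i + N.T i) i k)
      = r * (if i = k then 1 else 0) + s k * p.1.2 i)
include hn hα hR

lemma curlMat_mulVec {x : Vec n} (hx : x ∈ U) (v : Vec n) : (curlMat a b x).mulVec v = 0 := by
  obtain ⟨t, ht⟩ := exists_rep_tauOf H H.slit_fst
  have hσ : (slitAB H).σ = 0 := ext_ev fun p => by
    rw [ev_σ, curl_sharp N hn hα hR p.2.1, map_zero]
  have hr : (slitAB H).r00 = t * (slitAB H).D := ext_ev fun p => by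
    rw [ev_r00, cov_quadratic N hn hα hR p.2.1, map_mul, ev_D, ht p]
    rfl
  obtain ⟨E, r, s, rfl, rfl⟩ := SliceFrame.exists_eq_smul_add_smul H hn hx v
  have hcurl : ∀ v, ip (curlMat a b E.x) E.e v = 0 := fun v => by
    have h := curl_sharp N hn hα hR E.mem v
    rw [E.sharp_eq, ip_smul_left] at h
    exact (mul_eq_zero.1 h).resolve_left E.B_pos.ne'
  have hu : (curlMat a b E.x).mulVec E.u = 0 := by
    have h := E.curlVec_eq_zero hcurl N hα (mem_regular_of_rep N ht) hσ hr hR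
    have h2 := congrArg (a E.x).mulVec h
    rwa [SliceFrame.curlVec, Matrix.mulVec_mulVec,
      Matrix.mul_nonsing_inv _ (H.posDef _ E.mem).det_pos.ne'.isUnit, Matrix.one_mulVec,
      Matrix.mulVec_zero] at h2
  have he : (curlMat a b E.x).mulVec E.e = 0 := by
    refine dotProduct_eq_zero _ fun w => ?_
    rw [dotProduct_comm, ← ip, SliceFrame.ip_curlMat_comm, hcurl, neg_zero]
  rw [Matrix.mulVec_add, Matrix.mulVec_smul, Matrix.mulVec_smul, hu, he, smul_zero, smul_zero,
    add_zero]

lemma covDeriv_eq {x : Vec n} (hx : x ∈ U) (i j : Fin n) : covDeriv a b i j x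
    = tauOf a b x * ((1 + 2 * bsq a b x) * a x i j - 3 * b x i * b x j) := by
  have hc : ∀ v w, ip (covMat a b x) v w = ip (covMat a b x) w v := fun v w => by
    have h := ip_curlMat (a := a) (b := b) x v w
    rw [ip, curlMat_mulVec N hn hα hR hx, dotProduct_zero] at h
    linarith
  have hq := cov_quadratic N hn hα hR hx
  have h1 := hq (Pi.single i 1 + Pi.single j 1)
  simp only [ip_add_left, ip_add_right, dotProduct_add] at h1
  rw [hq, hq, hc (Pi.single j 1) (Pi.single i 1),
    ip_comm (H.isSymm x hx) (Pi.single j 1) (Pi.single i 1), dotProduct_single_one,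
    dotProduct_single_one, ip_single (covMat a b x) i j, ip_single (a x) i j] at h1
  rw [← Matrix.of_apply (f := fun i j => covDeriv a b i j x) i j, ← covMat]
  linear_combination h1 / 2

end SmoothAlg

end

section

open TopologicalSpace

variable {n : ℕ} {U : Set (Vec n)} {a : Vec n → Matrix (Fin n) (Fin n) ℝ} {b : Vec n → Vec n}

namespace SmoothAlg

variable {H : SquareData U a b} {τ : Vec n → ℝ} {t : SmoothAlg H.slit}
  (ht : Rep t fun x _ => τ x)
  (hcov : ∀ x ∈ U, ∀ i j,
    covDeriv a b i j x = τ x * ((1 + 2 * bsq a b x) * a x i j - 3 * b x i * b x j))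

include ht hcov in
lemma cov_eq_of_covDeriv (i j : Fin n) : (slitAB H).cov i j
    = t * ((slitAB H).c0 * (slitAB H).a i j - 3 * (slitAB H).b i * (slitAB H).b j) :=
  ext_ev fun p => by
    refine (rep_cov H H.slit_fst i j p).trans ((hcov _ p.2.1 i j).trans ?_)
    rw [slitAB]
    simp only [AlphaBeta.c0, map_mul, map_sub, map_add, map_ofNat, map_one, ht p,
      rep_a H H.slit_fst i j p, rep_b H H.slit_fst _ p, rep_bsq H H.slit_fst p]

lemma ev_curv_G (i k : Fin n) (p : H.slit) : ev p ((calculus H.slit).curv (slitAB H).G i k)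
    = curvOfSpray (sprayOf a) i k p.1.1 p.1.2 :=
  rep_curv (rep_G H H.slit_fst) i k p

include H in
lemma sum_curvOfSpray_mul_low {x y : Vec n} (hx : x ∈ U) (hy : y ≠ 0) (k : Fin n) :
    ∑ l, curvOfSpray (sprayOf a) l k x y * (a x).mulVec y l = 0 := by
  have h := congrArg (ev (⟨(x, y), hx, hy⟩ : H.slit)) ((slitAB H).sum_curv_low k)
  simpa only [map_sum, map_mul, map_zero, ev_curv_G, ev_low_y] using h

include ht in
lemma ev_X_of_rep (k : Fin n) (p : H.slit) : ev p ((calculus H.slit).X k t) = pd τ k p.1.1 :=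
  ht.pdx k p

include ht hcov

lemma sum_curvOfSpray_mul_b {x y : Vec n} (hx : x ∈ U) (hy : y ≠ 0) (k : Fin n) :
    ∑ l, curvOfSpray (sprayOf a) l k x y * b x l
      = (∑ j, y j * pd τ j x)
          * ((1 + 2 * bsq a b x) * (a x).mulVec y k - 3 * betaOf b x y * b x k)
        - pd τ k x * ((1 + 2 * bsq a b x) * ip (a x) y y - 3 * betaOf b x y ^ 2)
        - τ x ^ 2 * (7 + 2 * bsq a b x)
          * (ip (a x) y y * b x k - betaOf b x y * (a x).mulVec y k) := by
  have h := congrArg (ev (⟨(x, y), hx, hy⟩ : H.slit))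
    ((slitAB H).sum_curv_b (cov_eq_of_covDeriv ht hcov) (Y_of_rep ht) k)
  simpa only [AlphaBeta.c0, map_sum, map_mul, map_zero, map_sub, map_add, map_pow, map_ofNat,
    map_one, ev_curv_G, ev_low_y, ev_b, ev_bsq, ev_q, ev_β, ev_y, ev_X_of_rep ht, ht _] using h

lemma exists_curvOfSpray_eq (N : (slitAB H).Root)
    (hR : ∀ p, ∃ (r : ℝ) (s : Vec n), ∀ i k,
      ev p ((calculus H.slit).curv (fun i => (slitAB H).G i + N.T i) i k)
        = r * (if i = k then 1 else 0) + s k * p.1.2 i)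
    {x y : Vec n} (hx : x ∈ U) (hy : y ≠ 0) : ∃ (r : ℝ) (s : Vec n), ∀ i k,
      curvOfSpray (sprayOf a) i k x y = r * (if i = k then 1 else 0) + s k * y i
        - 2 * (a x)⁻¹.mulVec (b x) i * (ip (a x) y y * (pd τ k x - τ x ^ 2 * b x k)
          - (a x).mulVec y k * (∑ j, y j * pd τ j x - τ x ^ 2 * betaOf b x y)) := by
  obtain ⟨r, s, h⟩ := hR ⟨(x, y), hx, hy⟩
  have hc := cov_eq_of_covDeriv ht hcov
  have hT : (fun i => (slitAB H).G i + N.T i)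
      = fun i => (slitAB H).G i + t * (slitAB H).q * (slitAB H).up (slitAB H).b i := by
    funext i
    have hV : (slitAB H).V i = 0 := by
      simp [AlphaBeta.V, AlphaBeta.up, AlphaBeta.s0_of_cov _ hc]
    have hσ : (slitAB H).σ = 0 := by
      simp [AlphaBeta.σ, AlphaBeta.dot, AlphaBeta.s0_of_cov _ hc]
    rw [AlphaBeta.Root.T, hV, hσ, AlphaBeta.r00_of_cov _ hc]
    linear_combination ((slitAB H).q * t * (slitAB H).up (slitAB H).b i) * N.D_Di
  rw [hT] at h
  refine ⟨r - 2 * τ x ^ 2 * (1 + 2 * bsq a b x) * ip (a x) y y,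
    fun k => s k + 2 * τ x ^ 2 * (1 + 2 * bsq a b x) * (a x).mulVec y k, fun i k => ?_⟩
  have h1 := h i k
  rw [(slitAB H).curv_add_upb hc (Y_of_rep ht) i k] at h1
  have hδ : ev (⟨(x, y), hx, hy⟩ : H.slit) (if i = k then 1 else 0)
      = if i = k then (1 : ℝ) else 0 := by split_ifs <;> simp
  simp only [AlphaBeta.c0, map_sum, map_mul, map_sub, map_add, map_pow, map_ofNat, hδ,
    map_one, ev_curv_G, ev_low_y, ev_b, ev_bsq, ev_q, ev_β, ev_y, ev_X_of_rep ht, ht _, ev_upb]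
    at h1
  linear_combination h1

/-- The differential of the conformal factor is proportional to the one-form. -/
lemma bsq_mul_pd {x : Vec n} (hx : x ∈ U) (k : Fin n) : bsq a b x * pd τ k x
    = (∑ j, (a x)⁻¹.mulVec (b x) j * pd τ j x) * b x k := by
  have hb0 := H.bsq_pos x hx
  have hb1 := H.bsq_lt_one x hx
  have hg := H.posDef x hx
  have hy : (a x)⁻¹.mulVec (b x) ≠ 0 := fun h => by
    rw [SquareData.bsq_eq, h, dotProduct_zero] at hb0
    exact lt_irrefl _ hb0
  have h1 := sum_curvOfSpray_mul_low (H := H) hx hy k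
  have h2 := sum_curvOfSpray_mul_b ht hcov hx hy k
  have hlow : (a x).mulVec ((a x)⁻¹.mulVec (b x)) = b x := by
    rw [Matrix.mulVec_mulVec, Matrix.mul_nonsing_inv _ hg.det_pos.ne'.isUnit, Matrix.one_mulVec]
  have hβ : betaOf b x ((a x)⁻¹.mulVec (b x)) = bsq a b x := (SquareData.bsq_eq x).symm
  rw [hlow] at h1 h2
  rw [h1, hβ, H.ip_sharp_sharp hx] at h2
  refine mul_left_cancel₀ (sub_pos.2 hb1).ne' ?_
  linear_combination h2

end SmoothAlg

end

section

open TopologicalSpace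

variable {n : ℕ} {U : Set (Vec n)} {a : Vec n → Matrix (Fin n) (Fin n) ℝ} {b : Vec n → Vec n}

/-- The curvature coefficient of the metric, in terms of the conformal factor. -/
def lamOf (a : Vec n → Matrix (Fin n) (Fin n) ℝ) (b : Vec n → Vec n) (τ : Vec n → ℝ)
    (x : Vec n) : ℝ :=
  τ x ^ 2 - (∑ k, (a x)⁻¹.mulVec (b x) k * pd τ k x) / bsq a b x - 4 * (2 + bsq a b x) * τ x ^ 2

namespace SmoothAlg

variable {H : SquareData U a b} {τ : Vec n → ℝ} {t : SmoothAlg H.slit}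
  (ht : Rep t fun x _ => τ x)
  (hcov : ∀ x ∈ U, ∀ i j,
    covDeriv a b i j x = τ x * ((1 + 2 * bsq a b x) * a x i j - 3 * b x i * b x j))
  (N : (slitAB H).Root)
  (hR : ∀ p, ∃ (r : ℝ) (s : Vec n), ∀ i k,
    ev p ((calculus H.slit).curv (fun i => (slitAB H).G i + N.T i) i k)
      = r * (if i = k then 1 else 0) + s k * p.1.2 i)

include ht hcov

lemma pd_eq {x : Vec n} (hx : x ∈ U) (k : Fin n) :
    pd τ k x = (-(7 + 4 * bsq a b x) * τ x ^ 2 - lamOf a b τ x) * b x k := by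
  have h := bsq_mul_pd ht hcov hx k
  have hb0 := (H.bsq_pos x hx).ne'
  refine mul_left_cancel₀ hb0 ?_
  rw [h, lamOf]
  field_simp
  ring

include hR in
lemma curvOfSpray_eq_of_gap {x y : Vec n} (hx : x ∈ U)
    (hgap : betaOf b x y ^ 2 < bsq a b x * ip (a x) y y) (i k : Fin n) :
    curvOfSpray (sprayOf a) i k x y
      = lamOf a b τ x * (ip (a x) y y * (if i = k then 1 else 0) - y i * (a x).mulVec y k)
        + 2 * (lamOf a b τ x + 4 * (2 + bsq a b x) * τ x ^ 2)
          * (betaOf b x y ^ 2 * (if i = k then 1 else 0)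
            + ip (a x) y y * (a x)⁻¹.mulVec (b x) i * b x k
            - betaOf b x y * (a x)⁻¹.mulVec (b x) i * (a x).mulVec y k
            - betaOf b x y * b x k * y i) := by
  have hg := H.posDef x hx
  have hy : y ≠ 0 := by
    rintro rfl
    rw [ip_zero_left, mul_zero] at hgap
    exact absurd hgap (not_lt.2 (sq_nonneg _))
  have hq := (ip_pos hg hy).ne'
  obtain ⟨r, s, h⟩ := exists_curvOfSpray_eq ht hcov N hR hx hy
  set L := lamOf a b τ x
  set q := ip (a x) y y with hqdef
  set β := betaOf b x y with hβdef
  set B := bsq a b x with hB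
  have hdτ := pd_eq ht hcov hx
  have hS : ∑ j, y j * pd τ j x = (-(7 + 4 * B) * τ x ^ 2 - L) * β := by
    rw [hβdef, betaOf, Finset.mul_sum]
    refine Finset.sum_congr rfl fun j _ => ?_
    rw [hdτ]
    ring
  have hlowy : ∑ l, y l * (a x).mulVec y l = q := rfl
  have hlowb : ∑ l, (a x)⁻¹.mulVec (b x) l * (a x).mulVec y l = β := ip_sharp hg (b x) y
  have hyb : ∑ l, y l * b x l = β := by
    rw [hβdef, betaOf]
    exact Finset.sum_congr rfl fun j _ => mul_comm _ _
  have hbb : ∑ l, (a x)⁻¹.mulVec (b x) l * b x l = B := by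
    rw [hB, SquareData.bsq_eq, dotProduct_comm]
    rfl
  have hcontr : ∀ (w : Vec n) k, ∑ l, curvOfSpray (sprayOf a) l k x y * w l
      = r * w k + s k * ∑ l, y l * w l - 2 * (∑ l, (a x)⁻¹.mulVec (b x) l * w l)
        * (-L - 4 * (2 + B) * τ x ^ 2) * (q * b x k - β * (a x).mulVec y k) := fun w k => by
    have : r * w k = ∑ l, r * (if l = k then 1 else 0) * w l := by simp
    rw [this, Finset.mul_sum, Finset.mul_sum, Finset.sum_mul, Finset.sum_mul,
      ← Finset.sum_add_distrib, ← Finset.sum_sub_distrib]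
    refine Finset.sum_congr rfl fun l _ => ?_
    rw [h, hdτ, hS]
    ring
  have hlow : ∀ k, r * (a x).mulVec y k + s k * q
      = 2 * β * (-L - 4 * (2 + B) * τ x ^ 2) * (q * b x k - β * (a x).mulVec y k) := fun k => by
    have h1 := sum_curvOfSpray_mul_low (H := H) hx hy k
    rw [hcontr, hlowy, hlowb] at h1
    linear_combination h1
  obtain ⟨m, hm⟩ : ∃ m, q * b x m - β * (a x).mulVec y m ≠ 0 := by
    by_contra! h0
    have h1 : ∑ m, (a x)⁻¹.mulVec (b x) m * (q * b x m - β * (a x).mulVec y m) = q * B - β * β := by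
      rw [← hbb, ← hlowb, Finset.mul_sum, Finset.mul_sum, ← Finset.sum_sub_distrib]
      refine Finset.sum_congr rfl fun l _ => by rw [hlowb]; ring
    simp only [h0, mul_zero, Finset.sum_const_zero] at h1
    nlinarith
  have hr : r = L * q + 2 * (L + 4 * (2 + B) * τ x ^ 2) * β ^ 2 := by
    have h1 := sum_curvOfSpray_mul_b ht hcov hx hy m
    rw [hcontr, hyb, hbb, hS, hdτ] at h1
    refine mul_right_cancel₀ hm ?_
    linear_combination q * h1 - β * hlow m
  have hs : s k = -L * (a x).mulVec y k - 2 * (L + 4 * (2 + B) * τ x ^ 2) * β * b x k := by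
    refine mul_right_cancel₀ hq ?_
    have h1 := hlow k
    rw [hr] at h1
    linear_combination h1
  rw [h, hs, hr, hdτ, hS]
  ring

include hR in
lemma curvOfSpray_eq (hn : 3 ≤ n) {x : Vec n} (hx : x ∈ U) (y : Vec n) (i k : Fin n) :
    curvOfSpray (sprayOf a) i k x y
      = lamOf a b τ x * (ip (a x) y y * (if i = k then 1 else 0) - y i * (a x).mulVec y k)
        + 2 * (lamOf a b τ x + 4 * (2 + bsq a b x) * τ x ^ 2)
          * (betaOf b x y ^ 2 * (if i = k then 1 else 0)
            + ip (a x) y y * (a x)⁻¹.mulVec (b x) i * b x k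
            - betaOf b x y * (a x)⁻¹.mulVec (b x) i * (a x).mulVec y k
            - betaOf b x y * b x k * y i) := by
  have hg := H.posDef x hx
  obtain ⟨v, hvv, hbv, hyv⟩ := exists_unit_orthogonal hg hn ((a x)⁻¹.mulVec (b x)) y
  rw [ip_sharp hg] at hbv
  have hβ : ∀ s : ℝ, betaOf b x (y + s • v) = betaOf b x y := fun s => by
    change b x ⬝ᵥ (y + s • v) = b x ⬝ᵥ y
    rw [dotProduct_add, dotProduct_smul, hbv, smul_zero, add_zero]
  have hq : ∀ s : ℝ, ip (a x) (y + s • v) (y + s • v) = ip (a x) y y + s ^ 2 := fun s => by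
    simp only [ip_add_left, ip_add_right, ip_smul_left, ip_smul_right, hvv, hyv, ip_symm hg v y]
    ring
  have hcurv : Continuous fun s : ℝ => curvOfSpray (sprayOf a) i k x (y + s • v) := by
    have h1 : ∀ s : ℝ, curvOfSpray (sprayOf a) i k x (y + s • v)
        = zeroExtend ((calculus H.total).curv (alphaBeta H H.total_fst).G i k).1
          (x, y + s • v) := fun s => by
      rw [zeroExtend_eq_ev _ (⟨(x, y + s • v), hx⟩ : H.total),
        rep_curv (rep_G H H.total_fst) i k]
    simp only [h1]
    exact (contDiffOn_zeroExtend _).continuousOn.comp_continuous (by fun_prop) fun s => hx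
  have h := Continuous.ext_on (dense_compl_singleton (0 : ℝ)) hcurv
    (g := fun s => lamOf a b τ x * ((ip (a x) y y + s ^ 2) * (if i = k then 1 else 0)
          - (y + s • v) i * (a x).mulVec (y + s • v) k)
        + 2 * (lamOf a b τ x + 4 * (2 + bsq a b x) * τ x ^ 2)
          * (betaOf b x y ^ 2 * (if i = k then 1 else 0)
            + (ip (a x) y y + s ^ 2) * (a x)⁻¹.mulVec (b x) i * b x k
            - betaOf b x y * (a x)⁻¹.mulVec (b x) i * (a x).mulVec (y + s • v) k
            - betaOf b x y * b x k * (y + s • v) i))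
    (by simp only [Matrix.mulVec, dotProduct, Pi.add_apply, Pi.smul_apply]; fun_prop)
    (fun s hs => by
      dsimp only
      rw [← hq, ← hβ s]
      refine curvOfSpray_eq_of_gap ht hcov N hR hx ?_ i k
      rw [hβ, hq]
      have h1 := H.beta_sq_le hx y
      have h2 := mul_pos (H.bsq_pos x hx) (pow_pos (abs_pos.2 hs) 2)
      rw [sq_abs] at h2
      linarith)
  have h0 := congrFun h 0
  simpa only [zero_smul, add_zero, zero_pow two_ne_zero] using h0

end SmoothAlg

namespace SmoothAlg

variable (H : SquareData U a b)

include H in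
lemma contDiffOn_of_rep {f : SmoothAlg H.total} {F : Vec n → ℝ} (h : Rep f fun x _ => F x) :
    ContDiffOn ℝ (⊤ : ℕ∞) F U := by
  have h1 : ContDiffOn ℝ (⊤ : ℕ∞) (fun x => zeroExtend f.1 (x, (0 : Vec n))) U :=
    (contDiffOn_zeroExtend f).comp (by fun_prop) fun x hx => hx
  refine h1.congr fun x hx => ?_
  rw [zeroExtend_eq_ev f (⟨(x, 0), hx⟩ : H.total), h]

include H in
lemma contDiffOn_tauOf : ContDiffOn ℝ (⊤ : ℕ∞) (tauOf a b) U := by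
  obtain ⟨t, ht⟩ := exists_rep_tauOf H H.total_fst
  exact contDiffOn_of_rep H ht

include H in
lemma contDiffOn_lamOf : ContDiffOn ℝ (⊤ : ℕ∞) (lamOf a b (tauOf a b)) U := by
  obtain ⟨t, ht⟩ := exists_rep_tauOf H H.total_fst
  have hb := rep_bsq H H.total_fst
  obtain ⟨d, hd⟩ := exists_inv (alphaBeta H H.total_fst).bsq fun p => by
    rw [hb p]
    exact (H.bsq_pos _ p.2).ne'
  refine contDiffOn_of_rep H (f := t ^ 2 - (∑ k, (alphaBeta H H.total_fst).up
    (alphaBeta H H.total_fst).b k * (calculus H.total).X k t) * d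
      - 4 * (2 + (alphaBeta H H.total_fst).bsq) * t ^ 2) fun p => ?_
  have h := congrArg (ev p) hd
  rw [map_mul, map_one, hb p] at h
  simp only [map_sub, map_mul, map_sum, map_pow, map_add, map_ofNat, ht p, hb p,
    rep_upb H H.total_fst _ p, ht.pdx _ p, lamOf, div_eq_mul_inv, inv_eq_of_mul_eq_one_right h]
  rfl

end SmoothAlg

end

/-- Theorem 3.1 (necessity): an `n ≥ 3`-dimensional square metric `F = (α+β)²/α`
of scalar flag curvature satisfies (E1)–(E3) for some scalar functions `τ`, `λ`. -/
theorem stmt_1 {n : ℕ} (hn : 3 ≤ n) (U : Set (Vec n))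
    (hU : IsOpen U) (hconn : IsConnected U)
    (a : Vec n → Matrix (Fin n) (Fin n) ℝ) (b : Vec n → Vec n)
    (ha : ∀ i j, ContDiffOn ℝ (⊤ : ℕ∞) (fun x => a x i j) U)
    (hsym : ∀ x ∈ U, (a x).IsSymm)
    (hpos : ∀ x ∈ U, (a x).PosDef)
    (hb : ∀ i, ContDiffOn ℝ (⊤ : ℕ∞) (fun x => b x i) U)
    (hb2 : ∀ x ∈ U, 0 < bsq a b x ∧ bsq a b x < 1)
    (hscal : IsScalarFlag U (sqMetric a b)) :
    ∃ τ lam : Vec n → ℝ, ContDiffOn ℝ (⊤ : ℕ∞) τ U ∧ ContDiffOn ℝ (⊤ : ℕ∞) lam U ∧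
      E123 U a b τ lam := by
  have H : SquareData U a b :=
    ⟨hU, ha, hb, hsym, hpos, fun x hx => (hb2 x hx).1, fun x hx => (hb2 x hx).2⟩
  obtain ⟨N, Fi, hFi, hα, hF⟩ := SmoothAlg.exists_root H
  have hR := SmoothAlg.exists_curv_eq N hα hF hFi hscal
  have hcov : ∀ x ∈ U, ∀ i j, covDeriv a b i j x =
      tauOf a b x * ((1 + 2 * bsq a b x) * a x i j - 3 * b x i * b x j) :=
    fun x hx => SmoothAlg.covDeriv_eq N hn hα hR hx
  obtain ⟨t, ht⟩ := SmoothAlg.exists_rep_tauOf H H.slit_fst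
  refine ⟨tauOf a b, lamOf a b (tauOf a b), SmoothAlg.contDiffOn_tauOf H,
    SmoothAlg.contDiffOn_lamOf H, hcov, fun x hx y i k => ?_,
    fun x hx i => SmoothAlg.pd_eq ht hcov hx i⟩
  rw [H.alpha_sq hx]
  exact SmoothAlg.curvOfSpray_eq ht hcov N hR hn hx y i k
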